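/- Let 1 < p < n and q = p/(p-1). For every smooth compactly supported function f on ℝ^n, (∫_{∂ℝ^n_+} |f(0,x)|^{p(n-1)/(n-p)} dx)^{(n-p)/(n-1)} ≤ d_2 (ℰ_p(f)^p + ‖∂f/∂t‖_p^p) ≤ d_2 ∫_{ℝ^n_+} (|∇̃f|^p + |∂f/∂t|^p) dx dt, where d_2 = (p^{1/p} q^{1/q})^{-1/p} · p 𝒜_{n,p}. -/

import Mathlib

open MeasureTheory Real Set
open scoped RealInnerProductSpace ENNReal NNReal Pointwise

noncomputable section

namespace AffineTrace

/-- `ω s = π^(s/2) / Γ(s/2 + 1)` -/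
def w (s : ℝ) : ℝ := Real.pi ^ (s / 2) / Real.Gamma (s / 2 + 1)

/-- the constant `c_{m,p} = (m ω_m)^{1/m} (m ω_m ω_{p-1} / (2 ω_{m+p-2}))^{1/p}` -/
def cc (m : ℕ) (p : ℝ) : ℝ :=
  ((m : ℝ) * w m) ^ ((m : ℝ)⁻¹) *
    ((m : ℝ) * w m * w (p - 1) / (2 * w ((m : ℝ) + p - 2))) ^ p⁻¹

/-- the constant `a_{m,p} = ω_{m+p} / (ω_2 ω_m ω_{p-1})` -/
def aa (m : ℕ) (p : ℝ) : ℝ := w ((m : ℝ) + p) / (w 2 * w m * w (p - 1))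

/-- the open half-space `ℝⁿ₊ = (0,∞) × ℝ^{n-1}` -/
def H (n : ℕ) : Set (ℝ × EuclideanSpace ℝ (Fin (n - 1))) := {y | 0 < y.1}

/-- `∂f/∂t`, the partial derivative in the `t`-variable -/
def dt {n : ℕ} (f : ℝ × EuclideanSpace ℝ (Fin (n - 1)) → ℝ)
    (y : ℝ × EuclideanSpace ℝ (Fin (n - 1))) : ℝ :=
  fderiv ℝ f y (1, 0)

/-- `∇_ξ f = ∇̃f ⬝ ξ`, the directional derivative in the direction `(0, ξ)` -/
def dxi {n : ℕ} (f : ℝ × EuclideanSpace ℝ (Fin (n - 1)) → ℝ)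
    (ξ : EuclideanSpace ℝ (Fin (n - 1))) (y : ℝ × EuclideanSpace ℝ (Fin (n - 1))) : ℝ :=
  fderiv ℝ f y (0, ξ)

/-- `∇̃f`, the gradient in the `x`-variable -/
def gradx {n : ℕ} (f : ℝ × EuclideanSpace ℝ (Fin (n - 1)) → ℝ)
    (y : ℝ × EuclideanSpace ℝ (Fin (n - 1))) : EuclideanSpace ℝ (Fin (n - 1)) :=
  gradient (fun x => f (y.1, x)) y.2

/-- the `L^p` norm (w.r.t. Lebesgue measure) over the half-space `ℝⁿ₊` -/
def lp (n : ℕ) (p : ℝ) (g : ℝ × EuclideanSpace ℝ (Fin (n - 1)) → ℝ) : ℝ :=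
  (∫ y in H n, |g y| ^ p) ^ p⁻¹

/-- the surface measure on the unit sphere `𝕊^{m-1}` of `ℝ^m` -/
def sphMeasure (m : ℕ) : Measure (Metric.sphere (0 : EuclideanSpace ℝ (Fin m)) 1) :=
  (volume : Measure (EuclideanSpace ℝ (Fin m))).toSphere

/-- `Z_p(f) = (∫_{𝕊^{n-2}} ‖∇_ξ f‖_p^{1-n} dξ)^{1/(1-n)}` -/
def Z (n : ℕ) (p : ℝ) (f : ℝ × EuclideanSpace ℝ (Fin (n - 1)) → ℝ) : ℝ :=
  (∫ ξ, lp n p (dxi f (ξ : EuclideanSpace ℝ (Fin (n - 1)))) ^ (1 - (n : ℝ))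
      ∂(sphMeasure (n - 1))) ^ (1 - (n : ℝ))⁻¹

/-- the affine energy `ℰ_p(f) = c_{n-1,p} Z_p(f)` -/
def Ep (n : ℕ) (p : ℝ) (f : ℝ × EuclideanSpace ℝ (Fin (n - 1)) → ℝ) : ℝ :=
  cc (n - 1) p * Z n p f

/-- the boundary trace integral `∫_{∂ℝⁿ₊} |f(0,x)|^r dx` -/
def bdry (n : ℕ) (r : ℝ) (f : ℝ × EuclideanSpace ℝ (Fin (n - 1)) → ℝ) : ℝ :=
  ∫ x : EuclideanSpace ℝ (Fin (n - 1)), |f (0, x)| ^ r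

/-- the duality pairing on `ℝ × ℝ^m` -/
def pairP {m : ℕ} (y z : ℝ × EuclideanSpace ℝ (Fin m)) : ℝ := y.1 * z.1 + ⟪y.2, z.2⟫

/-- the Legendre transform of a function on `ℝ × ℝ^m` -/
def legendreP {m : ℕ} (C : ℝ × EuclideanSpace ℝ (Fin m) → ℝ)
    (y : ℝ × EuclideanSpace ℝ (Fin m)) : ℝ :=
  ⨆ z, (pairP y z - C z)

/-- the Legendre transform of a function on `ℝ^m` -/
def legendreE {m : ℕ} (C : EuclideanSpace ℝ (Fin m) → ℝ) (y : EuclideanSpace ℝ (Fin m)) : ℝ :=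
  ⨆ z, (⟪y, z⟫ - C z)

/-- the `m`-dimensional volume of a subset of `ℝ^m`, as a real number -/
def vol {m : ℕ} (K : Set (EuclideanSpace ℝ (Fin m))) : ℝ := (volume K).toReal

/-- the support function of a subset of `ℝ^m` -/
def suppFn {m : ℕ} (K : Set (EuclideanSpace ℝ (Fin m))) (y : EuclideanSpace ℝ (Fin m)) : ℝ :=
  sSup ((fun z => ⟪y, z⟫) '' K)

/-- the polar body of a subset of `ℝ^m` -/
def polar {m : ℕ} (K : Set (EuclideanSpace ℝ (Fin m))) : Set (EuclideanSpace ℝ (Fin m)) :=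
  {y | ∀ z ∈ K, ⟪y, z⟫ ≤ 1}

/-- the `L_p`-centroid body `Γ_p K` of a convex body `K ⊂ ℝ^m`: the convex body whose
support function is `h(y) = ((a_{m,p} vol K)⁻¹ ∫_K |⟨y,z⟩|^p dz)^{1/p}` -/
def centroid (m : ℕ) (p : ℝ) (K : Set (EuclideanSpace ℝ (Fin m))) :
    Set (EuclideanSpace ℝ (Fin m)) :=
  {x | ∀ y, ⟪x, y⟫ ≤ ((aa m p * vol K)⁻¹ * ∫ z in K, |⟪y, z⟫| ^ p) ^ p⁻¹}

/-- the convex body `L_f = {ξ : ‖∇_ξ f‖_p ≤ 1}` in `ℝ^{n-1}` -/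
def Lbody (n : ℕ) (p : ℝ) (f : ℝ × EuclideanSpace ℝ (Fin (n - 1)) → ℝ) :
    Set (EuclideanSpace ℝ (Fin (n - 1))) :=
  {ξ | lp n p (dxi f ξ) ≤ 1}

/-- the constant `α_f = (p/(p-1)) ‖∂f/∂t‖_p^{-p} Z_p(f)^{1-n}` -/
def alpha (n : ℕ) (p : ℝ) (f : ℝ × EuclideanSpace ℝ (Fin (n - 1)) → ℝ) : ℝ :=
  p / (p - 1) * lp n p (dt f) ^ (-p) * Z n p f ^ (1 - (n : ℝ))

/-- `D_f^*(x) = ∫_{𝕊^{n-2}} ‖∇_ξ f‖_p^{1-n-p} |⟨x,ξ⟩|^p dξ` -/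
def Dstar (n : ℕ) (p : ℝ) (f : ℝ × EuclideanSpace ℝ (Fin (n - 1)) → ℝ)
    (x : EuclideanSpace ℝ (Fin (n - 1))) : ℝ :=
  ∫ ξ, lp n p (dxi f (ξ : EuclideanSpace ℝ (Fin (n - 1)))) ^ (1 - (n : ℝ) - p) *
      |⟪x, (ξ : EuclideanSpace ℝ (Fin (n - 1)))⟫| ^ p ∂(sphMeasure (n - 1))

/-- `C_f^*(t,x) = (α_f/p)|t|^p + D_f^*(x)` -/
def Cstar (n : ℕ) (p : ℝ) (f : ℝ × EuclideanSpace ℝ (Fin (n - 1)) → ℝ)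
    (y : ℝ × EuclideanSpace ℝ (Fin (n - 1))) : ℝ :=
  alpha n p f / p * |y.1| ^ p + Dstar n p f y.2

/-- `C_f`, the Legendre transform of `C_f^*` -/
def Cf (n : ℕ) (p : ℝ) (f : ℝ × EuclideanSpace ℝ (Fin (n - 1)) → ℝ) :
    ℝ × EuclideanSpace ℝ (Fin (n - 1)) → ℝ :=
  legendreP (Cstar n p f)

/-- the convex body `K_f = {y : C_f(y) ≤ 1}` in `ℝⁿ` -/
def Kf (n : ℕ) (p : ℝ) (f : ℝ × EuclideanSpace ℝ (Fin (n - 1)) → ℝ) :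
    Set (ℝ × EuclideanSpace ℝ (Fin (n - 1))) :=
  {y | Cf n p f y ≤ 1}

/-- the slice `K_{f,t} = {x : (t,x) ∈ K_f}` -/
def slice (n : ℕ) (p : ℝ) (f : ℝ × EuclideanSpace ℝ (Fin (n - 1)) → ℝ) (t : ℝ) :
    Set (EuclideanSpace ℝ (Fin (n - 1))) :=
  {x | (t, x) ∈ Kf n p f}

/-- the sharp constant `𝒦_n` of the `L²` Sobolev trace inequality -/
def Kn (n : ℕ) : ℝ :=
  1 / (Real.sqrt Real.pi * ((n : ℝ) - 2)) *
    (Real.Gamma n / (((n : ℝ) - 1) * Real.Gamma (((n : ℝ) - 1) / 2))) ^ (((n : ℝ) - 1)⁻¹)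

/-- the sharp constant `𝒜_{n,p}` of the affine `L^p` Sobolev trace inequality -/
def A (n : ℕ) (p : ℝ) : ℝ :=
  Real.pi ^ (-(p - 1) / 2) * ((p - 1) ^ ((p - 1) / p) / ((n : ℝ) - p)) ^ (p - 1) *
    (Real.Gamma n * Real.Gamma (((n : ℝ) + 1) / 2) /
      (((n : ℝ) - 1) * Real.Gamma (((n : ℝ) - 1) / p) *
        Real.Gamma (((n : ℝ) * (p - 1) + 1) / p))) ^ ((p - 1) / ((n : ℝ) - 1))

/-- The primitive of a continuous function bounded below by a positive constant has a
differentiable inverse. -/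
theorem exists_inverse_primitive {k : ℝ → ℝ} (hk : Continuous k) {ε : ℝ} (hε : 0 < ε)
    (hkε : ∀ s, ε ≤ k s) (α : ℝ) :
    ∃ g : ℝ → ℝ, (∀ y, ∫ s in α..g y, k s = y) ∧ (∀ y s, s ≤ g y ↔ ∫ r in α..s, k r ≤ y) ∧
      ∀ y, HasDerivAt g (k (g y))⁻¹ y := by
  set G : ℝ → ℝ := fun s => ∫ r in α..s, k r with hG
  have hderiv : ∀ s, HasDerivAt G (k s) s := fun s =>
    intervalIntegral.integral_hasDerivAt_right (hk.intervalIntegrable _ _)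
      (hk.stronglyMeasurableAtFilter _ _) hk.continuousAt
  have hcont : Continuous G := continuous_iff_continuousAt.2 fun s => (hderiv s).continuousAt
  have hmono : StrictMono G := by
    apply strictMono_of_deriv_pos
    intro s
    rw [(hderiv s).deriv]
    exact hε.trans_le (hkε s)
  have hsub : ∀ a b, a ≤ b → ε * (b - a) ≤ G b - G a := by
    intro a b hab
    have h1 : G b - G a = ∫ r in a..b, k r :=
      intervalIntegral.integral_interval_sub_left (hk.intervalIntegrable _ _)
        (hk.intervalIntegrable _ _)
    rw [h1]
    have h2 : ∫ _ in a..b, ε = ε * (b - a) := by simp [mul_comm]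
    rw [← h2]
    exact intervalIntegral.integral_mono_on hab (by simp) (hk.intervalIntegrable _ _)
      fun x _ => hkε x
  have hGα : G α = 0 := by simp [hG]
  have hsurj : Function.Surjective G := by
    intro y
    have hl : G (α - |y| / ε) ≤ y := by
      have := hsub (α - |y| / ε) α (by have : 0 ≤ |y| / ε := by positivity
                                       linarith)
      rw [hGα] at this
      have h2 : ε * (α - (α - |y| / ε)) = |y| := by field_simp; ring
      rw [h2] at this
      linarith [neg_abs_le y]
    have hr : y ≤ G (α + |y| / ε) := by
      have := hsub α (α + |y| / ε) (by have : 0 ≤ |y| / ε := by positivity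
                                       linarith)
      rw [hGα] at this
      have h2 : ε * ((α + |y| / ε) - α) = |y| := by field_simp; ring
      rw [h2] at this
      linarith [le_abs_self y]
    exact mem_range_of_exists_le_of_exists_ge hcont ⟨_, hl⟩ ⟨_, hr⟩
  let e : ℝ ≃o ℝ := hmono.orderIsoOfSurjective G hsurj
  have he : ∀ s, e s = G s := fun s => rfl
  refine ⟨e.symm, fun y => ?_, fun y s => ?_, fun y => ?_⟩
  · change G (e.symm y) = y
    rw [← he]; simp
  · rw [← e.le_iff_le, e.apply_symm_apply]; rfl
  · refine HasDerivAt.of_local_left_inverse e.symm.continuous.continuousAt (hderiv _)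
      (hε.trans_le (hkε _)).ne' (Filter.Eventually.of_forall fun y => ?_)
    rw [← he]; simp

/-- A measurable family of one-dimensional monotone transports from densities on `(c, ∞)` to
densities on `[α, β]`. -/
theorem exists_transport_real {Ω : Type*} [MeasurableSpace Ω] (u v : Ω → ℝ → ℝ) (c α β : ℝ)
    (hαβ : α < β) (hum : Measurable (Function.uncurry u)) (hvm : Measurable (Function.uncurry v))
    (huc : ∀ ω, Continuous (u ω)) (hu0 : ∀ ω t, 0 ≤ u ω t) (hus : ∀ ω, HasCompactSupport (u ω))
    (hvc : ∀ ω, ContinuousOn (v ω) (Icc α β)) (hvpos : ∀ ω, ∀ s ∈ Icc α β, 0 < v ω s)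
    (hv0 : ∀ ω, ∀ s ∉ Icc α β, v ω s = 0) :
    ∃ T δ : Ω → ℝ → ℝ, Measurable (Function.uncurry T) ∧ Measurable (Function.uncurry δ) ∧
      (∀ ω t, T ω t ∈ Icc α β) ∧ (∀ ω t, 0 ≤ δ ω t) ∧
      (∀ ω (h : ℝ → ℝ≥0∞), Measurable h →
        (∫⁻ t in Ioi c, ENNReal.ofReal (u ω t) * h (T ω t)) * ENNReal.ofReal (∫ s, v ω s) =
          ENNReal.ofReal (∫ t in Ioi c, u ω t) * ∫⁻ s, ENNReal.ofReal (v ω s) * h s) ∧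
      (∀ ω t, c < t → 0 < u ω t →
        δ ω t * (v ω (T ω t) * ∫ t in Ioi c, u ω t) = u ω t * ∫ s, v ω s) ∧
      (∀ ω (φ : ℝ → ℝ), ContDiff ℝ 1 φ → HasCompactSupport φ → (∀ t, 0 ≤ φ t) →
        IntegrableOn (fun t => φ t * δ ω t) (Ioi c) ∧
        ∫ t in Ioi c, φ t * δ ω t = -(∫ t in Ioi c, deriv φ t * T ω t) - α * φ c) := by
  -- extension of the target densities
  set k : Ω → ℝ → ℝ := fun ω s => v ω (projIcc α β hαβ.le s) with hkdef
  have hkc : ∀ ω, Continuous (k ω) := fun ω =>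
    (continuousOn_iff_continuous_domRestrict.1 (hvc ω)).comp continuous_projIcc
  have hk_eq : ∀ ω, ∀ s ∈ Icc α β, k ω s = v ω s := fun ω s hs => by
    simp [hkdef, projIcc_of_mem hαβ.le hs]
  have hkpos : ∀ ω s, 0 < k ω s := fun ω s => hvpos ω _ (Subtype.prop _)
  have hkε : ∀ ω, ∃ ε, 0 < ε ∧ ∀ s, ε ≤ k ω s := by
    intro ω
    obtain ⟨x, hx, hmin⟩ := isCompact_Icc.exists_isMinOn (nonempty_Icc.2 hαβ.le) (hvc ω)
    exact ⟨v ω x, hvpos ω x hx, fun s => hmin (Subtype.prop _)⟩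
  have hkm : Measurable (Function.uncurry k) := by
    have : Measurable fun q : Ω × ℝ => (q.1, ((projIcc α β hαβ.le q.2 : Icc α β) : ℝ)) :=
      measurable_fst.prodMk
        ((continuous_subtype_val.comp continuous_projIcc).measurable.comp measurable_snd)
    exact hvm.comp this
  choose ε hε0 hε using hkε
  choose g hg1 hg2 hg3 using fun ω => exists_inverse_primitive (hkc ω) (hε0 ω) (hε ω) α
  have hprim_meas : ∀ (k : Ω → ℝ → ℝ), Measurable (Function.uncurry k) → ∀ a : ℝ,
      Measurable fun q : Ω × ℝ => ∫ r in a..q.2, k q.1 r := by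
    intro k hkm a
    have h1 : ∀ S : Set (ℝ × ℝ), MeasurableSet S →
        Measurable fun q : Ω × ℝ => ∫ r, S.indicator (fun z => k q.1 z.2) (q.2, r) := by
      intro S hS
      have : StronglyMeasurable fun z : (Ω × ℝ) × ℝ =>
          S.indicator (fun y => k z.1.1 y.2) (z.1.2, z.2) := by
        apply Measurable.stronglyMeasurable
        have h2 : (fun z : (Ω × ℝ) × ℝ => S.indicator (fun y => k z.1.1 y.2) (z.1.2, z.2)) =
            ((fun z : (Ω × ℝ) × ℝ => (z.1.2, z.2)) ⁻¹' S).indicator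
              (fun z => Function.uncurry k (z.1.1, z.2)) := by
          ext z; rfl
        rw [h2]
        exact (hkm.comp (by fun_prop)).indicator (hS.preimage (by fun_prop))
      exact this.integral_prod_right.measurable
    have hA := h1 {z | a < z.2 ∧ z.2 ≤ z.1} (by measurability)
    have hB := h1 {z | z.1 < z.2 ∧ z.2 ≤ a} (by measurability)
    convert hA.sub hB using 2 with q
    rw [intervalIntegral, ← integral_indicator measurableSet_Ioc,
      ← integral_indicator measurableSet_Ioc]
    rfl
  have hgm : Measurable (Function.uncurry g) := by
    apply measurable_of_Ici
    intro s
    have : Function.uncurry g ⁻¹' Ici s = {q : Ω × ℝ | ∫ r in α..s, k q.1 r ≤ q.2} := by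
      ext q; exact hg2 q.1 q.2 s
    rw [this]
    refine measurableSet_le ?_ measurable_snd
    exact (hprim_meas k hkm α).comp (measurable_fst.prodMk measurable_const)
  -- masses
  set V : Ω → ℝ := fun ω => ∫ s, v ω s with hV
  set U : Ω → ℝ := fun ω => ∫ t in Ioi c, u ω t with hU
  have hVk : ∀ ω, ∫ s in α..β, k ω s = V ω := by
    intro ω
    rw [hV, intervalIntegral.integral_of_le hαβ.le, ← integral_Icc_eq_integral_Ioc]
    rw [setIntegral_congr_fun measurableSet_Icc (hk_eq ω)]
    exact setIntegral_eq_integral_of_forall_compl_eq_zero fun s hs => hv0 ω s hs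
  have hVpos : ∀ ω, 0 < V ω := by
    intro ω
    rw [← hVk]
    exact intervalIntegral.intervalIntegral_pos_of_pos ((hkc ω).intervalIntegrable _ _)
      (hkpos ω) hαβ
  have huint : ∀ ω, Integrable (u ω) := fun ω => (huc ω).integrable_of_hasCompactSupport (hus ω)
  have hU0 : ∀ ω, 0 ≤ U ω := fun ω => integral_nonneg (hu0 ω)
  set F : Ω → ℝ → ℝ := fun ω t => ∫ r in c..t, u ω r with hF
  have hFd : ∀ ω t, HasDerivAt (F ω) (u ω t) t := fun ω t =>
    intervalIntegral.integral_hasDerivAt_right ((huc ω).intervalIntegrable _ _)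
      ((huc ω).stronglyMeasurableAtFilter _ _) (huc ω).continuousAt
  have hF0 : ∀ ω t, c ≤ t → 0 ≤ F ω t := fun ω t ht =>
    intervalIntegral.integral_nonneg ht fun s _ => hu0 ω s
  have hFU : ∀ ω t, c ≤ t → F ω t ≤ U ω := by
    intro ω t ht
    simp only [hF, hU]
    rw [intervalIntegral.integral_of_le ht]
    exact setIntegral_mono_set (huint ω).integrableOn
      (Filter.Eventually.of_forall (hu0 ω)) (Filter.Eventually.of_forall Ioc_subset_Ioi_self)
  set S : Ω → ℝ → ℝ := fun ω t => g ω (F ω t * (V ω / U ω)) with hS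
  have hgmono : ∀ ω, Monotone (g ω) := by
    intro ω y z hyz
    rw [hg2, hg1]; exact hyz
  have hgα : ∀ ω, g ω 0 = α := by
    intro ω
    apply le_antisymm
    · by_contra! hlt
      have h1 : 0 < ∫ s in α..g ω 0, k ω s :=
        intervalIntegral.intervalIntegral_pos_of_pos ((hkc ω).intervalIntegrable _ _)
          (hkpos ω) hlt
      rw [hg1] at h1
      exact lt_irrefl _ h1
    · rw [hg2]; simp
  have hgβ : ∀ ω, g ω (V ω) = β := by
    intro ω
    apply le_antisymm
    · by_contra! hlt
      have h1 : 0 < ∫ s in β..g ω (V ω), k ω s :=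
        intervalIntegral.intervalIntegral_pos_of_pos ((hkc ω).intervalIntegrable _ _)
          (hkpos ω) hlt
      have h2 := intervalIntegral.integral_add_adjacent_intervals
        ((hkc ω).intervalIntegrable (μ := volume) α β)
        ((hkc ω).intervalIntegrable (μ := volume) β (g ω (V ω)))
      rw [hg1, hVk] at h2
      linarith
    · rw [hg2, hVk]
  have hSmem : ∀ ω t, c ≤ t → S ω t ∈ Icc α β := by
    intro ω t ht
    have h1 : 0 ≤ F ω t * (V ω / U ω) :=
      mul_nonneg (hF0 ω t ht) (div_nonneg (hVpos ω).le (hU0 ω))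
    have h2 : F ω t * (V ω / U ω) ≤ V ω := by
      rcases (hU0 ω).eq_or_lt with h0 | h0
      · rw [← h0]; simpa using (hVpos ω).le
      · rw [mul_div_assoc', div_le_iff₀ h0, mul_comm]
        exact mul_le_mul_of_nonneg_left (hFU ω t ht) (hVpos ω).le
    constructor
    · rw [← hgα ω]; exact hgmono ω h1
    · rw [← hgβ ω]; exact hgmono ω h2
  have hSd : ∀ ω t, HasDerivAt (S ω) (u ω t * (V ω / U ω) * (k ω (S ω t))⁻¹) t := by
    intro ω t
    have := (hg3 ω (F ω t * (V ω / U ω))).comp t ((hFd ω t).mul_const (V ω / U ω))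
    rw [mul_comm]
    exact this
  have hSc : ∀ ω, Continuous (S ω) := fun ω =>
    continuous_iff_continuousAt.2 fun t => (hSd ω t).continuousAt
  have hdc : ∀ ω, Continuous fun t => u ω t * (V ω / U ω) * (k ω (S ω t))⁻¹ := fun ω =>
    ((huc ω).mul continuous_const).mul
      (((hkc ω).comp (hSc ω)).inv₀ fun t => (hkpos ω _).ne')
  have hVm : Measurable V :=
    (hvm.stronglyMeasurable.integral_prod_right (ν := (volume : Measure ℝ))).measurable
  have hUm : Measurable U := (hum.stronglyMeasurable.integral_prod_right
    (ν := (volume : Measure ℝ).restrict (Ioi c))).measurable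
  have hSm : Measurable (Function.uncurry S) := by
    have : Measurable fun q : Ω × ℝ => (q.1, F q.1 q.2 * (V q.1 / U q.1)) :=
      measurable_fst.prodMk ((hprim_meas u hum c).mul
        ((hVm.comp measurable_fst).div (hUm.comp measurable_fst)))
    exact hgm.comp this
  refine ⟨fun ω t => S ω (max t c), fun ω t => u ω t * (V ω / U ω) * (k ω (S ω (max t c)))⁻¹,
    ?_, ?_, fun ω t => hSmem ω _ (le_max_right _ _), fun ω t => ?_, ?_, ?_, ?_⟩
  · exact hSm.comp (measurable_fst.prodMk (measurable_snd.max measurable_const))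
  · refine (hum.mul ((hVm.comp measurable_fst).div (hUm.comp measurable_fst))).mul
      (Measurable.inv ?_)
    exact hkm.comp (measurable_fst.prodMk
      (hSm.comp (measurable_fst.prodMk (measurable_snd.max measurable_const))))
  · exact mul_nonneg (mul_nonneg (hu0 ω t) (div_nonneg (hVpos ω).le (hU0 ω)))
      (inv_nonneg.2 (hkpos ω _).le)
  · intro ω h hh
    have hcongr : ∫⁻ t in Ioi c, ENNReal.ofReal (u ω t) * h (S ω (max t c)) =
        ∫⁻ t in Ioi c, ENNReal.ofReal (u ω t) * h (S ω t) := by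
      refine setLIntegral_congr_fun measurableSet_Ioi fun t ht => ?_
      simp only [max_eq_left (le_of_lt (mem_Ioi.1 ht))]
    rw [hcongr]
    rcases (hU0 ω).eq_or_lt with h0 | h0
    · have hz : ∫⁻ t in Ioi c, ENNReal.ofReal (u ω t) * h (S ω t) = 0 := by
        have h3 : ∀ᵐ t ∂(volume.restrict (Ioi c)), u ω t = 0 :=
          (integral_eq_zero_iff_of_nonneg (hu0 ω) (huint ω).integrableOn).1 h0.symm
        rw [lintegral_eq_zero_iff' ?_]
        · filter_upwards [h3] with t ht
          simp [ht]
        · exact ((huc ω).measurable.ennreal_ofReal.mul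
            (hh.comp (hSc ω).measurable)).aemeasurable
      have h0' : ∫ t in Ioi c, u ω t = 0 := h0.symm
      rw [hz, h0']; simp
    · have hmono : MonotoneOn (S ω) (Ioi c) := by
        intro x hx y hy hxy
        apply hgmono ω
        refine mul_le_mul_of_nonneg_right ?_ (div_nonneg (hVpos ω).le (hU0 ω))
        have := intervalIntegral.integral_interval_sub_left
          ((huc ω).intervalIntegrable (μ := volume) c y)
          ((huc ω).intervalIntegrable (μ := volume) c x)
        have h4 : 0 ≤ ∫ r in x..y, u ω r :=
          intervalIntegral.integral_nonneg hxy fun s _ => hu0 ω s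
        simp only [hF]
        linarith
      have hcv := lintegral_image_eq_lintegral_deriv_mul_of_monotoneOn measurableSet_Ioi
        (fun t _ => (hSd ω t).hasDerivWithinAt) hmono
        (fun s => ENNReal.ofReal (k ω s) * h s)
      have himg : S ω '' Ioi c =ᵐ[volume] Icc α β := by
        have h5 : S ω '' Ioi c ⊆ Icc α β := by
          rintro _ ⟨t, ht, rfl⟩; exact hSmem ω t (le_of_lt ht)
        have h6 : Ioo α β ⊆ S ω '' Ioi c := by
          intro s hs
          obtain ⟨M, hM⟩ : ∃ M, c ≤ M ∧ F ω M = U ω := by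
            obtain ⟨R, hR⟩ := (hus ω).isCompact.isBounded.subset_closedBall 0
            refine ⟨max c R, le_max_left _ _, ?_⟩
            simp only [hF, hU]
            rw [intervalIntegral.integral_of_le (le_max_left _ _)]
            symm
            refine setIntegral_eq_of_subset_of_forall_sdiff_eq_zero measurableSet_Ioi
              Ioc_subset_Ioi_self fun x hx => ?_
            by_contra hne
            have h7 := hR (subset_tsupport _ hne)
            rw [mem_closedBall_zero_iff] at h7
            refine hx.2 ⟨hx.1, le_max_of_le_right ((le_abs_self x).trans h7)⟩
          have h8 : S ω c = α := by simp [hS, hF, hgα]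
          have h9 : S ω M = β := by
            simp only [hS, hM.2]
            rw [mul_div_cancel₀ _ h0.ne', hgβ]
          have h10 := intermediate_value_Icc hM.1 (hSc ω).continuousOn
          rw [h8, h9] at h10
          obtain ⟨t, ht, hts⟩ := h10 (Ioo_subset_Icc_self hs)
          refine ⟨t, lt_of_le_of_ne ht.1 ?_, hts⟩
          rintro rfl
          rw [h8] at hts
          exact hs.1.ne hts
        exact Filter.EventuallyLE.antisymm (LE.le.eventuallyLE h5)
          (Ioo_ae_eq_Icc.symm.le.trans (LE.le.eventuallyLE h6))
      rw [setLIntegral_congr himg] at hcv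
      have hL : ∫⁻ s in Icc α β, ENNReal.ofReal (k ω s) * h s =
          ∫⁻ s, ENNReal.ofReal (v ω s) * h s := by
        rw [← lintegral_indicator measurableSet_Icc]
        congr 1; ext s
        by_cases hs : s ∈ Icc α β
        · simp [hs, hk_eq ω s hs]
        · simp [hs, hv0 ω s hs]
      have hR : ∫⁻ x in Ioi c, ENNReal.ofReal (u ω x * (V ω / U ω) * (k ω (S ω x))⁻¹) *
          (ENNReal.ofReal (k ω (S ω x)) * h (S ω x)) =
          ENNReal.ofReal (V ω / U ω) * ∫⁻ x in Ioi c, ENNReal.ofReal (u ω x) * h (S ω x) := by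
        rw [← lintegral_const_mul']
        · congr 1; ext x
          rw [← mul_assoc, ← mul_assoc, ← ENNReal.ofReal_mul', ← ENNReal.ofReal_mul']
          · congr 2
            rw [mul_assoc, inv_mul_cancel₀ (hkpos ω _).ne', mul_one, mul_comm]
          · exact hu0 ω x
          · exact (hkpos ω _).le
        · exact ENNReal.ofReal_ne_top
      rw [hL, hR] at hcv
      rw [hcv, ← mul_assoc, ← ENNReal.ofReal_mul (hU0 ω), mul_div_cancel₀ _ h0.ne', mul_comm]
  · intro ω t hct hut
    have hUp : 0 < U ω := by
      have h1 : 0 < ∫ t in Ioi c, u ω t := by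
        rw [setIntegral_pos_iff_support_of_nonneg_ae (Filter.Eventually.of_forall (hu0 ω))
          (huint ω).integrableOn]
        have hopen : IsOpen (Function.support (u ω) ∩ Ioi c) :=
          (huc ω).isOpen_support.inter isOpen_Ioi
        exact hopen.measure_pos _ ⟨t, hut.ne', hct⟩
      exact h1
    have h1 : k ω (S ω (max t c)) = v ω (S ω (max t c)) :=
      hk_eq ω _ (hSmem ω _ (le_max_right _ _))
    have h2 : v ω (S ω (max t c)) ≠ 0 := by rw [← h1]; exact (hkpos ω _).ne'
    simp only [h1]
    change _ * (_ * U ω) = _ * V ω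
    field_simp
  · intro ω φ hφ hφs hφ0
    have hcont : Continuous fun t => φ t * (u ω t * (V ω / U ω) * (k ω (S ω t))⁻¹) :=
      hφ.continuous.mul (hdc ω)
    have hintg : Integrable fun t => φ t * (u ω t * (V ω / U ω) * (k ω (S ω t))⁻¹) :=
      hcont.integrable_of_hasCompactSupport hφs.mul_right
    have hintg2 : Integrable fun t => deriv φ t * S ω t :=
      ((hφ.continuous_deriv le_rfl).mul (hSc ω)).integrable_of_hasCompactSupport
        hφs.deriv.mul_right
    have hc1 : EqOn (fun t => φ t * (u ω t * (V ω / U ω) * (k ω (S ω (max t c)))⁻¹))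
        (fun t => φ t * (u ω t * (V ω / U ω) * (k ω (S ω t))⁻¹)) (Ioi c) := by
      intro t ht
      simp only [max_eq_left (le_of_lt (mem_Ioi.1 ht))]
    have hc2 : EqOn (fun t => deriv φ t * S ω (max t c))
        (fun t => deriv φ t * S ω t) (Ioi c) := by
      intro t ht
      simp only [max_eq_left (le_of_lt (mem_Ioi.1 ht))]
    refine ⟨hintg.integrableOn.congr_fun hc1.symm measurableSet_Ioi, ?_⟩
    rw [setIntegral_congr_fun measurableSet_Ioi hc1, setIntegral_congr_fun measurableSet_Ioi hc2]
    have hd : ∀ t ∈ Ioi c, HasDerivAt (fun t => φ t * S ω t)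
        (deriv φ t * S ω t + φ t * (u ω t * (V ω / U ω) * (k ω (S ω t))⁻¹)) t := fun t _ =>
      ((hφ.differentiable one_ne_zero) t).hasDerivAt.mul (hSd ω t)
    have hlim : Filter.Tendsto (fun t => φ t * S ω t) Filter.atTop (nhds 0) := by
      have : HasCompactSupport fun t => φ t * S ω t := hφs.mul_right
      refine (this.is_zero_at_infty).mono_left ?_
      exact atTop_le_cocompact
    have := integral_Ioi_of_hasDerivAt_of_tendsto
      ((hφ.continuous.mul (hSc ω)).continuousWithinAt) hd
      (hintg2.integrableOn.add hintg.integrableOn) hlim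
    rw [integral_add hintg2.integrableOn hintg.integrableOn] at this
    have h8 : S ω c = α := by simp [hS, hF, hgα]
    simp only [Pi.mul_apply] at this
    rw [h8] at this
    linarith

/-- The set `K` in a space of dimension `k` is the target of measurable families of triangular
(Knothe) transport maps `T`, with divergence `δ` satisfying the arithmetic-geometric mean
inequality and an integration by parts inequality. -/
def KnotheOn (E : Type) [NormedAddCommGroup E] [NormedSpace ℝ E] [MeasureSpace E] (k : ℕ)
    (K : Set E) : Prop :=
  ∀ (Ω : Type) [MeasurableSpace Ω] (ρ σ : Ω → E → ℝ) (C : Set E), IsCompact C →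
    Measurable (Function.uncurry ρ) → Measurable (Function.uncurry σ) →
    (∀ ω, Continuous (ρ ω)) → (∀ ω x, 0 ≤ ρ ω x) → (∀ ω, ∀ x ∉ C, ρ ω x = 0) →
    (∀ ω, ContinuousOn (σ ω) K) → (∀ ω, ∀ y ∈ K, 0 < σ ω y) → (∀ ω, ∀ y ∉ K, σ ω y = 0) →
    ∃ (T : Ω → E → E) (δ : Ω → E → ℝ), Measurable (Function.uncurry T) ∧
      Measurable (Function.uncurry δ) ∧ (∀ ω x, T ω x ∈ K) ∧ (∀ ω x, 0 ≤ δ ω x) ∧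
      (∀ ω (h : E → ℝ≥0∞), Measurable h →
        (∫⁻ x, ENNReal.ofReal (ρ ω x) * h (T ω x)) * ENNReal.ofReal (∫ y, σ ω y) =
          ENNReal.ofReal (∫ x, ρ ω x) * ∫⁻ y, ENNReal.ofReal (σ ω y) * h y) ∧
      (∀ ω x, 0 < ρ ω x →
        (k : ℝ) ^ k * (ρ ω x * ∫ y, σ ω y) ≤ δ ω x ^ k * (σ ω (T ω x) * ∫ x, ρ ω x)) ∧
      (∀ ω (φ : E → ℝ), ContDiff ℝ 1 φ → (∀ x, 0 ≤ φ x) → (∀ x ∉ C, φ x = 0) →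
        0 ≤ -∫ x, fderiv ℝ φ x (T ω x) ∧
        ∫⁻ x, ENNReal.ofReal (φ x * δ ω x) ≤ ENNReal.ofReal (-∫ x, fderiv ℝ φ x (T ω x)))

theorem am_gm_succ (k : ℕ) {a b : ℝ} (ha : 0 ≤ a) (hb : 0 ≤ b) :
    ((k : ℝ) + 1) ^ (k + 1) * (a * b ^ k) ≤ (k : ℝ) ^ k * (a + b) ^ (k + 1) := by
  rcases Nat.eq_zero_or_pos k with rfl | hk
  · simpa using hb
  have hk' : (0 : ℝ) < k := by exact_mod_cast hk
  rcases hb.eq_or_lt with rfl | hb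
  · rw [zero_pow hk.ne']; simp only [mul_zero]; positivity
  set y := b / k with hy
  have hyp : 0 < y := by positivity
  have hby : b = k * y := by rw [hy]; field_simp
  have h1 := one_add_mul_le_pow (a := (a - y) / ((k + 1) * y))
    (by
      rw [le_div_iff₀ (by positivity)]
      nlinarith) (k + 1)
  have h2 : 1 + ((k + 1 : ℕ) : ℝ) * ((a - y) / ((k + 1) * y)) = a / y := by
    push_cast; field_simp; ring
  have h3 : 1 + (a - y) / ((k + 1) * y) = (a + b) / ((k + 1) * y) := by
    rw [hby]; field_simp; ring
  rw [h2, h3, div_pow, div_le_div_iff₀ hyp (by positivity)] at h1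
  have h4 : y * (((k : ℝ) + 1) ^ (k + 1) * (a * b ^ k)) ≤
      y * ((k : ℝ) ^ k * (a + b) ^ (k + 1)) := by
    calc y * (((k : ℝ) + 1) ^ (k + 1) * (a * b ^ k))
        = (k : ℝ) ^ k * (a * (((k : ℝ) + 1) * y) ^ (k + 1)) := by
          rw [hby, mul_pow, mul_pow]; ring
      _ ≤ (k : ℝ) ^ k * ((a + b) ^ (k + 1) * y) := by gcongr
      _ = _ := by ring
  exact le_of_mul_le_mul_left h4 hyp

theorem knotheOn_zero : KnotheOn (EuclideanSpace ℝ (Fin 0)) 0 univ := by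
  intro Ω _ ρ σ C hC hρm hσm hρc hρ0 hρC hσc hσp hσ0
  have hvol : (volume : Measure (EuclideanSpace ℝ (Fin 0))) = Measure.dirac 0 :=
    volume_euclideanSpace_eq_dirac _
  refine ⟨fun _ x => x, fun _ _ => 0, measurable_snd, measurable_const, fun _ _ => mem_univ _,
    fun _ _ => le_rfl, fun ω h hh => ?_, fun ω x hx => ?_, fun ω φ hφ hφ0 hφC => ?_⟩
  · simp only [hvol, lintegral_dirac, integral_dirac]
    ring
  · have : x = 0 := Subsingleton.elim _ _
    subst this
    simp only [hvol, integral_dirac]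
    simp [mul_comm]
  · have h : ∀ x : EuclideanSpace ℝ (Fin 0), fderiv ℝ φ x x = 0 := fun x => by
      rw [show (fderiv ℝ φ x) x = fderiv ℝ φ x 0 from congrArg _ (Subsingleton.elim _ _)]; simp
    simp [h]

theorem integrable_of_continuousOn_compact {E : Type*} [NormedAddCommGroup E] [MeasurableSpace E]
    [BorelSpace E] {μ : Measure E} [IsFiniteMeasureOnCompacts μ] {K : Set E} (hK : IsCompact K)
    {g : E → ℝ} (hg : ContinuousOn g K) (h0 : ∀ x ∉ K, g x = 0) : Integrable g μ := by
  have h1 : IntegrableOn g K μ := hg.integrableOn_compact hK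
  rwa [integrableOn_iff_integrable_of_support_subset] at h1
  intro x hx
  by_contra hxK
  exact hx (h0 x hxK)

theorem integrable_fderiv_apply {E : Type*} [NormedAddCommGroup E] [NormedSpace ℝ E]
    [MeasurableSpace E] [BorelSpace E] [SecondCountableTopology E] {μ : Measure E}
    [IsFiniteMeasureOnCompacts μ] {φ : E → ℝ}
    (hφ : ContDiff ℝ 1 φ) (hφs : HasCompactSupport φ) {T : E → E} (hT : Measurable T) {B : ℝ}
    (hB : ∀ x, ‖T x‖ ≤ B) : Integrable (fun x => fderiv ℝ φ x (T x)) μ := by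
  have h1 : Continuous (fderiv ℝ φ) := hφ.continuous_fderiv one_ne_zero
  have h2 : Integrable (fun x => ‖fderiv ℝ φ x‖ * B) μ :=
    (h1.norm.mul continuous_const).integrable_of_hasCompactSupport
      (hφs.fderiv (𝕜 := ℝ)).norm.mul_right
  refine h2.mono' ?_ (Filter.Eventually.of_forall fun x => ?_)
  · have h3 : Continuous fun z : E × E => fderiv ℝ φ z.1 z.2 :=
      (h1.comp continuous_fst).clm_apply continuous_snd
    exact (h3.measurable.comp (measurable_id.prodMk hT)).aestronglyMeasurable
  · refine (ContinuousLinearMap.le_opNorm _ _).trans ?_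
    exact mul_le_mul_of_nonneg_left (hB x) (norm_nonneg _)

section BoxTransport

variable {k : ℕ}

theorem KnotheOn.exists_halfSpace {K : Set (EuclideanSpace ℝ (Fin k))}
    (hK : KnotheOn (EuclideanSpace ℝ (Fin k)) k K) (hKc : IsCompact K) (hKv : 0 < volume K)
    {α β : ℝ} (hαβ : α < β) (c : ℝ) (Ω : Type) [MeasurableSpace Ω]
    (ρ σ : Ω → ℝ × EuclideanSpace ℝ (Fin k) → ℝ) (C : Set (ℝ × EuclideanSpace ℝ (Fin k)))
    (hC : IsCompact C) (hρm : Measurable (Function.uncurry ρ))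
    (hσm : Measurable (Function.uncurry σ)) (hρc : ∀ ω, Continuous (ρ ω))
    (hρ0 : ∀ ω x, 0 ≤ ρ ω x) (hρC : ∀ ω, ∀ x ∉ C, ρ ω x = 0)
    (hσc : ∀ ω, ContinuousOn (σ ω) (Icc α β ×ˢ K)) (hσp : ∀ ω, ∀ y ∈ Icc α β ×ˢ K, 0 < σ ω y)
    (hσ0 : ∀ ω, ∀ y ∉ Icc α β ×ˢ K, σ ω y = 0) :
    ∃ (T : Ω → ℝ × EuclideanSpace ℝ (Fin k) → ℝ × EuclideanSpace ℝ (Fin k))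
      (δ : Ω → ℝ × EuclideanSpace ℝ (Fin k) → ℝ), Measurable (Function.uncurry T) ∧
      Measurable (Function.uncurry δ) ∧ (∀ ω x, T ω x ∈ Icc α β ×ˢ K) ∧ (∀ ω x, 0 ≤ δ ω x) ∧
      (∀ ω (h : ℝ × EuclideanSpace ℝ (Fin k) → ℝ≥0∞), Measurable h →
        (∫⁻ x in {x | c < x.1}, ENNReal.ofReal (ρ ω x) * h (T ω x)) *
            ENNReal.ofReal (∫ y, σ ω y) =
          ENNReal.ofReal (∫ x in {x | c < x.1}, ρ ω x) *
            ∫⁻ y, ENNReal.ofReal (σ ω y) * h y) ∧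
      (∀ ω x, c < x.1 → 0 < ρ ω x →
        ((k : ℝ) + 1) ^ (k + 1) * (ρ ω x * ∫ y, σ ω y) ≤
          δ ω x ^ (k + 1) * (σ ω (T ω x) * ∫ x in {x | c < x.1}, ρ ω x)) ∧
      (∀ ω (φ : ℝ × EuclideanSpace ℝ (Fin k) → ℝ), ContDiff ℝ 1 φ → (∀ x, 0 ≤ φ x) →
        (∀ x ∉ C, φ x = 0) →
        0 ≤ -(∫ x in {x | c < x.1}, fderiv ℝ φ x (T ω x)) - α * ∫ x, φ (c, x) ∧
        ∫⁻ x in {x | c < x.1}, ENNReal.ofReal (φ x * δ ω x) ≤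
          ENNReal.ofReal (-(∫ x in {x | c < x.1}, fderiv ℝ φ x (T ω x)) -
            α * ∫ x, φ (c, x))) := by
  set μ : Measure (ℝ × EuclideanSpace ℝ (Fin k)) :=
    (volume.restrict (Ioi c)).prod volume with hμdef
  have hμ : volume.restrict {x : ℝ × EuclideanSpace ℝ (Fin k) | c < x.1} = μ := by
    rw [hμdef, ← Measure.restrict_univ (μ := (volume : Measure (EuclideanSpace ℝ (Fin k)))),
      Measure.prod_restrict]
    congr 1
    ext x; simp
  have hμle : μ ≤ volume := hμ ▸ Measure.restrict_le_self
  simp only [hμ]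
  have hKbox : IsCompact (Icc α β ×ˢ K) := isCompact_Icc.prod hKc
  have hC2 : IsCompact (Prod.snd '' C) := hC.image continuous_snd
  have hC1 : IsCompact (Prod.fst '' C) := hC.image continuous_fst
  have hCm : ∀ t x, x ∉ Prod.snd '' C → (t, x) ∉ C := fun t x hx h => hx ⟨_, h, rfl⟩
  have hCm1 : ∀ t x, t ∉ Prod.fst '' C → (t, x) ∉ C := fun t x hx h => hx ⟨_, h, rfl⟩
  -- marginals
  set M : Ω → ℝ → ℝ := fun ω t => ∫ x, ρ ω (t, x) with hM
  set S : Ω → ℝ → ℝ := fun ω s => ∫ y, σ ω (s, y) with hS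
  have hρi : ∀ ω, Integrable (ρ ω) := fun ω =>
    (hρc ω).integrable_of_hasCompactSupport (HasCompactSupport.intro hC (hρC ω))
  have hσi : ∀ ω, Integrable (σ ω) := fun ω =>
    integrable_of_continuousOn_compact hKbox (hσc ω) (hσ0 ω)
  have hσnn : ∀ ω z, 0 ≤ σ ω z := fun ω z => by
    by_cases hz : z ∈ Icc α β ×ˢ K
    · exact (hσp ω z hz).le
    · rw [hσ0 ω z hz]
  have hMm : Measurable (Function.uncurry M) := by
    have : Measurable fun q : (Ω × ℝ) × EuclideanSpace ℝ (Fin k) => ρ q.1.1 (q.1.2, q.2) :=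
      hρm.comp (by fun_prop : Measurable fun q : (Ω × ℝ) × EuclideanSpace ℝ (Fin k) =>
        (q.1.1, (q.1.2, q.2)))
    exact (this.stronglyMeasurable.integral_prod_right).measurable
  have hSm : Measurable (Function.uncurry S) := by
    have : Measurable fun q : (Ω × ℝ) × EuclideanSpace ℝ (Fin k) => σ q.1.1 (q.1.2, q.2) :=
      hσm.comp (by fun_prop : Measurable fun q : (Ω × ℝ) × EuclideanSpace ℝ (Fin k) =>
        (q.1.1, (q.1.2, q.2)))
    exact (this.stronglyMeasurable.integral_prod_right).measurable
  have hMc : ∀ ω, Continuous (M ω) := by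
    intro ω
    have h1 : M ω = fun t => ∫ x in Prod.snd '' C, ρ ω (t, x) := by
      ext t
      exact (setIntegral_eq_integral_of_forall_compl_eq_zero
        fun x hx => hρC ω _ (hCm t x hx)).symm
    rw [h1]
    exact continuous_parametric_integral_of_continuous (f := fun t x => ρ ω (t, x))
      (hρc ω) hC2
  have hM0 : ∀ ω t, 0 ≤ M ω t := fun ω t => integral_nonneg fun x => hρ0 ω _
  have hMs : ∀ ω, HasCompactSupport (M ω) := fun ω =>
    HasCompactSupport.intro hC1 fun t ht => by
      simp only [hM]
      rw [integral_congr_ae (g := fun _ => 0)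
        (Filter.Eventually.of_forall fun x => hρC ω _ (hCm1 t x ht))]
      simp
  have hσsec : ∀ ω, ∀ s ∈ Icc α β, ContinuousOn (fun y => σ ω (s, y)) K := fun ω s hs =>
    (hσc ω).comp (by fun_prop) fun y hy => ⟨hs, hy⟩
  have hσsec0 : ∀ ω s y, y ∉ K → σ ω (s, y) = 0 := fun ω s y hy =>
    hσ0 ω _ fun h => hy h.2
  have hσseci : ∀ ω, ∀ s ∈ Icc α β, Integrable fun y => σ ω (s, y) := fun ω s hs =>
    integrable_of_continuousOn_compact hKc (hσsec ω s hs) (hσsec0 ω s)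
  have hSc : ∀ ω, ContinuousOn (S ω) (Icc α β) := by
    intro ω
    obtain ⟨B, hB⟩ := hKbox.exists_bound_of_continuousOn (hσc ω)
    refine continuousOn_of_dominated (bound := K.indicator fun _ => B)
      (fun s hs => (hσseci ω s hs).aestronglyMeasurable) (fun s hs => ?_) ?_ ?_
    · refine Filter.Eventually.of_forall fun y => ?_
      by_cases hy : y ∈ K
      · simpa [hy] using hB (s, y) ⟨hs, hy⟩
      · simp [hy, hσsec0 ω s y hy]
    · rw [integrable_indicator_iff hKc.measurableSet]
      exact continuousOn_const.integrableOn_compact hKc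
    · refine Filter.Eventually.of_forall fun y => ?_
      by_cases hy : y ∈ K
      · exact (hσc ω).comp (by fun_prop) fun s hs => ⟨hs, hy⟩
      · exact continuousOn_const.congr fun s hs => hσsec0 ω s y hy
  have hSp : ∀ ω, ∀ s ∈ Icc α β, 0 < S ω s := by
    intro ω s hs
    simp only [hS]
    rw [integral_pos_iff_support_of_nonneg (fun y => hσnn ω _) (hσseci ω s hs)]
    exact hKv.trans_le (measure_mono fun y hy => (hσp ω (s, y) ⟨hs, hy⟩).ne')
  have hS0 : ∀ ω, ∀ s ∉ Icc α β, S ω s = 0 := by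
    intro ω s hs
    simp only [hS]
    rw [integral_congr_ae (g := fun _ => 0)
      (Filter.Eventually.of_forall fun y => hσ0 ω _ fun h => hs h.1)]
    simp
  have hSint : ∀ ω, ∫ s, S ω s = ∫ y, σ ω y := fun ω => (integral_prod _ (hσi ω)).symm
  have hMint : ∀ ω, ∫ t in Ioi c, M ω t = ∫ x, ρ ω x ∂μ := fun ω =>
    (integral_prod _ ((hρi ω).mono_measure hμle)).symm
  obtain ⟨a, a', ham, ha'm, haI, ha'0, hapush, hajac, haibp⟩ :=
    exists_transport_real M S c α β hαβ hMm hSm hMc hM0 hMs hSc hSp hS0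
  -- fibre transports
  obtain ⟨T', δ', hT'm, hδ'm, hT'K, hδ'0, hpush', hjac', hibp'⟩ :=
    hK (Ω × ℝ) (fun q x => ρ q.1 (q.2, x)) (fun q y => σ q.1 (a q.1 q.2, y)) (Prod.snd '' C) hC2
      (hρm.comp (by fun_prop : Measurable fun q : (Ω × ℝ) × EuclideanSpace ℝ (Fin k) =>
        (q.1.1, (q.1.2, q.2))))
      (hσm.comp ((measurable_fst.comp measurable_fst).prodMk
        ((ham.comp measurable_fst).prodMk measurable_snd)))
      (fun q => (hρc q.1).comp (by fun_prop)) (fun q x => hρ0 _ _)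
      (fun q x hx => hρC _ _ (hCm _ x hx)) (fun q => hσsec q.1 _ (haI _ _))
      (fun q y hy => hσp _ _ ⟨haI _ _, hy⟩) (fun q y hy => hσsec0 _ _ _ hy)
  have hTm : Measurable fun q : Ω × (ℝ × EuclideanSpace ℝ (Fin k)) => T' (q.1, q.2.1) q.2.2 :=
    hT'm.comp (by fun_prop : Measurable fun q : Ω × (ℝ × EuclideanSpace ℝ (Fin k)) =>
      ((q.1, q.2.1), q.2.2))
  have hδm : Measurable fun q : Ω × (ℝ × EuclideanSpace ℝ (Fin k)) => δ' (q.1, q.2.1) q.2.2 :=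
    hδ'm.comp (by fun_prop : Measurable fun q : Ω × (ℝ × EuclideanSpace ℝ (Fin k)) =>
      ((q.1, q.2.1), q.2.2))
  have ha1m : Measurable fun q : Ω × (ℝ × EuclideanSpace ℝ (Fin k)) => a q.1 q.2.1 :=
    ham.comp (by fun_prop : Measurable fun q : Ω × (ℝ × EuclideanSpace ℝ (Fin k)) =>
      (q.1, q.2.1))
  have ha2m : Measurable fun q : Ω × (ℝ × EuclideanSpace ℝ (Fin k)) => a' q.1 q.2.1 :=
    ha'm.comp (by fun_prop : Measurable fun q : Ω × (ℝ × EuclideanSpace ℝ (Fin k)) =>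
      (q.1, q.2.1))
  refine ⟨fun ω z => (a ω z.1, T' (ω, z.1) z.2), fun ω z => a' ω z.1 + δ' (ω, z.1) z.2,
    ha1m.prodMk hTm, ha2m.add hδm, fun ω z => ⟨haI _ _, hT'K _ _⟩,
    fun ω z => add_nonneg (ha'0 _ _) (hδ'0 _ _), ?_, ?_, ?_⟩
  · intro ω h hh
    have hm1 : Measurable fun z : ℝ × EuclideanSpace ℝ (Fin k) =>
        ENNReal.ofReal (ρ ω z) * h (a ω z.1, T' (ω, z.1) z.2) :=
      (hρc ω).measurable.ennreal_ofReal.mul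
        (hh.comp ((ha1m.prodMk hTm).comp (measurable_const.prodMk measurable_id)))
    have hm2 : Measurable fun z : ℝ × EuclideanSpace ℝ (Fin k) =>
        ENNReal.ofReal (σ ω z) * h z :=
      (hσm.comp (measurable_const.prodMk measurable_id)).ennreal_ofReal.mul hh
    set J : ℝ → ℝ≥0∞ := fun s => ∫⁻ y, ENNReal.ofReal (σ ω (s, y)) * h (s, y) with hJ
    have hJm : Measurable J := hm2.lintegral_prod_right'
    have hSωm : Measurable (S ω) := hSm.comp (measurable_const.prodMk measurable_id)
    have h1 := hapush ω (fun s => J s / ENNReal.ofReal (S ω s)) (hJm.div hSωm.ennreal_ofReal)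
    have h2 : ∀ t, ∫⁻ x, ENNReal.ofReal (ρ ω (t, x)) * h (a ω t, T' (ω, t) x) =
        ENNReal.ofReal (M ω t) * (J (a ω t) / ENNReal.ofReal (S ω (a ω t))) := by
      intro t
      have h3 := hpush' (ω, t) (fun y => h (a ω t, y)) (hh.comp (by fun_prop))
      have h4 : 0 < S ω (a ω t) := hSp ω _ (haI ω t)
      rw [← mul_div_assoc, ENNReal.eq_div_iff (by simpa using h4) ENNReal.ofReal_ne_top,
        mul_comm]
      exact h3
    have h3 : ∫⁻ s, ENNReal.ofReal (S ω s) * (J s / ENNReal.ofReal (S ω s)) = ∫⁻ s, J s := by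
      congr 1; ext s
      by_cases hs : s ∈ Icc α β
      · exact ENNReal.mul_div_cancel (by simpa using hSp ω s hs) ENNReal.ofReal_ne_top
      · have h4 : J s = 0 := by
          simp only [hJ]
          rw [lintegral_congr (g := fun _ => 0)]
          · simp
          · intro y
            rw [hσ0 ω (s, y) fun h => hs h.1]; simp
        rw [h4, hS0 ω s hs]; simp
    rw [lintegral_prod _ hm1.aemeasurable, lintegral_congr h2, ← hSint, ← hMint, h1, h3]
    congr 1
    exact (lintegral_prod _ hm2.aemeasurable).symm
  · rintro ω ⟨t, x⟩ hct hx
    simp only at hct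
    have hMp : 0 < M ω t := by
      simp only [hM]
      have hi : Integrable fun x => ρ ω (t, x) :=
        ((hρc ω).comp (by fun_prop)).integrable_of_hasCompactSupport
          (HasCompactSupport.intro hC2 fun x hx => hρC ω _ (hCm t x hx))
      rw [integral_pos_iff_support_of_nonneg (fun y => hρ0 ω _) hi]
      exact (Continuous.isOpen_support (f := fun x => ρ ω (t, x))
        ((hρc ω).comp (by fun_prop))).measure_pos _ ⟨x, hx.ne'⟩
    have h1 := hajac ω t hct hMp
    have h2 := hjac' (ω, t) x hx
    simp only at h2 ⊢
    rw [hMint, hSint] at h1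
    have h3 := am_gm_succ k (ha'0 ω t) (hδ'0 (ω, t) x)
    have h4 : 0 < S ω (a ω t) := hSp ω _ (haI ω t)
    change (k : ℝ) ^ k * (ρ ω (t, x) * S ω (a ω t)) ≤
      δ' (ω, t) x ^ k * (σ ω (a ω t, T' (ω, t) x) * M ω t) at h2
    set U := ∫ x, ρ ω x ∂μ
    set V := ∫ y, σ ω y
    set s := σ ω (a ω t, T' (ω, t) x)
    have hs : 0 ≤ s := hσnn _ _
    have hU : 0 ≤ U := integral_nonneg (hρ0 ω)
    have hkk : (0 : ℝ) < (k : ℝ) ^ k := by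
      rcases Nat.eq_zero_or_pos k with h | h
      · rw [h]; simp
      · have : (0 : ℝ) < k := by exact_mod_cast h
        positivity
    have h5 : (k : ℝ) ^ k * S ω (a ω t) * M ω t *
        (((k : ℝ) + 1) ^ (k + 1) * (ρ ω (t, x) * V)) ≤ (k : ℝ) ^ k * S ω (a ω t) * M ω t *
        ((a' ω t + δ' (ω, t) x) ^ (k + 1) * (s * U)) := by
      calc _ = ((k : ℝ) + 1) ^ (k + 1) * (M ω t * V) *
            ((k : ℝ) ^ k * (ρ ω (t, x) * S ω (a ω t))) := by ring
        _ ≤ ((k : ℝ) + 1) ^ (k + 1) * (M ω t * V) * (δ' (ω, t) x ^ k * (s * M ω t)) := by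
            have hV : 0 ≤ V := integral_nonneg (hσnn ω)
            gcongr
        _ = (((k : ℝ) + 1) ^ (k + 1) * (a' ω t * δ' (ω, t) x ^ k)) *
            (S ω (a ω t) * U * s * M ω t) := by rw [← h1]; ring
        _ ≤ ((k : ℝ) ^ k * (a' ω t + δ' (ω, t) x) ^ (k + 1)) *
            (S ω (a ω t) * U * s * M ω t) := by gcongr
        _ = _ := by ring
    exact le_of_mul_le_mul_left h5 (by positivity)
  · intro ω φ hφ hφ0 hφC
    have hφs : HasCompactSupport φ := HasCompactSupport.intro hC hφC
    obtain ⟨B, hB⟩ := hKbox.isBounded.exists_norm_le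
    obtain ⟨B₁, hB₁⟩ := (isCompact_Icc (a := α) (b := β)).isBounded.exists_norm_le
    obtain ⟨B₂, hB₂⟩ := hKc.isBounded.exists_norm_le
    have hmeas1 : Measurable fun z : ℝ × EuclideanSpace ℝ (Fin k) =>
        ((a ω z.1, 0) : ℝ × EuclideanSpace ℝ (Fin k)) :=
      (ha1m.comp (measurable_const.prodMk measurable_id)).prodMk measurable_const
    have hmeas2 : Measurable fun z : ℝ × EuclideanSpace ℝ (Fin k) =>
        ((0, T' (ω, z.1) z.2) : ℝ × EuclideanSpace ℝ (Fin k)) :=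
      measurable_const.prodMk (hTm.comp (measurable_const.prodMk measurable_id))
    have hG1 : Integrable (fun z : ℝ × EuclideanSpace ℝ (Fin k) =>
        fderiv ℝ φ z (a ω z.1, 0)) μ :=
      (integrable_fderiv_apply (μ := volume) hφ hφs hmeas1 (B := B₁) fun z => by
        simpa [Prod.norm_def] using hB₁ _ (haI ω z.1)).mono_measure hμle
    have hG2 : Integrable (fun z : ℝ × EuclideanSpace ℝ (Fin k) =>
        fderiv ℝ φ z (0, T' (ω, z.1) z.2)) μ :=
      (integrable_fderiv_apply (μ := volume) hφ hφs hmeas2 (B := B₂) fun z => by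
        simpa [Prod.norm_def] using hB₂ _ (hT'K (ω, z.1) z.2)).mono_measure hμle
    have hφd : Differentiable ℝ φ := hφ.differentiable one_ne_zero
    have hd1 : ∀ t x, deriv (fun t => φ (t, x)) t * a ω t = fderiv ℝ φ (t, x) (a ω t, 0) := by
      intro t x
      have h1 : HasDerivAt (fun t => φ (t, x)) (fderiv ℝ φ (t, x) (1, 0)) t :=
        (hφd (t, x)).hasFDerivAt.comp_hasDerivAt t
          ((hasDerivAt_id t).prodMk (hasDerivAt_const t x))
      rw [h1.deriv, mul_comm, ← smul_eq_mul, ← map_smul]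
      simp
    have hd2 : ∀ t x v, fderiv ℝ (fun x => φ (t, x)) x v = fderiv ℝ φ (t, x) (0, v) := by
      intro t x v
      have h1 : HasFDerivAt (fun x => φ (t, x))
          ((fderiv ℝ φ (t, x)).comp (ContinuousLinearMap.inr ℝ ℝ (EuclideanSpace ℝ (Fin k)))) x :=
        (hφd (t, x)).hasFDerivAt.comp x (hasFDerivAt_prodMk_right t x)
      rw [h1.fderiv]; simp
    -- first coordinate
    have hφc : Integrable fun x => φ (c, x) :=
      (hφ.continuous.comp (by fun_prop)).integrable_of_hasCompactSupport
        (HasCompactSupport.intro hC2 fun x hx => hφC _ (hCm c x hx))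
    set P : EuclideanSpace ℝ (Fin k) → ℝ := fun x =>
      -(∫ t in Ioi c, fderiv ℝ φ (t, x) (a ω t, 0)) - α * φ (c, x) with hP
    have hPi : Integrable P := hG1.integral_prod_right.neg.sub (hφc.const_mul α)
    have hsl1 : ∀ x, ContDiff ℝ 1 (fun t => φ (t, x)) := fun x =>
      hφ.comp (contDiff_id.prodMk contDiff_const)
    have hib1 : ∀ x, IntegrableOn (fun t => φ (t, x) * a' ω t) (Ioi c) ∧
        ∫ t in Ioi c, φ (t, x) * a' ω t = P x := by
      intro x
      have h1 := haibp ω (fun t => φ (t, x)) (hsl1 x)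
        (HasCompactSupport.intro hC1 fun t ht => hφC _ (hCm1 t x ht)) (fun t => hφ0 _)
      simpa only [hd1] using h1
    have hP0 : ∀ x, 0 ≤ P x := fun x => by
      rw [← (hib1 x).2]
      exact integral_nonneg fun t => mul_nonneg (hφ0 _) (ha'0 _ _)
    have hPint : ∫ x, P x = -(∫ z, fderiv ℝ φ z (a ω z.1, 0) ∂μ) - α * ∫ x, φ (c, x) := by
      simp only [hP]
      have h1 : Integrable fun x => -∫ t in Ioi c, fderiv ℝ φ (t, x) (a ω t, 0) :=
        hG1.integral_prod_right.neg
      rw [integral_sub h1 (hφc.const_mul α), integral_neg,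
        integral_const_mul, integral_prod_symm _ hG1]
    have hma' : Measurable fun z : ℝ × EuclideanSpace ℝ (Fin k) =>
        ENNReal.ofReal (φ z * a' ω z.1) :=
      (hφ.continuous.measurable.mul
        (ha2m.comp (measurable_const.prodMk measurable_id))).ennreal_ofReal
    have hmδ' : Measurable fun z : ℝ × EuclideanSpace ℝ (Fin k) =>
        ENNReal.ofReal (φ z * δ' (ω, z.1) z.2) :=
      (hφ.continuous.measurable.mul
        (hδm.comp (measurable_const.prodMk measurable_id))).ennreal_ofReal
    have hL1 : ∫⁻ z, ENNReal.ofReal (φ z * a' ω z.1) ∂μ = ENNReal.ofReal (∫ x, P x) := by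
      rw [lintegral_prod_symm _ hma'.aemeasurable,
        ofReal_integral_eq_lintegral_ofReal hPi (Filter.Eventually.of_forall hP0)]
      refine lintegral_congr fun x => ?_
      rw [← (hib1 x).2, ofReal_integral_eq_lintegral_ofReal (hib1 x).1
        (Filter.Eventually.of_forall fun t => mul_nonneg (hφ0 _) (ha'0 _ _))]
    -- fibres
    have hib2 : ∀ t, 0 ≤ -∫ x, fderiv ℝ φ (t, x) (0, T' (ω, t) x) ∧
        ∫⁻ x, ENNReal.ofReal (φ (t, x) * δ' (ω, t) x) ≤
          ENNReal.ofReal (-∫ x, fderiv ℝ φ (t, x) (0, T' (ω, t) x)) := by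
      intro t
      have h1 := hibp' (ω, t) (fun x => φ (t, x)) (hφ.comp (contDiff_const.prodMk contDiff_id))
        (fun x => hφ0 _) (fun x hx => hφC _ (hCm t x hx))
      simpa only [hd2] using h1
    have hL2 : ∫⁻ z, ENNReal.ofReal (φ z * δ' (ω, z.1) z.2) ∂μ ≤
        ENNReal.ofReal (-∫ z, fderiv ℝ φ z (0, T' (ω, z.1) z.2) ∂μ) := by
      have h1 : Integrable (fun t => -∫ x, fderiv ℝ φ (t, x) (0, T' (ω, t) x))
          (volume.restrict (Ioi c)) := hG2.integral_prod_left.neg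
      rw [lintegral_prod _ hmδ'.aemeasurable, integral_prod _ hG2, ← integral_neg,
        ofReal_integral_eq_lintegral_ofReal h1
          (Filter.Eventually.of_forall fun t => (hib2 t).1)]
      exact lintegral_mono fun t => (hib2 t).2
    have hN2 : 0 ≤ -∫ z, fderiv ℝ φ z (0, T' (ω, z.1) z.2) ∂μ := by
      rw [integral_prod _ hG2, ← integral_neg]
      exact integral_nonneg fun t => (hib2 t).1
    have hN1 : 0 ≤ ∫ x, P x := integral_nonneg hP0
    have hsum : -(∫ z, fderiv ℝ φ z (a ω z.1, T' (ω, z.1) z.2) ∂μ) - α * ∫ x, φ (c, x) =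
        (∫ x, P x) + -∫ z, fderiv ℝ φ z (0, T' (ω, z.1) z.2) ∂μ := by
      have h1 : ∀ z, fderiv ℝ φ z (a ω z.1, T' (ω, z.1) z.2) =
          fderiv ℝ φ z (a ω z.1, 0) + fderiv ℝ φ z (0, T' (ω, z.1) z.2) := fun z => by
        rw [← map_add]; simp
      simp only [h1]
      rw [integral_add hG1 hG2, hPint]
      ring
    rw [hsum]
    refine ⟨add_nonneg hN1 hN2, ?_⟩
    rw [ENNReal.ofReal_add hN1 hN2, ← hL1]
    refine le_trans (le_of_eq ?_) (add_le_add_right hL2 _)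
    rw [← lintegral_add_left hma']
    refine lintegral_congr fun z => ?_
    rw [mul_add, ENNReal.ofReal_add (mul_nonneg (hφ0 _) (ha'0 _ _))
      (mul_nonneg (hφ0 _) (hδ'0 _ _))]

end BoxTransport

/-- Splitting off the first coordinate of a Euclidean space. -/
def splitE (k : ℕ) : EuclideanSpace ℝ (Fin (k + 1)) ≃L[ℝ] ℝ × EuclideanSpace ℝ (Fin k) :=
  (EuclideanSpace.equiv (Fin (k + 1)) ℝ).trans
    ((Fin.consEquivL ℝ fun _ : Fin (k + 1) => ℝ).symm.trans
      ((ContinuousLinearEquiv.refl ℝ ℝ).prodCongr (EuclideanSpace.equiv (Fin k) ℝ).symm))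

theorem splitE_fst (k : ℕ) (x : EuclideanSpace ℝ (Fin (k + 1))) : (splitE k x).1 = x 0 := rfl

theorem splitE_snd (k : ℕ) (x : EuclideanSpace ℝ (Fin (k + 1))) (i : Fin k) :
    (splitE k x).2 i = x i.succ := rfl

theorem inner_splitE (k : ℕ) (x y : EuclideanSpace ℝ (Fin (k + 1))) :
    ⟪x, y⟫ = (splitE k x).1 * (splitE k y).1 + ⟪(splitE k x).2, (splitE k y).2⟫ := by
  simp only [PiLp.inner_apply, splitE_fst, splitE_snd, Fin.sum_univ_succ]
  simp [mul_comm]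

theorem measurePreserving_splitE (k : ℕ) : MeasurePreserving (splitE k) volume volume := by
  have h1 := PiLp.volume_preserving_ofLp (Fin (k + 1))
  have h2 := volume_preserving_piFinSuccAbove (fun _ : Fin (k + 1) => ℝ) 0
  have h3 : MeasurePreserving
      (Prod.map id (WithLp.toLp 2) : ℝ × (Fin k → ℝ) → ℝ × EuclideanSpace ℝ (Fin k))
      volume volume := (MeasurePreserving.id volume).prod (PiLp.volume_preserving_toLp (Fin k))
  exact h3.comp (h2.comp h1)

theorem KnotheOn.comp_equiv {E F : Type} [NormedAddCommGroup E] [NormedSpace ℝ E] [MeasureSpace E]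
    [BorelSpace E] [NormedAddCommGroup F] [NormedSpace ℝ F] [MeasureSpace F] [BorelSpace F]
    (e : E ≃L[ℝ] F) (he : MeasurePreserving e volume volume) {k : ℕ} {K : Set F}
    (hK : KnotheOn F k K) : KnotheOn E k (e ⁻¹' K) := by
  intro Ω _ ρ σ C hC hρm hσm hρc hρ0 hρC hσc hσp hσ0
  have hem : MeasurableEmbedding e := e.toHomeomorph.measurableEmbedding
  have hes : Measurable e.symm := e.symm.continuous.measurable
  have hCs : ∀ x, x ∉ e '' C → e.symm x ∉ C := fun x hx h => hx ⟨_, h, e.apply_symm_apply x⟩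
  have hmap : Measurable fun q : Ω × F => (q.1, e.symm q.2) :=
    measurable_fst.prodMk (hes.comp measurable_snd)
  obtain ⟨T, δ, hTm, hδm, hTK, hδ0, hpush, hjac, hibp⟩ :=
    hK Ω (fun ω x => ρ ω (e.symm x)) (fun ω y => σ ω (e.symm y)) (e '' C) (hC.image e.continuous)
      (hρm.comp hmap) (hσm.comp hmap)
      (fun ω => (hρc ω).comp e.symm.continuous) (fun ω x => hρ0 _ _)
      (fun ω x hx => hρC ω _ (hCs x hx))
      (fun ω => (hσc ω).comp e.symm.continuous.continuousOn fun y hy => by simpa using hy)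
      (fun ω y hy => hσp ω _ (by simpa using hy)) (fun ω y hy => hσ0 ω _ (by simpa using hy))
  have hmap' : Measurable fun q : Ω × E => (q.1, e q.2) :=
    measurable_fst.prodMk (e.continuous.measurable.comp measurable_snd)
  have hintg : ∀ g : E → ℝ, ∫ x, g (e.symm x) = ∫ x, g x := fun g => by
    rw [← he.integral_comp hem fun x => g (e.symm x)]; simp
  have hlint : ∀ g : F → ℝ≥0∞, ∫⁻ x, g x = ∫⁻ x, g (e x) := fun g =>
    (he.lintegral_comp_emb hem g).symm
  refine ⟨fun ω x => e.symm (T ω (e x)), fun ω x => δ ω (e x), hes.comp (hTm.comp hmap'),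
    hδm.comp hmap', fun ω x => by simpa using hTK ω (e x), fun ω x => hδ0 _ _, ?_, ?_, ?_⟩
  · intro ω h hh
    have h1 := hpush ω (fun y => h (e.symm y)) (hh.comp hes)
    simp only [hlint, hintg, ContinuousLinearEquiv.symm_apply_apply] at h1
    exact h1
  · intro ω x hx
    have h1 := hjac ω (e x) (by simpa using hx)
    simpa only [hintg, ContinuousLinearEquiv.symm_apply_apply] using h1
  · intro ω φ hφ hφ0 hφC
    have h1 := hibp ω (fun x => φ (e.symm x)) (hφ.comp e.symm.contDiff) (fun x => hφ0 _)
      (fun x hx => hφC _ (hCs x hx))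
    have h2 : ∀ x, fderiv ℝ (fun x => φ (e.symm x)) x (T ω x) =
        (fun z => fderiv ℝ φ z (e.symm (T ω (e z)))) (e.symm x) := by
      intro x
      have h3 : HasFDerivAt (fun x => φ (e.symm x))
          ((fderiv ℝ φ (e.symm x)).comp (e.symm : F →L[ℝ] E)) x :=
        ((hφ.differentiable one_ne_zero) _).hasFDerivAt.comp x e.symm.hasFDerivAt
      rw [h3.fderiv]; simp
    simp only [h2] at h1
    rw [hintg (fun z => fderiv ℝ φ z (e.symm (T ω (e z))))] at h1
    simpa only [hlint, ContinuousLinearEquiv.symm_apply_apply] using h1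

theorem KnotheOn.prod {k : ℕ} {K : Set (EuclideanSpace ℝ (Fin k))}
    (hK : KnotheOn (EuclideanSpace ℝ (Fin k)) k K) (hKc : IsCompact K) (hKv : 0 < volume K)
    {α β : ℝ} (hαβ : α < β) :
    KnotheOn (ℝ × EuclideanSpace ℝ (Fin k)) (k + 1) (Icc α β ×ˢ K) := by
  intro Ω _ ρ σ C hC hρm hσm hρc hρ0 hρC hσc hσp hσ0
  obtain ⟨R, hR⟩ := hC.isBounded.exists_norm_le
  set c := -R - 1
  have hCc : ∀ x ∈ C, c < x.1 := by
    intro x hx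
    have h1 := (norm_fst_le x).trans (hR x hx)
    have h2 := neg_abs_le x.1
    rw [Real.norm_eq_abs] at h1
    simp only [c]; linarith
  obtain ⟨T, δ, hTm, hδm, hTK, hδ0, hpush, hjac, hibp⟩ :=
    hK.exists_halfSpace hKc hKv hαβ c Ω ρ σ C hC hρm hσm hρc hρ0 hρC hσc hσp hσ0
  have hCn : ∀ x : ℝ × EuclideanSpace ℝ (Fin k), x ∉ {x | c < x.1} → x ∉ C :=
    fun x hx h => hx (hCc x h)
  have hms : MeasurableSet {x : ℝ × EuclideanSpace ℝ (Fin k) | c < x.1} :=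
    measurableSet_lt measurable_const measurable_fst
  have hintg : ∀ g : ℝ × EuclideanSpace ℝ (Fin k) → ℝ, (∀ x ∉ C, g x = 0) →
      ∫ x in {x | c < x.1}, g x = ∫ x, g x := fun g hg =>
    setIntegral_eq_integral_of_forall_compl_eq_zero fun x hx => hg x (hCn x hx)
  have hlint : ∀ g : ℝ × EuclideanSpace ℝ (Fin k) → ℝ≥0∞, (∀ x ∉ C, g x = 0) →
      ∫⁻ x in {x | c < x.1}, g x = ∫⁻ x, g x := fun g hg => by
    rw [← lintegral_indicator hms]
    congr 1
    ext x
    by_cases hx : x ∈ {x : ℝ × EuclideanSpace ℝ (Fin k) | c < x.1}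
    · rw [indicator_of_mem hx]
    · rw [indicator_of_notMem hx, hg x (hCn x hx)]
  refine ⟨T, δ, hTm, hδm, hTK, hδ0, fun ω h hh => ?_, fun ω x hx => ?_,
    fun ω φ hφ hφ0 hφC => ?_⟩
  · have h1 := hpush ω h hh
    rwa [hlint _ fun x hx => by simp [hρC ω x hx], hintg _ (hρC ω)] at h1
  · have h1 := hjac ω x (hCc x (by by_contra h; exact hx.ne' (hρC ω x h))) hx
    rw [hintg _ (hρC ω)] at h1
    exact_mod_cast h1
  · have h1 := hibp ω φ hφ hφ0 hφC
    have h2 : ∀ x : EuclideanSpace ℝ (Fin k), φ (c, x) = 0 := fun x =>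
      hφC _ fun h => lt_irrefl c (hCc _ h)
    have h3 : ∀ x ∉ C, fderiv ℝ φ x (T ω x) = 0 := fun x hx => by
      have h4 : φ x = 0 := hφC x hx
      have h5 : IsLocalMin φ x := Filter.Eventually.of_forall fun y => by rw [h4]; exact hφ0 y
      rw [h5.fderiv_eq_zero]; rfl
    rw [hlint _ fun x hx => by simp [hφC x hx], hintg _ h3] at h1
    simpa [h2] using h1

/-- Knothe targets exist which contain arbitrarily large balls. -/
theorem exists_knotheOn (k : ℕ) (R : ℝ) : ∃ K : Set (EuclideanSpace ℝ (Fin k)), IsCompact K ∧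
    0 < volume K ∧ Metric.closedBall 0 R ⊆ K ∧ KnotheOn (EuclideanSpace ℝ (Fin k)) k K := by
  induction k with
  | zero =>
    refine ⟨univ, isCompact_univ, ?_, subset_univ _, knotheOn_zero⟩
    simp [volume_euclideanSpace_eq_dirac]
  | succ k ih =>
    obtain ⟨K, hKc, hKv, hKR, hK⟩ := ih
    have hR : -|R| - 1 < |R| + 1 := by linarith [abs_nonneg R]
    refine ⟨splitE k ⁻¹' (Icc (-|R| - 1) (|R| + 1) ×ˢ K), ?_, ?_, ?_,
      (hK.prod hKc hKv hR).comp_equiv _ (measurePreserving_splitE k)⟩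
    · exact (splitE k).toHomeomorph.isCompact_preimage.2 (isCompact_Icc.prod hKc)
    · rw [(measurePreserving_splitE k).measure_preimage
        (isCompact_Icc.prod hKc).measurableSet.nullMeasurableSet]
      change 0 < (volume.prod volume) _
      rw [Measure.prod_prod, Real.volume_Icc]
      exact ENNReal.mul_pos (by simpa using hR) hKv.ne'
    · intro x hx
      rw [mem_closedBall_zero_iff] at hx
      have h1 : ‖x‖ ^ 2 = (splitE k x).1 ^ 2 + ‖(splitE k x).2‖ ^ 2 := by
        rw [← real_inner_self_eq_norm_sq, inner_splitE, real_inner_self_eq_norm_sq]; ring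
      have h0 : 0 ≤ R := (norm_nonneg x).trans hx
      have h2 : (splitE k x).1 ^ 2 ≤ R ^ 2 := by nlinarith [norm_nonneg x, norm_nonneg (splitE k x).2]
      have h3 : ‖(splitE k x).2‖ ≤ R := by
        apply le_of_sq_le_sq _ h0
        nlinarith [norm_nonneg x, sq_nonneg (splitE k x).1]
      have h4 := abs_le_of_sq_le_sq' h2 h0
      refine ⟨⟨?_, ?_⟩, hKR (by simpa using h3)⟩
      · rw [abs_of_nonneg h0]; linarith
      · rw [abs_of_nonneg h0]; linarith

/-- Optimization in the scaling parameter `c` in the mass transport inequality. -/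
theorem trace_le_of_transport {m p q c Y B A : ℝ} (hm : 0 < m) (hp : 1 < p) (hpm : p < m + 1)
    (hq : q = p / (p - 1)) (hc : 0 < c) (hY : 0 < Y) (hB : 0 ≤ B) (hA : 0 ≤ A)
    (h : B + (m + 1) * c ^ (-(m + 1)⁻¹) * (c * Y) ≤
      p * m / (m + 1 - p) * (A ^ p⁻¹ * (c * Y) ^ q⁻¹)) :
    B ^ ((m + 1 - p) / m) ≤
      Y ^ (-(p - 1) / m) * ((p - 1) / (m + 1 - p)) ^ (p - (m + 1 - p) / m) * A := by
  have hmp : 0 < m + 1 - p := by linarith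
  have hp0 : 0 < p := by linarith
  have hp1 : 0 < p - 1 := by linarith
  set κ := (p - 1) / (m + 1 - p) with hκ
  have hκ0 : 0 < κ := by positivity
  set r := p * m / (m + 1 - p) with hr
  have hr0 : 0 < r := by positivity
  set e := (m + 1) * (p - 1) / (p * m) with he
  have he1 : 1 - e = r⁻¹ := by rw [he, hr]; field_simp; ring
  have he0 : 0 < e := by positivity
  set θ₀ := (κ * (A / Y) ^ p⁻¹) ^ r with hθ₀
  have hθ₀0 : 0 ≤ θ₀ := by positivity
  set θ := c ^ (1 - (m + 1)⁻¹) with hθ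
  have h1 : θ₀ ^ (1 - e) = κ * (A / Y) ^ p⁻¹ := by
    rw [he1, hθ₀, ← Real.rpow_mul (by positivity), mul_inv_cancel₀ hr0.ne', Real.rpow_one]
  have h2 : θ ^ e = c ^ q⁻¹ := by
    rw [hθ, ← Real.rpow_mul hc.le]
    congr 1
    have hm1 : (m + 1) ≠ 0 := by positivity
    have h3 : 1 - (m + 1)⁻¹ = m / (m + 1) := by
      rw [eq_div_iff hm1, sub_mul, inv_mul_cancel₀ hm1]; ring
    rw [h3, he, hq, inv_div, div_mul_div_comm, div_eq_div_iff (by positivity) (by positivity)]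
    ring
  have h3 : c ^ (-(m + 1)⁻¹) * c = θ := by
    rw [hθ, sub_eq_add_neg, Real.rpow_add hc, Real.rpow_one, mul_comm]
  have h4 : θ₀ ^ (1 - e) * θ ^ e ≤ (1 - e) * θ₀ + e * θ :=
    Real.geom_mean_le_arith_mean2_weighted (by rw [he1]; positivity) he0.le hθ₀0 (by positivity)
      (by ring)
  rw [h1, h2] at h4
  have h5 : r * (A ^ p⁻¹ * (c * Y) ^ q⁻¹) =
      (m + 1) * Y / e * (κ * (A / Y) ^ p⁻¹ * c ^ q⁻¹) := by
    have hq1 : q⁻¹ = 1 - p⁻¹ := by rw [hq]; field_simp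
    rw [Real.mul_rpow hc.le hY.le, Real.div_rpow hA hY.le, hq1, Real.rpow_sub hY, Real.rpow_one]
    have : 0 < Y ^ p⁻¹ := by positivity
    rw [hr, hκ, he]; field_simp
  have h6 : (m + 1) * Y / e * (κ * (A / Y) ^ p⁻¹ * c ^ q⁻¹) ≤
      (m + 1) * Y / e * ((1 - e) * θ₀ + e * θ) := by gcongr
  have h7 : (m + 1) * Y / e * ((1 - e) * θ₀ + e * θ) = Y / κ * θ₀ + (m + 1) * Y * θ := by
    rw [he1, hr, hκ, he]; field_simp
  have h8 : B ≤ Y / κ * θ₀ := by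
    have : (m + 1) * c ^ (-(m + 1)⁻¹) * (c * Y) = (m + 1) * Y * θ := by rw [← h3]; ring
    linarith
  calc B ^ ((m + 1 - p) / m) ≤ (Y / κ * θ₀) ^ ((m + 1 - p) / m) := by gcongr
    _ = (Y / κ) ^ ((m + 1 - p) / m) * (κ ^ p * (A / Y)) := by
        rw [Real.mul_rpow (by positivity) hθ₀0, hθ₀, ← Real.rpow_mul (by positivity)]
        have : r * ((m + 1 - p) / m) = p := by rw [hr]; field_simp
        rw [this, Real.mul_rpow hκ0.le (by positivity), ← Real.rpow_mul (by positivity),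
          inv_mul_cancel₀ hp0.ne', Real.rpow_one]
    _ = _ := by
        have h9 : -(p - 1) / m = (m + 1 - p) / m - 1 := by field_simp; ring
        rw [h9, Real.rpow_sub hY, Real.rpow_sub hκ0, Real.div_rpow hY.le hκ0.le, Real.rpow_one]
        field_simp

theorem ofReal_integral_le_lintegral {X : Type*} [MeasurableSpace X] {μ : Measure X} (g : X → ℝ) :
    ENNReal.ofReal (∫ x, g x ∂μ) ≤ ∫⁻ x, ENNReal.ofReal (g x) ∂μ := by
  by_cases hg : Integrable g μ
  · rw [integral_eq_lintegral_pos_part_sub_lintegral_neg_part hg]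
    refine (ENNReal.ofReal_le_ofReal (sub_le_self _ ENNReal.toReal_nonneg)).trans ?_
    exact ENNReal.ofReal_toReal_le
  · rw [integral_undef hg]; simp

theorem mul_add_mul_le_Lp {p q a b s t : ℝ} (hpq : p.HolderConjugate q) (ha : 0 ≤ a) (hb : 0 ≤ b)
    (hs : 0 ≤ s) (ht : 0 ≤ t) :
    a * s + b * t ≤ (a ^ p + b ^ p) ^ p⁻¹ * (s ^ q + t ^ q) ^ q⁻¹ := by
  have := Real.inner_le_Lp_mul_Lq_of_nonneg (Finset.univ : Finset (Fin 2)) hpq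
    (f := ![a, b]) (g := ![s, t]) (by simp [Fin.forall_fin_two, ha, hb])
    (by simp [Fin.forall_fin_two, hs, ht])
  simpa [Fin.sum_univ_two] using this

section BoxTrace

variable {m : ℕ}

theorem exists_box_lintegral_gt {F : ℝ × EuclideanSpace ℝ (Fin m) → ℝ≥0∞} {y : ℝ≥0∞}
    (hy : y < ∫⁻ z in {z | 1 < z.1}, F z) :
    ∃ (R : ℝ) (K : Set (EuclideanSpace ℝ (Fin m))), 1 < R ∧ IsCompact K ∧ 0 < volume K ∧
      KnotheOn (EuclideanSpace ℝ (Fin m)) m K ∧ y < ∫⁻ z in Icc 1 R ×ˢ K, F z := by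
  set s : ℕ → Set (ℝ × EuclideanSpace ℝ (Fin m)) := fun n =>
    Icc (1 : ℝ) (n + 2) ×ˢ Metric.closedBall 0 n with hs
  have hmono : Monotone s := by
    intro a b hab
    have : (a : ℝ) ≤ b := by exact_mod_cast hab
    exact prod_mono (Icc_subset_Icc le_rfl (by linarith)) (Metric.closedBall_subset_closedBall this)
  have hsub : {z : ℝ × EuclideanSpace ℝ (Fin m) | 1 < z.1} ⊆ ⋃ n, s n := by
    intro z hz
    obtain ⟨n, hn⟩ := exists_nat_ge (max z.1 ‖z.2‖)
    refine mem_iUnion.2 ⟨n, ⟨le_of_lt hz, ?_⟩, ?_⟩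
    · linarith [(le_max_left _ _).trans hn]
    · simpa using (le_max_right _ _).trans hn
  have h1 := hy.trans_le (lintegral_mono_set (f := F) hsub)
  rw [setLIntegral_iUnion_of_directed _ hmono.directed_le] at h1
  obtain ⟨n, hn⟩ := lt_iSup_iff.1 h1
  obtain ⟨K, hKc, hKv, hKn, hK⟩ := exists_knotheOn m n
  refine ⟨n + 2, K, by linarith [n.cast_nonneg (α := ℝ)], hKc, hKv, hK, hn.trans_le ?_⟩
  exact lintegral_mono_set (prod_mono le_rfl hKn)

theorem trace_box {p q r : ℝ} (hm : 1 ≤ m) (hp : 1 < p) (hpm : p < m + 1)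
    (hq : q = p / (p - 1)) (hr : r = p * m / (m + 1 - p))
    {f : ℝ × EuclideanSpace ℝ (Fin m) → ℝ} (hf : ContDiff ℝ 1 f) (hfc : HasCompactSupport f)
    {G : ℝ × EuclideanSpace ℝ (Fin m) → EuclideanSpace ℝ (Fin m)} (hGm : Measurable G)
    (hG : ∀ z y, fderiv ℝ f z (0, y) = ⟪G z, y⟫)
    {h ν : EuclideanSpace ℝ (Fin m) → ℝ} (hνc : Continuous ν) (hν0 : ∀ y, 0 ≤ ν y)
    (hhm : Measurable h) (hh0 : ∀ y, 0 ≤ h y) (hhν : ∀ x y, |⟪x, y⟫| ≤ h x * ν y) {A : ℝ}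
    (hA : 0 ≤ A)
    (hfA : ∫⁻ z in {z | 0 < z.1}, ENNReal.ofReal (|fderiv ℝ f z (1, 0)| ^ p + h (G z) ^ p) ≤
      ENNReal.ofReal A) {R : ℝ} (hR : 1 < R) {K : Set (EuclideanSpace ℝ (Fin m))}
    (hKc : IsCompact K) (hKv : 0 < volume K) (hK : KnotheOn (EuclideanSpace ℝ (Fin m)) m K)
    {Y : ℝ} (hY : Y = ∫ z in Icc 1 R ×ˢ K, (z.1 ^ q + ν z.2 ^ q) ^ (-(m : ℝ)))
    (hP : 0 < ∫ z in {z | 0 < z.1}, |f z| ^ ((m + 1) * p / (m + 1 - p))) :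
    ∃ c, 0 < c ∧ 0 < Y ∧ (∫ x, |f (0, x)| ^ r) + (m + 1) * c ^ (-((m : ℝ) + 1)⁻¹) * (c * Y) ≤
      p * m / (m + 1 - p) * (A ^ p⁻¹ * (c * Y) ^ q⁻¹) := by
  have hm0 : (0 : ℝ) < m := by exact_mod_cast hm
  have hmp : 0 < (m : ℝ) + 1 - p := by linarith
  have hp0 : 0 < p := by linarith
  have hp1 : 0 < p - 1 := by linarith
  have hpq : p.HolderConjugate q := by
    rw [hq]; exact Real.HolderConjugate.conjExponent hp
  have hq0 : 0 < q := hpq.symm.pos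
  have hr1 : 1 < r := by
    rw [hr, lt_div_iff₀ hmp]; nlinarith
  set ps := ((m : ℝ) + 1) * p / (m + 1 - p) with hps
  have hps0 : 0 < ps := by positivity
  have hrq : (r - 1) * q = ps := by rw [hr, hq, hps]; field_simp; ring
  have hrps : r + ps * ((m : ℝ) + 1)⁻¹ = ps := by rw [hr, hps]; field_simp
  set W : ℝ × EuclideanSpace ℝ (Fin m) → ℝ := fun z => z.1 ^ q + ν z.2 ^ q with hW
  set box : Set (ℝ × EuclideanSpace ℝ (Fin m)) := Icc 1 R ×ˢ K with hbox
  have hboxc : IsCompact box := isCompact_Icc.prod hKc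
  have hWc : Continuous W := by
    refine (continuous_fst.rpow_const fun _ => Or.inr hq0.le).add
      ((hνc.comp continuous_snd).rpow_const fun _ => Or.inr hq0.le)
  have hWpos : ∀ z ∈ box, 0 < W z := fun z hz =>
    add_pos_of_pos_of_nonneg (Real.rpow_pos_of_pos (by linarith [hz.1.1]) _)
      (Real.rpow_nonneg (hν0 _) _)
  have hWrc : ∀ s : ℝ, ContinuousOn (fun z => W z ^ s) box := fun s =>
    hWc.continuousOn.rpow_const fun z hz => Or.inl (hWpos z hz).ne'
  have hvolbox : 0 < volume box := by
    rw [hbox]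
    change 0 < (volume.prod volume) _
    rw [Measure.prod_prod, Real.volume_Icc]
    exact ENNReal.mul_pos (by simpa using hR) hKv.ne'
  have hpos : ∀ s : ℝ, 0 < ∫ z in box, W z ^ s := by
    intro s
    rw [setIntegral_pos_iff_support_of_nonneg_ae]
    · refine hvolbox.trans_le (measure_mono fun z hz => ⟨(Real.rpow_pos_of_pos (hWpos z hz) s).ne', hz⟩)
    · exact (ae_restrict_iff' hboxc.measurableSet).2
        (Filter.Eventually.of_forall fun z hz => Real.rpow_nonneg (hWpos z hz).le _)
    · exact (hWrc s).integrableOn_compact hboxc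
  set σ : ℝ × EuclideanSpace ℝ (Fin m) → ℝ := box.indicator fun z => W z ^ (-((m : ℝ) + 1)) with hσ
  have hσbox : ∀ z ∈ box, σ z = W z ^ (-((m : ℝ) + 1)) := fun z hz => indicator_of_mem hz _
  set X := ∫ z, σ z with hX
  have hXpos : 0 < X := by
    rw [hX, hσ, integral_indicator hboxc.measurableSet]; exact hpos _
  have hYpos : 0 < Y := hY ▸ hpos _
  have hf0c : Continuous f := hf.continuous
  set ρ : ℝ × EuclideanSpace ℝ (Fin m) → ℝ := fun z => |f z| ^ ps with hρ
  have hρc : Continuous ρ := hf0c.abs.rpow_const fun _ => Or.inr hps0.le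
  set φ : ℝ × EuclideanSpace ℝ (Fin m) → ℝ := fun z => |f z| ^ r with hφ
  have hφ1 : ContDiff ℝ 1 φ := (contDiff_norm_rpow (E := ℝ) hr1).comp hf
  have hf0 : ∀ z ∉ tsupport f, f z = 0 := fun z hz => image_eq_zero_of_notMem_tsupport hz
  have hWm : Measurable W := hWc.measurable
  obtain ⟨T, δ, hTm, hδm, hTK, hδ0, hpush, hjac, hibp⟩ :=
    hK.exists_halfSpace hKc hKv hR 0 Unit (fun _ => ρ) (fun _ => σ) (tsupport f) hfc
      (hρc.measurable.comp measurable_snd)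
      (((hWm.pow_const _).indicator hboxc.measurableSet).comp measurable_snd)
      (fun _ => hρc) (fun _ z => by positivity)
      (fun _ z hz => by simp [hρ, hf0 z hz, hps0.ne'])
      (fun _ => (hWrc _).congr hσbox)
      (fun _ z hz => by rw [hσbox z hz]; exact Real.rpow_pos_of_pos (hWpos z hz) _)
      (fun _ z hz => indicator_of_notMem hz _)
  replace hTm : Measurable (T ()) := hTm.comp (measurable_const.prodMk measurable_id)
  replace hδm : Measurable (δ ()) := hδm.comp (measurable_const.prodMk measurable_id)
  replace hpush := hpush ()
  replace hjac := hjac ()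
  replace hibp := hibp () φ hφ1 (fun z => by positivity)
    (fun z hz => by simp [hφ, hf0 z hz, (zero_lt_one.trans hr1).ne'])
  replace hTK := hTK ()
  replace hδ0 := hδ0 ()
  set T := T ()
  set δ := δ ()
  set μ : Measure (ℝ × EuclideanSpace ℝ (Fin m)) := volume.restrict {z | 0 < z.1} with hμ
  set P := ∫ z, ρ z ∂μ with hPdef
  have hTW : ∀ z, 0 < W (T z) := fun z => hWpos _ (hTK z)
  set c := P / X with hc
  have hc0 : 0 < c := div_pos hP hXpos
  refine ⟨c, hc0, hYpos, ?_⟩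
  -- the transported integral of `W`
  have hQ : ∫⁻ z, ENNReal.ofReal (ρ z) * ENNReal.ofReal (W (T z)) ∂μ = ENNReal.ofReal (c * Y) := by
    have h1 := hpush (fun z => ENNReal.ofReal (W z)) hWm.ennreal_ofReal
    have h2 : ∫⁻ z, ENNReal.ofReal (σ z) * ENNReal.ofReal (W z) = ENNReal.ofReal Y := by
      have h3 : ∀ z, ENNReal.ofReal (σ z) * ENNReal.ofReal (W z) =
          box.indicator (fun z => ENNReal.ofReal (W z ^ (-(m : ℝ)))) z := by
        intro z
        by_cases hz : z ∈ box
        · rw [indicator_of_mem hz, hσbox z hz, ← ENNReal.ofReal_mul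
            (Real.rpow_nonneg (hWpos z hz).le _)]
          congr 1
          nth_rewrite 2 [← Real.rpow_one (W z)]
          rw [← Real.rpow_add (hWpos z hz)]
          congr 1; ring
        · rw [indicator_of_notMem hz, hσ, indicator_of_notMem hz]; simp
      rw [lintegral_congr h3, lintegral_indicator hboxc.measurableSet, hY,
        ofReal_integral_eq_lintegral_ofReal ((hWrc _).integrableOn_compact hboxc)]
      exact (ae_restrict_iff' hboxc.measurableSet).2
        (Filter.Eventually.of_forall fun z hz => Real.rpow_nonneg (hWpos z hz).le _)
    rw [h2] at h1
    change _ * ENNReal.ofReal X = ENNReal.ofReal P * _ at h1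
    rw [mul_comm] at h1
    rw [(ENNReal.eq_div_iff (by simpa using hXpos) ENNReal.ofReal_ne_top).2 h1,
      ← ENNReal.ofReal_mul hP.le, ← ENNReal.ofReal_div_of_pos hXpos, hc]
    congr 1; ring
  -- lower bound for the divergence term
  have hlow : ENNReal.ofReal ((m + 1) * c ^ (-((m : ℝ) + 1)⁻¹) * (c * Y)) ≤
      ∫⁻ z, ENNReal.ofReal (φ z * δ z) ∂μ := by
    rw [ENNReal.ofReal_mul (by positivity), ← hQ, ← lintegral_const_mul' _ _ ENNReal.ofReal_ne_top]
    refine setLIntegral_mono' (measurableSet_lt measurable_const measurable_fst) fun z hz => ?_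
    rw [← ENNReal.ofReal_mul (by positivity), ← ENNReal.ofReal_mul (by positivity)]
    apply ENNReal.ofReal_le_ofReal
    by_cases hfz : f z = 0
    · have h1 : ρ z = 0 := by simp [hρ, hfz, hps0.ne']
      rw [h1]; simp only [zero_mul, mul_zero]
      exact mul_nonneg (by positivity) (hδ0 z)
    have hfz' : 0 < |f z| := abs_pos.2 hfz
    have hρz : 0 < ρ z := by positivity
    have h1 := hjac z hz hρz
    rw [hσbox _ (hTK z)] at h1
    change _ * (ρ z * X) ≤ _ * (_ * P) at h1
    -- solve for the divergence
    have h2 : ((m : ℝ) + 1) * c ^ (-((m : ℝ) + 1)⁻¹) * (|f z| ^ (ps * ((m : ℝ) + 1)⁻¹) * W (T z)) ≤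
        δ z := by
      refine le_of_pow_le_pow_left₀ (n := m + 1) (by omega) (hδ0 z) ?_
      have h3 : ∀ x : ℝ, 0 ≤ x → (x ^ ((m : ℝ) + 1)⁻¹) ^ (m + 1) = x := by
        intro x hx
        rw [← Real.rpow_natCast, ← Real.rpow_mul hx]
        push_cast
        rw [inv_mul_cancel₀ (by positivity), Real.rpow_one]
      have h4 : W (T z) ^ (-((m : ℝ) + 1)) = (W (T z) ^ (m + 1))⁻¹ := by
        rw [Real.rpow_neg (hTW z).le, ← Real.rpow_natCast]; push_cast; rfl
      rw [h4] at h1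
      rw [mul_pow, mul_pow, mul_pow, Real.rpow_mul hfz'.le, h3 _ (by positivity),
        Real.rpow_neg hc0.le, inv_pow, h3 _ hc0.le]
      have hWp : 0 < W (T z) ^ (m + 1) := pow_pos (hTW z) _
      change _ * c⁻¹ * (ρ z * _) ≤ _
      rw [hc, inv_div]
      have h5 := mul_le_mul_of_nonneg_right h1 (a := W (T z) ^ (m + 1) / P)
        (div_nonneg hWp.le hP.le)
      have hP' := hP.ne'
      change P ≠ 0 at hP'
      calc _ = ((m : ℝ) + 1) ^ (m + 1) * (ρ z * X) * (W (T z) ^ (m + 1) / P) := by ring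
        _ ≤ _ := h5
        _ = δ z ^ (m + 1) := by field_simp
    calc (m + 1) * c ^ (-((m : ℝ) + 1)⁻¹) * (ρ z * W (T z))
        = φ z * (((m : ℝ) + 1) * c ^ (-((m : ℝ) + 1)⁻¹) *
            (|f z| ^ (ps * ((m : ℝ) + 1)⁻¹) * W (T z))) := by
          have : ρ z = φ z * |f z| ^ (ps * ((m : ℝ) + 1)⁻¹) := by
            simp only [hρ, hφ]
            rw [← Real.rpow_add hfz', hrps]
          rw [this]; ring
      _ ≤ φ z * δ z := mul_le_mul_of_nonneg_left h2 (by positivity)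
  -- upper bound for the drift term
  set g : ℝ × EuclideanSpace ℝ (Fin m) → ℝ := fun z =>
    (|fderiv ℝ f z (1, 0)| ^ p + h (G z) ^ p) ^ p⁻¹ with hg
  have hg0 : ∀ z, 0 ≤ g z := fun z =>
    Real.rpow_nonneg (add_nonneg (by positivity) (Real.rpow_nonneg (hh0 _) _)) _
  have hgm : Measurable g := by
    have h1 : Measurable fun z => fderiv ℝ f z (1, 0) :=
      ((hf.continuous_fderiv one_ne_zero).clm_apply continuous_const).measurable
    exact (((measurable_norm.comp h1).pow_const p).add ((hhm.comp hGm).pow_const p)).pow_const _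
  have hup : ENNReal.ofReal (-∫ z, fderiv ℝ φ z (T z) ∂μ) ≤
      ENNReal.ofReal (r * (A ^ p⁻¹ * (c * Y) ^ q⁻¹)) := by
    rw [← integral_neg]
    refine (ofReal_integral_le_lintegral _).trans ?_
    have h1 : ∀ z, ENNReal.ofReal (-fderiv ℝ φ z (T z)) ≤ ENNReal.ofReal r *
        (ENNReal.ofReal (g z) * ENNReal.ofReal (|f z| ^ (r - 1) * W (T z) ^ q⁻¹)) := by
      intro z
      rw [← ENNReal.ofReal_mul (hg0 z), ← ENNReal.ofReal_mul (zero_lt_one.trans hr1).le]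
      apply ENNReal.ofReal_le_ofReal
      have hd : HasFDerivAt φ ((r * |f z| ^ (r - 2) * f z) • fderiv ℝ f z) z :=
        (hasDerivAt_abs_rpow (f z) hr1).comp_hasFDerivAt z
          (hf.differentiable one_ne_zero z).hasFDerivAt
      rw [hd.fderiv]
      have h2 : |fderiv ℝ f z (T z)| ≤ g z * W (T z) ^ q⁻¹ := by
        have h3 : T z = (T z).1 • ((1, 0) : ℝ × EuclideanSpace ℝ (Fin m)) + (0, (T z).2) := by
          ext <;> simp
        have hT1 : 0 ≤ (T z).1 := by linarith [(hTK z).1.1]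
        have h5 := congrArg (fderiv ℝ f z) h3
        rw [map_add, map_smul, hG, smul_eq_mul] at h5
        rw [h5]
        refine (abs_add_le _ _).trans ?_
        rw [abs_mul, abs_of_nonneg hT1, mul_comm]
        refine (add_le_add_right (hhν _ _) _).trans ?_
        exact mul_add_mul_le_Lp hpq (abs_nonneg _) (hh0 _) hT1 (hν0 _)
      have h4 : |(r * |f z| ^ (r - 2) * f z)| = r * |f z| ^ (r - 1) := by
        rw [abs_mul, abs_mul, abs_of_pos (zero_lt_one.trans hr1), abs_of_nonneg (by positivity)]
        by_cases hfz : f z = 0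
        · rw [hfz]; simp [(sub_pos.2 hr1).ne']
        · have hfz' : 0 < |f z| := abs_pos.2 hfz
          nth_rewrite 2 [← Real.rpow_one |f z|]
          rw [mul_assoc, ← Real.rpow_add hfz']
          congr 2; ring
      calc -(((r * |f z| ^ (r - 2) * f z) • fderiv ℝ f z) (T z))
          ≤ |(r * |f z| ^ (r - 2) * f z) * fderiv ℝ f z (T z)| := neg_le_abs _
        _ = r * |f z| ^ (r - 1) * |fderiv ℝ f z (T z)| := by rw [abs_mul, h4]
        _ ≤ r * |f z| ^ (r - 1) * (g z * W (T z) ^ q⁻¹) := by gcongr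
        _ = _ := by ring
    refine (lintegral_mono h1).trans ?_
    rw [lintegral_const_mul' _ _ ENNReal.ofReal_ne_top, ENNReal.ofReal_mul (by positivity)]
    gcongr
    have hm2 : Measurable fun z => |f z| ^ (r - 1) * W (T z) ^ q⁻¹ :=
      ((hf0c.abs.measurable).pow_const _).mul ((hWm.comp hTm).pow_const _)
    refine (ENNReal.lintegral_mul_le_Lp_mul_Lq μ hpq hgm.ennreal_ofReal.aemeasurable
      hm2.ennreal_ofReal.aemeasurable).trans ?_
    rw [ENNReal.ofReal_mul (by positivity), one_div, one_div,
      ← ENNReal.ofReal_rpow_of_nonneg hA (by positivity),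
      ← ENNReal.ofReal_rpow_of_nonneg (by positivity) (by positivity), ← hQ]
    have h5 : ∀ z, ENNReal.ofReal (g z) ^ p =
        ENNReal.ofReal (|fderiv ℝ f z (1, 0)| ^ p + h (G z) ^ p) := by
      intro z
      have h6 : 0 ≤ |fderiv ℝ f z (1, 0)| ^ p + h (G z) ^ p :=
        add_nonneg (by positivity) (Real.rpow_nonneg (hh0 _) _)
      rw [ENNReal.ofReal_rpow_of_nonneg (Real.rpow_nonneg h6 _) hp0.le]
      change ENNReal.ofReal (((|fderiv ℝ f z (1, 0)| ^ p + h (G z) ^ p) ^ p⁻¹) ^ p) = _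
      rw [← Real.rpow_mul h6, inv_mul_cancel₀ hp0.ne', Real.rpow_one]
    have h7 : ∀ z, ENNReal.ofReal (|f z| ^ (r - 1) * W (T z) ^ q⁻¹) ^ q =
        ENNReal.ofReal (ρ z) * ENNReal.ofReal (W (T z)) := by
      intro z
      rw [ENNReal.ofReal_rpow_of_nonneg (by have := hTW z; positivity) hq0.le,
        ← ENNReal.ofReal_mul (by positivity), Real.mul_rpow (by positivity)
        (by have := hTW z; positivity), ← Real.rpow_mul (abs_nonneg _), hrq,
        ← Real.rpow_mul (hTW z).le, inv_mul_cancel₀ hq0.ne', Real.rpow_one]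
    rw [lintegral_congr h5, lintegral_congr h7]
    gcongr
  have h8 := (ENNReal.ofReal_le_ofReal_iff hibp.1).1 (hlow.trans hibp.2)
  have h9 := (ENNReal.ofReal_le_ofReal_iff (by positivity)).1 hup
  rw [← hr]
  simp only [one_mul] at h8
  linarith

end BoxTrace

section HalfSpaceTrace

variable {m : ℕ}

theorem eq_zero_of_integral_halfSpace_eq_zero {g : ℝ × EuclideanSpace ℝ (Fin m) → ℝ}
    (hg : Continuous g) (hgc : HasCompactSupport g) {s : ℝ} (hs : 0 < s)
    (h : ∫ z in {z | 0 < z.1}, |g z| ^ s = 0) {z : ℝ × EuclideanSpace ℝ (Fin m)} (hz : 0 ≤ z.1) :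
    g z = 0 := by
  have hc : Continuous fun z => |g z| ^ s := hg.abs.rpow_const fun _ => Or.inr hs.le
  have ho : IsOpen {z : ℝ × EuclideanSpace ℝ (Fin m) | 0 < z.1} :=
    isOpen_lt continuous_const continuous_fst
  have hcs : HasCompactSupport fun z => |g z| ^ s := by
    refine hgc.comp_left (g := fun x : ℝ => |x| ^ s) ?_
    simp [hs.ne']
  have h1 := (integral_eq_zero_iff_of_nonneg (fun z => by positivity)
    (hc.integrable_of_hasCompactSupport hcs).integrableOn).1 h
  have h2 := Measure.eqOn_open_of_ae_eq h1 ho hc.continuousOn continuous_const.continuousOn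
  have h3 := h2.closure hc continuous_const
  have h4 : z ∈ closure {z : ℝ × EuclideanSpace ℝ (Fin m) | 0 < z.1} := by
    have h5 : {z : ℝ × EuclideanSpace ℝ (Fin m) | 0 < z.1} = Ioi 0 ×ˢ univ := by ext; simp
    rw [h5, closure_prod_eq, closure_Ioi]
    exact ⟨hz, by simp⟩
  have h5 : |g z| ^ s = 0 := h3 h4
  simpa using (Real.rpow_eq_zero (abs_nonneg _) hs.ne').1 h5

theorem trace_le_of_le_lintegral {p q r : ℝ} (hm : 1 ≤ m) (hp : 1 < p) (hpm : p < m + 1)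
    (hq : q = p / (p - 1)) (hr : r = p * m / (m + 1 - p))
    {f : ℝ × EuclideanSpace ℝ (Fin m) → ℝ} (hf : ContDiff ℝ 1 f) (hfc : HasCompactSupport f)
    {G : ℝ × EuclideanSpace ℝ (Fin m) → EuclideanSpace ℝ (Fin m)} (hGm : Measurable G)
    (hG : ∀ z y, fderiv ℝ f z (0, y) = ⟪G z, y⟫)
    {h ν : EuclideanSpace ℝ (Fin m) → ℝ} (hνc : Continuous ν) (hν0 : ∀ y, 0 ≤ ν y)
    (hhm : Measurable h) (hh0 : ∀ y, 0 ≤ h y) (hhν : ∀ x y, |⟪x, y⟫| ≤ h x * ν y) {A : ℝ}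
    (hA : 0 ≤ A)
    (hfA : ∫⁻ z in {z | 0 < z.1}, ENNReal.ofReal (|fderiv ℝ f z (1, 0)| ^ p + h (G z) ^ p) ≤
      ENNReal.ofReal A) {y₀ : ℝ} (hy₀ : 0 < y₀)
    (hy : ENNReal.ofReal y₀ ≤ ∫⁻ z in {z : ℝ × EuclideanSpace ℝ (Fin m) | 1 < z.1},
      ENNReal.ofReal ((z.1 ^ q + ν z.2 ^ q) ^ (-(m : ℝ)))) :
    (∫ x, |f (0, x)| ^ r) ^ ((m + 1 - p) / m) ≤
      y₀ ^ (-(p - 1) / m) * ((p - 1) / (m + 1 - p)) ^ (p - (m + 1 - p) / m) * A := by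
  have hm0 : (0 : ℝ) < m := by exact_mod_cast hm
  have hmp : 0 < (m : ℝ) + 1 - p := by linarith
  have hp0 : 0 < p := by linarith
  have hp1 : 0 < p - 1 := by linarith
  have hq0 : 0 < q := by rw [hq]; positivity
  have hr0 : 0 < r := by rw [hr]; positivity
  have hps : 0 < ((m : ℝ) + 1) * p / (m + 1 - p) := by positivity
  have hP0 : 0 ≤ ∫ z in {z | 0 < z.1}, |f z| ^ (((m : ℝ) + 1) * p / (m + 1 - p)) :=
    integral_nonneg fun z => by positivity
  rcases hP0.eq_or_lt with hP | hP
  · have h1 : ∀ x, f (0, x) = 0 := fun x =>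
      eq_zero_of_integral_halfSpace_eq_zero hf.continuous hfc hps hP.symm le_rfl
    simp only [h1, abs_zero, Real.zero_rpow hr0.ne', integral_zero]
    rw [Real.zero_rpow (by positivity)]
    positivity
  have hlt : ∀ y, 0 < y → y < y₀ → (∫ x, |f (0, x)| ^ r) ^ ((m + 1 - p) / m) ≤
      y ^ (-(p - 1) / m) * ((p - 1) / (m + 1 - p)) ^ (p - (m + 1 - p) / m) * A := by
    intro y hy0 hyy
    obtain ⟨R, K, hR, hKc, hKv, hK, hyK⟩ := exists_box_lintegral_gt
      (((ENNReal.ofReal_lt_ofReal_iff hy₀).2 hyy).trans_le hy)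
    obtain ⟨c, hc, hY, h1⟩ := trace_box hm hp hpm hq hr hf hfc hGm hG hνc hν0 hhm hh0 hhν hA hfA hR
      hKc hKv hK rfl hP
    set Y := ∫ z in Icc 1 R ×ˢ K, (z.1 ^ q + ν z.2 ^ q) ^ (-(m : ℝ)) with hYdef
    rw [hr] at h1 ⊢
    have h2 := trace_le_of_transport hm0 hp hpm hq hc hY
      (integral_nonneg fun x => by positivity) hA h1
    have hbox : IsCompact (Icc 1 R ×ˢ K) := isCompact_Icc.prod hKc
    have hWpos : ∀ z ∈ Icc 1 R ×ˢ K, 0 < z.1 ^ q + ν z.2 ^ q := fun z hz =>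
      add_pos_of_pos_of_nonneg (Real.rpow_pos_of_pos (by linarith [hz.1.1]) _)
        (Real.rpow_nonneg (hν0 _) _)
    have hWc : Continuous fun z : ℝ × EuclideanSpace ℝ (Fin m) => z.1 ^ q + ν z.2 ^ q :=
      (continuous_fst.rpow_const fun _ => Or.inr hq0.le).add
        ((hνc.comp continuous_snd).rpow_const fun _ => Or.inr hq0.le)
    have h3 : y ≤ Y := by
      rw [← ofReal_integral_eq_lintegral_ofReal
        ((hWc.continuousOn.rpow_const fun z hz => Or.inl (hWpos z hz).ne').integrableOn_compact hbox)
        ((ae_restrict_iff' hbox.measurableSet).2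
          (Filter.Eventually.of_forall fun z hz => Real.rpow_nonneg (hWpos z hz).le _))] at hyK
      exact ((ENNReal.ofReal_lt_ofReal_iff hY).1 hyK).le
    refine h2.trans ?_
    have h4 : Y ^ (-(p - 1) / m) ≤ y ^ (-(p - 1) / m) :=
      Real.rpow_le_rpow_of_nonpos hy0 h3 (div_nonpos_of_nonpos_of_nonneg (by linarith) hm0.le)
    gcongr
  have hcont : ContinuousAt (fun y : ℝ => y ^ (-(p - 1) / m) *
      ((p - 1) / (m + 1 - p)) ^ (p - (m + 1 - p) / m) * A) y₀ :=
    ((Real.continuousAt_rpow_const _ _ (Or.inl hy₀.ne')).mul_const _).mul_const _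
  refine ge_of_tendsto (hcont.tendsto.mono_left (nhdsWithin_le_nhds (s := Iio y₀))) ?_
  filter_upwards [Ioo_mem_nhdsLT hy₀] with y hy
  exact hlt y hy.1 hy.2

end HalfSpaceTrace

section HalfSpaceVolume

variable {m : ℕ}

theorem lintegral_rpow_mul_exp_neg_mul {a r : ℝ} (ha : 0 < a) (hr : 0 < r) :
    ∫⁻ t in Ioi 0, ENNReal.ofReal (t ^ (a - 1) * Real.exp (-(r * t))) =
      ENNReal.ofReal (Real.Gamma a * r ^ (-a)) := by
  have h := Real.integral_rpow_mul_exp_neg_mul_Ioi ha hr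
  have hpos : 0 < (1 / r) ^ a * Real.Gamma a := by
    have := Real.Gamma_pos_of_pos ha
    positivity
  have hintg : IntegrableOn (fun t : ℝ => t ^ (a - 1) * Real.exp (-(r * t))) (Ioi 0) := by
    by_contra hc
    rw [integral_undef hc] at h
    exact hpos.ne h
  rw [← ofReal_integral_eq_lintegral_ofReal hintg, h, one_div, Real.inv_rpow hr.le,
    Real.rpow_neg hr.le, mul_comm]
  exact (ae_restrict_iff' measurableSet_Ioi).2 (Filter.Eventually.of_forall fun t ht => by
    have : 0 < t := ht
    positivity)

theorem le_lintegral_exp_neg {ν : EuclideanSpace ℝ (Fin m) → ℝ} (hνc : Continuous ν)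
    (hν0 : ∀ y, 0 ≤ ν y) {V q : ℝ} (hV : 0 ≤ V) (hq : 0 < q)
    (hvol : ∀ c, 0 < c → ENNReal.ofReal (V * c ^ (m : ℝ)) ≤ volume {y | ν y < c}) {l : ℝ}
    (hl : 0 < l) :
    ENNReal.ofReal (V * Real.Gamma (m / q + 1) * l ^ (-(m / q))) ≤
      ∫⁻ y, ENNReal.ofReal (Real.exp (-(l * ν y ^ q))) := by
  have hνq : Continuous fun y => l * ν y ^ q :=
    continuous_const.mul (hνc.rpow_const fun _ => Or.inr hq.le)
  have hmeas : MeasurableSet {z : EuclideanSpace ℝ (Fin m) × ℝ | l * ν z.1 ^ q < z.2} :=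
    measurableSet_lt (hνq.measurable.comp measurable_fst) measurable_snd
  have h1 : ∀ y, ENNReal.ofReal (Real.exp (-(l * ν y ^ q))) =
      ∫⁻ u, {z : EuclideanSpace ℝ (Fin m) × ℝ | l * ν z.1 ^ q < z.2}.indicator
        (fun z => ENNReal.ofReal (Real.exp (-z.2))) (y, u) := by
    intro y
    rw [← integral_exp_neg_Ioi, ofReal_integral_eq_lintegral_ofReal
      (integrableOn_exp_neg_Ioi _) (Filter.Eventually.of_forall fun _ => by positivity),
      ← lintegral_indicator measurableSet_Ioi]
    rfl
  simp_rw [h1]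
  rw [lintegral_lintegral_swap]
  · have h2 : ∀ u ∈ Ioi (0 : ℝ), ENNReal.ofReal (V * l ^ (-(m / q))) *
        ENNReal.ofReal (u ^ (m / q + 1 - 1) * Real.exp (-(1 * u))) ≤
        ∫⁻ y, {z : EuclideanSpace ℝ (Fin m) × ℝ | l * ν z.1 ^ q < z.2}.indicator
        (fun z => ENNReal.ofReal (Real.exp (-z.2))) (y, u) := by
      intro u hu
      have hu0 : 0 < u := hu
      have h3 : ∀ y, {z : EuclideanSpace ℝ (Fin m) × ℝ | l * ν z.1 ^ q < z.2}.indicator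
          (fun z => ENNReal.ofReal (Real.exp (-z.2))) (y, u) =
          {y | ν y < (u / l) ^ q⁻¹}.indicator (fun _ => ENNReal.ofReal (Real.exp (-u))) y := by
        intro y
        have h4 : (l * ν y ^ q < u) ↔ ν y < (u / l) ^ q⁻¹ := by
          rw [Real.lt_rpow_inv_iff_of_pos (hν0 y) (by positivity) hq, lt_div_iff₀' hl]
        simp only [indicator, mem_ofPred_eq, h4]
      simp_rw [h3]
      rw [lintegral_indicator_const (measurableSet_lt hνc.measurable measurable_const)]
      refine le_trans (le_of_eq ?_) (mul_le_mul_right (hvol _ (by positivity)) _)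
      rw [← ENNReal.ofReal_mul (by positivity), ← ENNReal.ofReal_mul (by positivity)]
      congr 1
      rw [← Real.rpow_mul (by positivity), Real.div_rpow hu0.le hl.le, Real.rpow_neg hl.le,
        one_mul, add_sub_cancel_right, inv_mul_eq_div]
      ring
    refine le_trans (le_of_eq ?_) ((setLIntegral_mono' measurableSet_Ioi h2).trans
      (setLIntegral_le_lintegral _ _))
    rw [lintegral_const_mul' _ _ ENNReal.ofReal_ne_top, lintegral_rpow_mul_exp_neg_mul
      (by positivity) one_pos, ← ENNReal.ofReal_mul (by positivity), Real.one_rpow]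
    congr 1; ring
  · exact (Measurable.indicator (by fun_prop) hmeas).aemeasurable

theorem le_lintegral_halfSpace (hm : 1 ≤ m) {p q : ℝ} (hp : 1 < p) (hpm : p < m + 1)
    (hq : q = p / (p - 1)) {ν : EuclideanSpace ℝ (Fin m) → ℝ} (hνc : Continuous ν)
    (hν0 : ∀ y, 0 ≤ ν y) {V : ℝ} (hV : 0 ≤ V)
    (hvol : ∀ c, 0 < c → ENNReal.ofReal (V * c ^ (m : ℝ)) ≤ volume {y | ν y < c}) :
    ENNReal.ofReal ((p - 1) / (m + 1 - p) *
        (V * Real.Gamma (m / q + 1) * Real.Gamma (m / p) / Real.Gamma m)) ≤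
      ∫⁻ z in {z : ℝ × EuclideanSpace ℝ (Fin m) | 1 < z.1},
        ENNReal.ofReal ((z.1 ^ q + ν z.2 ^ q) ^ (-(m : ℝ))) := by
  have hm0 : (0 : ℝ) < m := by exact_mod_cast hm
  have hmp : 0 < (m : ℝ) + 1 - p := by linarith
  have hp0 : 0 < p := by linarith
  have hp1 : 0 < p - 1 := by linarith
  have hq0 : 0 < q := by rw [hq]; positivity
  have hΓ : 0 < Real.Gamma m := Real.Gamma_pos_of_pos hm0
  have hΓ1 : 0 < Real.Gamma (m / p) := Real.Gamma_pos_of_pos (by positivity)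
  have hΓ2 : 0 < Real.Gamma (m / q + 1) := Real.Gamma_pos_of_pos (by positivity)
  have hνq : Continuous fun y => ν y ^ q := hνc.rpow_const fun _ => Or.inr hq0.le
  have hprod : (volume : Measure (ℝ × EuclideanSpace ℝ (Fin m))).restrict {z | 1 < z.1} =
      (volume.restrict (Ioi 1)).prod volume := by
    have : {z : ℝ × EuclideanSpace ℝ (Fin m) | 1 < z.1} = Ioi 1 ×ˢ univ := by ext; simp
    rw [this, Measure.volume_eq_prod, ← Measure.prod_restrict, Measure.restrict_univ]
  have hmeas : Measurable fun z : ℝ × EuclideanSpace ℝ (Fin m) =>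
      ENNReal.ofReal ((z.1 ^ q + ν z.2 ^ q) ^ (-(m : ℝ))) :=
    (((measurable_fst.pow_const q).add (hνq.measurable.comp measurable_snd)).pow_const
      _).ennreal_ofReal
  rw [hprod, lintegral_prod _ hmeas.aemeasurable]
  set a := V * Real.Gamma (m / q + 1) / Real.Gamma m with ha
  have ha0 : 0 ≤ a := by positivity
  have hin : ∀ s ∈ Ioi (1 : ℝ), ENNReal.ofReal (a * Real.Gamma (m / p)) *
      ENNReal.ofReal (s ^ (-(m / (p - 1)))) ≤
      ∫⁻ y, ENNReal.ofReal ((s ^ q + ν y ^ q) ^ (-(m : ℝ))) := by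
    intro s hs
    have hs0 : 0 < s := zero_lt_one.trans hs
    have h1 : ∀ y, ENNReal.ofReal ((s ^ q + ν y ^ q) ^ (-(m : ℝ))) = ∫⁻ l in Ioi 0,
        ENNReal.ofReal ((Real.Gamma m)⁻¹ * (l ^ ((m : ℝ) - 1) * Real.exp (-(s ^ q * l)))) *
          ENNReal.ofReal (Real.exp (-(l * ν y ^ q))) := by
      intro y
      have hW : 0 < s ^ q + ν y ^ q :=
        add_pos_of_pos_of_nonneg (by positivity) (Real.rpow_nonneg (hν0 y) _)
      have h2 := lintegral_rpow_mul_exp_neg_mul hm0 hW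
      have h3 : ENNReal.ofReal ((s ^ q + ν y ^ q) ^ (-(m : ℝ))) = ENNReal.ofReal (Real.Gamma m)⁻¹ *
          ENNReal.ofReal (Real.Gamma m * (s ^ q + ν y ^ q) ^ (-(m : ℝ))) := by
        rw [← ENNReal.ofReal_mul (by positivity)]
        congr 1; field_simp
      rw [h3, ← h2, ← lintegral_const_mul' _ _ ENNReal.ofReal_ne_top]
      refine setLIntegral_congr_fun measurableSet_Ioi fun l hl => ?_
      have hl0 : 0 < l := hl
      rw [← ENNReal.ofReal_mul (by positivity), ← ENNReal.ofReal_mul (by positivity), mul_assoc,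
        mul_assoc, ← Real.exp_add]
      congr 4; ring
    simp_rw [h1]
    rw [lintegral_lintegral_swap]
    · have h4 : ∀ l ∈ Ioi (0 : ℝ), ENNReal.ofReal a *
          ENNReal.ofReal (l ^ (m / p - 1) * Real.exp (-(s ^ q * l))) ≤ ∫⁻ y,
          ENNReal.ofReal ((Real.Gamma m)⁻¹ * (l ^ ((m : ℝ) - 1) * Real.exp (-(s ^ q * l)))) *
          ENNReal.ofReal (Real.exp (-(l * ν y ^ q))) := by
        intro l hl
        have hl0 : 0 < l := hl
        rw [lintegral_const_mul' _ _ ENNReal.ofReal_ne_top]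
        refine le_trans (le_of_eq ?_)
          (mul_le_mul_right (le_lintegral_exp_neg hνc hν0 hV hq0 hvol hl0) _)
        rw [← ENNReal.ofReal_mul (by positivity), ← ENNReal.ofReal_mul (by positivity), ha]
        congr 1
        have h5 : (m : ℝ) / p - 1 = ((m : ℝ) - 1) + (-(m / q)) := by
          rw [hq]; field_simp; ring
        rw [h5, Real.rpow_add hl0]
        ring
      refine le_trans (le_of_eq ?_) (setLIntegral_mono' measurableSet_Ioi h4)
      rw [lintegral_const_mul' _ _ ENNReal.ofReal_ne_top, lintegral_rpow_mul_exp_neg_mul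
        (by positivity) (by positivity), ← ENNReal.ofReal_mul (by positivity),
        ← ENNReal.ofReal_mul (by positivity), ← Real.rpow_mul hs0.le]
      have h6 : q * (-(m / p)) = -(m / (p - 1)) := by rw [hq]; field_simp
      rw [h6]
      congr 1; ring
    · have h7 : Measurable fun z : EuclideanSpace ℝ (Fin m) × ℝ =>
          ENNReal.ofReal (Real.exp (-(z.2 * ν z.1 ^ q))) :=
        (Real.measurable_exp.comp
          (measurable_snd.mul (hνq.measurable.comp measurable_fst)).neg).ennreal_ofReal
      exact (Measurable.mul (by fun_prop) h7).aemeasurable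
  refine le_trans (le_of_eq ?_) (setLIntegral_mono' measurableSet_Ioi hin)
  have hexp : -((m : ℝ) / (p - 1)) < -1 := by
    rw [neg_lt_neg_iff, lt_div_iff₀ hp1]; linarith
  rw [lintegral_const_mul' _ _ ENNReal.ofReal_ne_top, ← ofReal_integral_eq_lintegral_ofReal
    (integrableOn_Ioi_rpow_of_lt hexp one_pos), integral_Ioi_rpow_of_lt hexp one_pos,
    ← ENNReal.ofReal_mul (by positivity), Real.one_rpow]
  · congr 1
    have h8 : -(1 : ℝ) / (-(m / (p - 1)) + 1) = (p - 1) / (m + 1 - p) := by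
      rw [div_eq_div_iff (by linarith) hmp.ne']
      field_simp
      ring
    rw [h8, ha]
    ring
  · exact (ae_restrict_iff' measurableSet_Ioi).2 (Filter.Eventually.of_forall fun t ht => by
      have : (0 : ℝ) < t := zero_lt_one.trans ht
      positivity)

end HalfSpaceVolume

section SteinerSymmetrization

variable {k : ℕ}

/-- Steiner symmetrization with respect to the hyperplane `{0} × ℝ^k`. -/
def steiner (L : Set (ℝ × EuclideanSpace ℝ (Fin k))) : Set (ℝ × EuclideanSpace ℝ (Fin k)) :=
  {Z | ∃ a b, (a, Z.2) ∈ L ∧ (b, Z.2) ∈ L ∧ 2 * |Z.1| < b - a}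

/-- The upper end of the vertical section of `L` over `z`. -/
def upperEnd (L : Set (ℝ × EuclideanSpace ℝ (Fin k))) (z : EuclideanSpace ℝ (Fin k)) : ℝ :=
  sSup {t | (t, z) ∈ L}

/-- The lower end of the vertical section of `L` over `z`. -/
def lowerEnd (L : Set (ℝ × EuclideanSpace ℝ (Fin k))) (z : EuclideanSpace ℝ (Fin k)) : ℝ :=
  sInf {t | (t, z) ∈ L}

/-- The midpoint of the vertical section of `L` over `z`. -/
def midPoint (L : Set (ℝ × EuclideanSpace ℝ (Fin k))) (z : EuclideanSpace ℝ (Fin k)) : ℝ :=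
  (lowerEnd L z + upperEnd L z) / 2

variable {L : Set (ℝ × EuclideanSpace ℝ (Fin k))}

theorem isOpen_steiner (hL : IsOpen L) : IsOpen (steiner L) := by
  have : steiner L = ⋃ (a : ℝ) (b : ℝ), {Z | (a, Z.2) ∈ L ∧ (b, Z.2) ∈ L ∧ 2 * |Z.1| < b - a} := by
    ext Z; simp [steiner]
  rw [this]
  refine isOpen_iUnion fun a => isOpen_iUnion fun b => ?_
  refine (hL.preimage (f := fun Z : ℝ × EuclideanSpace ℝ (Fin k) => (a, Z.2)) (by fun_prop)).inter
    ((hL.preimage (f := fun Z : ℝ × EuclideanSpace ℝ (Fin k) => (b, Z.2)) (by fun_prop)).inter ?_)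
  exact isOpen_lt (continuous_const.mul continuous_fst.abs) continuous_const

theorem convex_steiner (hL : Convex ℝ L) : Convex ℝ (steiner L) := by
  rintro ⟨x, x'⟩ ⟨a, b, ha, hb, hab⟩ ⟨y, y'⟩ ⟨c, d, hc, hd, hcd⟩ s t hs ht hst
  refine ⟨s * a + t * c, s * b + t * d, hL ha hc hs ht hst, hL hb hd hs ht hst, ?_⟩
  simp only [Prod.smul_mk, Prod.mk_add_mk, smul_eq_mul] at *
  have h1 : |s * x + t * y| ≤ s * |x| + t * |y| := by
    refine (abs_add_le _ _).trans ?_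
    rw [abs_mul, abs_mul, abs_of_nonneg hs, abs_of_nonneg ht]
  rcases hs.eq_or_lt with rfl | hs'
  · have : t = 1 := by linarith
    subst this; linarith
  · have := mul_lt_mul_of_pos_left hab hs'
    have := mul_le_mul_of_nonneg_left hcd.le ht
    linarith

theorem section_bddAbove (hb : Bornology.IsBounded L) (z : EuclideanSpace ℝ (Fin k)) :
    Bornology.IsBounded {t | (t, z) ∈ L} :=
  (hb.image_fst).subset fun t ht => ⟨(t, z), ht, rfl⟩

theorem section_eq_Ioo (ho : IsOpen L) (hc : Convex ℝ L) (hb : Bornology.IsBounded L)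
    (z : EuclideanSpace ℝ (Fin k)) : {t | (t, z) ∈ L} = Ioo (lowerEnd L z) (upperEnd L z) := by
  have hA := section_bddAbove hb z
  have hAo : IsOpen {t | (t, z) ∈ L} := ho.preimage (by fun_prop)
  have hAc : Convex ℝ {t | (t, z) ∈ L} := by
    intro a ha b hb' s t hs ht hst
    have := hc ha hb' hs ht hst
    simp only [Prod.smul_mk, Prod.mk_add_mk, ← add_smul, hst, one_smul] at this
    exact this
  refine Subset.antisymm ?_ ?_
  · rcases eq_empty_or_nonempty {t | (t, z) ∈ L} with h | h
    · rw [h]; exact empty_subset _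
    · rw [← interior_Icc]
      exact hAo.subset_interior_iff.2
        fun t ht => ⟨csInf_le hA.bddBelow ht, le_csSup hA.bddAbove ht⟩
  · rcases eq_empty_or_nonempty {t | (t, z) ∈ L} with h | h
    · rw [lowerEnd, upperEnd, h]; simp
    exact IsConnected.Ioo_csInf_csSup_subset ⟨h, hAc.isPreconnected⟩ hA.bddBelow hA.bddAbove

theorem mem_iff_mem_Ioo (ho : IsOpen L) (hc : Convex ℝ L) (hb : Bornology.IsBounded L)
    (Z : ℝ × EuclideanSpace ℝ (Fin k)) : Z ∈ L ↔ lowerEnd L Z.2 < Z.1 ∧ Z.1 < upperEnd L Z.2 := by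
  change Z.1 ∈ {t | (t, Z.2) ∈ L} ↔ _
  rw [section_eq_Ioo ho hc hb]; rfl

theorem mem_steiner_iff (ho : IsOpen L) (hc : Convex ℝ L) (hb : Bornology.IsBounded L)
    (Z : ℝ × EuclideanSpace ℝ (Fin k)) :
    Z ∈ steiner L ↔ |Z.1| < (upperEnd L Z.2 - lowerEnd L Z.2) / 2 := by
  constructor
  · rintro ⟨a, b, ha, hb', hab⟩
    rw [mem_iff_mem_Ioo ho hc hb] at ha hb'
    simp only at ha hb'
    linarith
  · intro h
    set A := {t | (t, Z.2) ∈ L} with hAdef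
    set δ := (upperEnd L Z.2 - lowerEnd L Z.2) / 2 - |Z.1| with hδ
    have habs := abs_nonneg Z.1
    have h1 : ∀ t, lowerEnd L Z.2 < t → t < upperEnd L Z.2 → (t, Z.2) ∈ L := fun t h1 h2 =>
      (mem_iff_mem_Ioo ho hc hb _).2 ⟨h1, h2⟩
    refine ⟨lowerEnd L Z.2 + δ / 2, upperEnd L Z.2 - δ / 2, h1 _ ?_ ?_, h1 _ ?_ ?_, ?_⟩ <;> linarith

theorem isBounded_steiner {R : ℝ}
    (hb : ∀ Z ∈ L, Z.1 ^ 2 + ‖Z.2‖ ^ 2 < R ^ 2) :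
    ∀ Z ∈ steiner L, Z.1 ^ 2 + ‖Z.2‖ ^ 2 < R ^ 2 := by
  rintro Z ⟨a, b, ha, hb', hab⟩
  have h1 := hb _ ha
  have h2 := hb _ hb'
  simp only at h1 h2
  have h3 : Z.1 ^ 2 ≤ ((b - a) / 2) ^ 2 := by
    rw [← sq_abs Z.1]
    have := abs_nonneg Z.1
    nlinarith
  nlinarith [sq_nonneg (a + b)]

theorem measurable_upperEnd (ho : IsOpen L) (hb : Bornology.IsBounded L) :
    Measurable (upperEnd L) := by
  refine measurable_of_Ioi fun c => ?_
  have hop : ∀ U : Set (ℝ × EuclideanSpace ℝ (Fin k)), IsOpen U → MeasurableSet (Prod.snd '' U) :=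
    fun U hU => (isOpenMap_snd U hU).measurableSet
  have hmem : ∀ z, z ∈ Prod.snd '' L ↔ {t | (t, z) ∈ L}.Nonempty := by
    intro z
    constructor
    · rintro ⟨⟨t, z⟩, h, rfl⟩; exact ⟨t, h⟩
    · rintro ⟨t, h⟩; exact ⟨(t, z), h, rfl⟩
  have h1 : upperEnd L ⁻¹' Ioi c = Prod.snd '' (L ∩ {Z | c < Z.1}) ∪
      ((Prod.snd '' L)ᶜ ∩ {_z | c < 0}) := by
    ext z
    by_cases hz : {t | (t, z) ∈ L}.Nonempty
    · have h2 : z ∈ upperEnd L ⁻¹' Ioi c ↔ ∃ t ∈ {t | (t, z) ∈ L}, c < t :=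
        lt_csSup_iff (section_bddAbove hb z).bddAbove hz
      rw [h2]
      constructor
      · rintro ⟨t, ht, hct⟩; exact Or.inl ⟨(t, z), ⟨ht, hct⟩, rfl⟩
      · rintro (⟨⟨t, z⟩, ⟨h, h'⟩, rfl⟩ | ⟨h, -⟩)
        · exact ⟨t, h, h'⟩
        · exact absurd ((hmem z).2 hz) h
    · have h2 : upperEnd L z = 0 := by
        rw [upperEnd, not_nonempty_iff_eq_empty.1 hz, Real.sSup_empty]
      have h3 : z ∉ Prod.snd '' L := fun h => hz ((hmem z).1 h)
      have h4 : z ∉ Prod.snd '' (L ∩ {Z | c < Z.1}) := fun h => h3 (image_mono inter_subset_left h)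
      simp only [mem_preimage, h2, mem_Ioi, mem_union, h4, mem_inter_iff, mem_compl_iff, h3,
        false_or, not_false_eq_true, true_and]
      rfl
  rw [h1]
  refine (hop _ (ho.inter (isOpen_lt continuous_const continuous_fst))).union
    ((hop _ ho).compl.inter (MeasurableSet.const _))

theorem lowerEnd_eq (z : EuclideanSpace ℝ (Fin k)) :
    lowerEnd L z = -upperEnd ((fun Z => (-Z.1, Z.2)) ⁻¹' L) z := by
  rw [lowerEnd, Real.sInf_def, upperEnd]; rfl

theorem measurable_midPoint (ho : IsOpen L) (hb : Bornology.IsBounded L) :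
    Measurable (midPoint L) := by
  have h1 : Measurable (lowerEnd L) := by
    have h2 : lowerEnd L = fun z => -upperEnd ((fun Z => (-Z.1, Z.2)) ⁻¹' L) z :=
      funext lowerEnd_eq
    rw [h2]
    refine (measurable_upperEnd (ho.preimage (by fun_prop)) ?_).neg
    obtain ⟨C, hC⟩ := hb.exists_norm_le
    refine isBounded_iff_forall_norm_le.2 ⟨C, fun Z hZ => ?_⟩
    have := hC _ hZ
    simpa [Prod.norm_def] using this
  exact (h1.add (measurable_upperEnd ho hb)).div_const 2

/-- A shear or sheared reflection along the vertical direction preserves the volume. -/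
theorem measurePreserving_shear {g : EuclideanSpace ℝ (Fin k) → ℝ} (hg : Measurable g) (s : ℤˣ) :
    MeasurePreserving (fun Z : ℝ × EuclideanSpace ℝ (Fin k) => (g Z.2 + (s : ℤ) * Z.1, Z.2)) := by
  have h1 : ∀ c : ℝ, MeasurePreserving (fun t : ℝ => c + (s : ℤ) * t) volume volume := by
    intro c
    rcases Int.units_eq_one_or s with rfl | rfl
    · simpa using measurePreserving_add_left volume c
    · simpa [sub_eq_add_neg] using Measure.measurePreserving_sub_left volume c
  have h2 := MeasurePreserving.skew_product (μa := (volume : Measure (EuclideanSpace ℝ (Fin k))))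
    (μc := (volume : Measure ℝ)) (MeasurePreserving.id _)
    (g := fun z t => g z + (s : ℤ) * t) (by unfold Function.uncurry; fun_prop)
    (Filter.Eventually.of_forall fun z => (h1 (g z)).map_eq)
  exact (Measure.measurePreserving_swap.comp h2).comp Measure.measurePreserving_swap

theorem shear_preimage (ho : IsOpen L) (hc : Convex ℝ L) (hb : Bornology.IsBounded L) (s : ℤˣ) :
    (fun Z : ℝ × EuclideanSpace ℝ (Fin k) => (midPoint L Z.2 + (s : ℤ) * Z.1, Z.2)) ⁻¹' L =
      steiner L := by
  ext Z
  rw [mem_preimage, mem_iff_mem_Ioo ho hc hb, mem_steiner_iff ho hc hb, abs_lt]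
  simp only [midPoint]
  rcases Int.units_eq_one_or s with rfl | rfl
  · push_cast
    constructor <;> rintro ⟨h1, h2⟩ <;> constructor <;> linarith
  · push_cast
    constructor <;> rintro ⟨h1, h2⟩ <;> constructor <;> linarith

theorem volume_steiner (ho : IsOpen L) (hc : Convex ℝ L) (hb : Bornology.IsBounded L) :
    volume (steiner L) = volume L := by
  rw [← shear_preimage ho hc hb 1]
  exact (measurePreserving_shear (measurable_midPoint ho hb) 1).measure_preimage
    ho.measurableSet.nullMeasurableSet

end SteinerSymmetrization

section SteinerBody

variable {k : ℕ} {L : Set (ℝ × EuclideanSpace ℝ (Fin k))} {p : ℝ}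

/-- The `L^p` norm over `L` of the linear functional with coefficient `X`. -/
def cenP (p : ℝ) (L : Set (ℝ × EuclideanSpace ℝ (Fin k))) (X : ℝ × EuclideanSpace ℝ (Fin k)) : ℝ :=
  (eLpNorm (fun Z => pairP X Z) (ENNReal.ofReal p) (volume.restrict L)).toReal

/-- The body with support function `cenP p L`. -/
def bodyP (p : ℝ) (L : Set (ℝ × EuclideanSpace ℝ (Fin k))) : Set (ℝ × EuclideanSpace ℝ (Fin k)) :=
  {Y | ∀ X, pairP X Y ≤ cenP p L X}

theorem continuous_pairP (X : ℝ × EuclideanSpace ℝ (Fin k)) : Continuous fun Z => pairP X Z := by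
  unfold pairP; fun_prop

theorem isClosed_bodyP : IsClosed (bodyP p L) := by
  have : bodyP p L = ⋂ X, {Y | pairP X Y ≤ cenP p L X} := by ext; simp [bodyP]
  rw [this]
  exact isClosed_iInter fun X => isClosed_le (continuous_pairP X) continuous_const

theorem abs_pairP_le (X Z : ℝ × EuclideanSpace ℝ (Fin k)) :
    |pairP X Z| ≤ (|X.1| + ‖X.2‖) * ‖Z‖ := by
  refine (abs_add_le _ _).trans ?_
  rw [add_mul, abs_mul]
  have h1 := norm_fst_le Z
  have h2 := norm_snd_le Z
  rw [Real.norm_eq_abs] at h1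
  gcongr
  exact (abs_real_inner_le_norm _ _).trans (by gcongr)

theorem memLp_pairP (hb : Bornology.IsBounded L) (ho : MeasurableSet L)
    (X : ℝ × EuclideanSpace ℝ (Fin k)) :
    MemLp (fun Z => pairP X Z) (ENNReal.ofReal p) (volume.restrict L) := by
  have : IsFiniteMeasure (volume.restrict L) :=
    ⟨by rw [Measure.restrict_apply_univ]; exact hb.measure_lt_top⟩
  obtain ⟨C, hC⟩ := hb.exists_norm_le
  refine MemLp.of_bound (continuous_pairP X).aestronglyMeasurable ((|X.1| + ‖X.2‖) * C)
    ((ae_restrict_iff' ho).2 (Filter.Eventually.of_forall fun Z hZ => ?_))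
  rw [Real.norm_eq_abs]
  refine (abs_pairP_le X Z).trans ?_
  have := hC Z hZ
  gcongr

theorem cenP_smul (c : ℝ) (X : ℝ × EuclideanSpace ℝ (Fin k)) :
    cenP p L (c • X) = |c| * cenP p L X := by
  have h1 : (fun Z => pairP (c • X) Z) = c • fun Z => pairP X Z := by
    ext Z
    simp only [pairP, Prod.smul_fst, Prod.smul_snd, smul_eq_mul, real_inner_smul_left,
      Pi.smul_apply]
    ring
  rw [cenP, h1, eLpNorm_const_smul, ENNReal.toReal_mul, toReal_enorm, Real.norm_eq_abs]; rfl

theorem pairP_smul (c : ℝ) (X Z : ℝ × EuclideanSpace ℝ (Fin k)) :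
    pairP (c • X) Z = c * pairP X Z := by
  simp only [pairP, Prod.smul_fst, Prod.smul_snd, smul_eq_mul, real_inner_smul_left]
  ring

theorem mem_bodyP_of (Y : ℝ × EuclideanSpace ℝ (Fin k))
    (h1 : ∀ x, Y.1 + ⟪x, Y.2⟫ ≤ cenP p L (1, x)) (h2 : ∀ x, -Y.1 + ⟪x, Y.2⟫ ≤ cenP p L (-1, x))
    (h0 : ∀ x, ⟪x, Y.2⟫ ≤ cenP p L (0, x)) : Y ∈ bodyP p L := by
  rintro ⟨s, x⟩
  rcases lt_trichotomy s 0 with hs | rfl | hs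
  · have h3 : ((s, x) : ℝ × EuclideanSpace ℝ (Fin k)) = (-s) • (-1, (-s)⁻¹ • x) := by
      rw [Prod.smul_mk, smul_smul, mul_inv_cancel₀ (by linarith), one_smul]; simp
    rw [h3, pairP_smul, cenP_smul, abs_of_pos (by linarith)]
    have := h2 ((-s)⁻¹ • x)
    refine mul_le_mul_of_nonneg_left ?_ (by linarith)
    simp only [pairP]
    linarith
  · simpa [pairP] using h0 x
  · have h3 : ((s, x) : ℝ × EuclideanSpace ℝ (Fin k)) = s • (1, s⁻¹ • x) := by
      rw [Prod.smul_mk, smul_smul, mul_inv_cancel₀ hs.ne', one_smul]; simp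
    rw [h3, pairP_smul, cenP_smul, abs_of_pos hs]
    have := h1 (s⁻¹ • x)
    refine mul_le_mul_of_nonneg_left ?_ hs.le
    simp only [pairP]
    linarith

theorem cenP_eq_of_measurePreserving {L' : Set (ℝ × EuclideanSpace ℝ (Fin k))}
    {Φ : ℝ × EuclideanSpace ℝ (Fin k) → ℝ × EuclideanSpace ℝ (Fin k)}
    (hΦ : MeasurePreserving Φ) (hL : MeasurableSet L) (h : Φ ⁻¹' L = L')
    (X : ℝ × EuclideanSpace ℝ (Fin k)) :
    eLpNorm (fun Z => pairP X Z) (ENNReal.ofReal p) (volume.restrict L) =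
      eLpNorm (fun Z => pairP X (Φ Z)) (ENNReal.ofReal p) (volume.restrict L') := by
  rw [← h]
  exact (eLpNorm_comp_measurePreserving (continuous_pairP X).aestronglyMeasurable
    (hΦ.restrict_preimage hL)).symm

theorem cenP_steiner_zero (ho : IsOpen L) (hc : Convex ℝ L) (hb : Bornology.IsBounded L)
    (x : EuclideanSpace ℝ (Fin k)) : cenP p (steiner L) (0, x) = cenP p L (0, x) := by
  rw [cenP, cenP, cenP_eq_of_measurePreserving (measurePreserving_shear
    (measurable_midPoint ho hb) 1) ho.measurableSet (shear_preimage ho hc hb 1)]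
  simp [pairP]

theorem cenP_steiner_neg_one (ho : IsOpen L) (x : EuclideanSpace ℝ (Fin k)) :
    cenP p (steiner L) (-1, x) = cenP p (steiner L) (1, x) := by
  rw [cenP, cenP, cenP_eq_of_measurePreserving (L' := steiner L) (measurePreserving_shear
    (g := fun _ => 0) measurable_const (-1)) (isOpen_steiner ho).measurableSet]
  · simp [pairP]
  · ext Z; simp [steiner]

theorem cenP_steiner_le (hp : 1 ≤ p) (ho : IsOpen L) (hc : Convex ℝ L)
    (hb : Bornology.IsBounded L) (x y : EuclideanSpace ℝ (Fin k)) :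
    2 * cenP p (steiner L) (1, (2⁻¹ : ℝ) • (x + y)) ≤ cenP p L (1, x) + cenP p L (-1, y) := by
  have hm := measurable_midPoint ho hb
  have e1 := cenP_eq_of_measurePreserving (p := p) (measurePreserving_shear hm 1)
    ho.measurableSet (shear_preimage ho hc hb 1) (1, x)
  have e2 := cenP_eq_of_measurePreserving (p := p) (measurePreserving_shear hm (-1))
    ho.measurableSet (shear_preimage ho hc hb (-1)) (-1, y)
  have hfin1 := (memLp_pairP (p := p) hb ho.measurableSet (1, x)).2.ne
  have hfin2 := (memLp_pairP (p := p) hb ho.measurableSet (-1, y)).2.ne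
  have h2 : 2 * cenP p (steiner L) (1, (2⁻¹ : ℝ) • (x + y)) =
      cenP p (steiner L) ((2 : ℝ) • (1, (2⁻¹ : ℝ) • (x + y))) := by
    rw [cenP_smul, abs_of_pos two_pos]
  rw [h2, cenP, cenP, cenP, ← ENNReal.toReal_add hfin1 hfin2]
  refine ENNReal.toReal_mono (ENNReal.add_ne_top.2 ⟨hfin1, hfin2⟩) ?_
  rw [e1, e2]
  have hmeas : ∀ (s : ℤˣ) (X : ℝ × EuclideanSpace ℝ (Fin k)), AEStronglyMeasurable
      (fun Z : ℝ × EuclideanSpace ℝ (Fin k) => pairP X (midPoint L Z.2 + (s : ℤ) * Z.1, Z.2))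
      (volume.restrict (steiner L)) := fun s X =>
    ((continuous_pairP X).measurable.comp (measurePreserving_shear hm s).measurable
      ).aestronglyMeasurable
  refine le_trans (le_of_eq ?_) (eLpNorm_add_le (hmeas 1 _) (hmeas (-1) _)
    (by rw [← ENNReal.ofReal_one]; exact ENNReal.ofReal_le_ofReal hp))
  congr 1
  ext Z
  rw [smul_add, Prod.smul_mk, smul_add, smul_smul, smul_smul]
  simp [pairP, inner_add_left]
  ring

theorem volume_bodyP_steiner_le (hp : 1 ≤ p) (ho : IsOpen L) (hc : Convex ℝ L)
    (hb : Bornology.IsBounded L) : volume (bodyP p (steiner L)) ≤ volume (bodyP p L) := by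
  rw [Measure.volume_eq_prod, Measure.prod_apply_symm isClosed_bodyP.measurableSet,
    Measure.prod_apply_symm isClosed_bodyP.measurableSet]
  refine lintegral_mono fun y => ?_
  change volume {t | (t, y) ∈ bodyP p (steiner L)} ≤ volume {t | (t, y) ∈ bodyP p L}
  rcases eq_empty_or_nonempty {t | (t, y) ∈ bodyP p (steiner L)} with h | ⟨t₀, ht₀⟩
  · rw [h]; simp
  have key : ∀ t, (t, y) ∈ bodyP p (steiner L) → ∀ x w, 2 * |t| ≤
      (cenP p L (1, x) - ⟪x, y⟫) + (cenP p L (-1, w) - ⟪w, y⟫) := by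
    intro t ht x w
    have h1 := ht (1, (2⁻¹ : ℝ) • (x + w))
    have h2 := ht (-1, (2⁻¹ : ℝ) • (x + w))
    rw [cenP_steiner_neg_one ho] at h2
    have h3 := cenP_steiner_le hp ho hc hb x w
    simp only [pairP, real_inner_smul_left, inner_add_left] at h1 h2
    have h4 : |t| ≤ cenP p (steiner L) (1, (2⁻¹ : ℝ) • (x + w)) - 2⁻¹ * (⟪x, y⟫ + ⟪w, y⟫) :=
      abs_le.2 ⟨by linarith, by linarith⟩
    linarith
  set a := ⨅ x, (cenP p L (1, x) - ⟪x, y⟫) with ha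
  set b := ⨅ x, (cenP p L (-1, x) - ⟪x, y⟫) with hb'
  have hab : ∀ t, (t, y) ∈ bodyP p (steiner L) → 2 * |t| ≤ a + b := by
    intro t ht
    have h1 : ∀ x, 2 * |t| - (cenP p L (1, x) - ⟪x, y⟫) ≤ b := fun x =>
      le_ciInf fun w => by linarith [key t ht x w]
    have h2 : 2 * |t| - b ≤ a := le_ciInf fun x => by linarith [h1 x]
    linarith
  have hbdd1 : BddBelow (range fun x => cenP p L (1, x) - ⟪x, y⟫) :=
    ⟨2 * |t₀| - (cenP p L (-1, 0) - ⟪0, y⟫), by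
      rintro _ ⟨x, rfl⟩
      dsimp only
      linarith [key t₀ ht₀ x 0]⟩
  have hbdd2 : BddBelow (range fun x => cenP p L (-1, x) - ⟪x, y⟫) :=
    ⟨2 * |t₀| - (cenP p L (1, 0) - ⟪0, y⟫), by
      rintro _ ⟨x, rfl⟩
      dsimp only
      linarith [key t₀ ht₀ 0 x]⟩
  calc volume {t | (t, y) ∈ bodyP p (steiner L)}
      ≤ volume (Icc (-((a + b) / 2)) ((a + b) / 2)) :=
        measure_mono fun t ht => abs_le.1 (by linarith [hab t ht])
    _ = volume (Icc (-b) a) := by rw [Real.volume_Icc, Real.volume_Icc]; congr 1; ring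
    _ ≤ volume {t | (t, y) ∈ bodyP p L} := by
        refine measure_mono fun t ht => mem_bodyP_of _ (fun x => ?_) (fun x => ?_) (fun x => ?_)
        · have := ciInf_le hbdd1 x
          dsimp only at this ⊢
          linarith [ht.2]
        · have := ciInf_le hbdd2 x
          dsimp only at this ⊢
          linarith [ht.1]
        · have := ht₀ (0, x)
          rw [cenP_steiner_zero ho hc hb] at this
          simpa [pairP] using this

end SteinerBody

section SteinerStep

variable {k : ℕ} {p : ℝ}

theorem volume_diff_add_le {I J S : Set ℝ} (hI : MeasurableSet I) (hJ : MeasurableSet J)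
    (hIt : volume I ≠ ∞) (hS : volume S = volume I) (h : S ⊆ J ∨ J ⊆ S)
    (v : ℝ) : volume (S \ J) + volume ((I \ J) ∩ (fun t => t - v) ⁻¹' (J \ I)) ≤
      volume (I \ J) := by
  rcases h with h | h
  · rw [sdiff_eq_bot_iff.2 h]
    simpa using measure_mono inter_subset_left
  · have h1 : volume ((I \ J) ∩ (fun t => t - v) ⁻¹' (J \ I)) ≤ volume (J \ I) :=
      (measure_mono inter_subset_right).trans_eq
        ((measurePreserving_sub_right volume v).measure_preimage
          (hJ.diff hI).nullMeasurableSet)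
    refine (add_le_add_right h1 _).trans ?_
    have h2 := measure_inter_add_sdiff (μ := volume) S hJ
    have h3 := measure_inter_add_sdiff (μ := volume) I hJ
    have h4 := measure_inter_add_sdiff (μ := volume) J hI
    rw [inter_eq_right.2 h, hS, ← h3, ← h4, inter_comm J I, add_assoc,
      ENNReal.add_right_inj (measure_ne_top_of_subset inter_subset_left hIt), add_comm] at h2
    exact h2.le

theorem volume_steiner_diff_add_le {L B : Set (ℝ × EuclideanSpace ℝ (Fin k))} (ho : IsOpen L)
    (hc : Convex ℝ L) (hb : Bornology.IsBounded L) (hB : MeasurableSet B)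
    (hBs : ∀ Z ∈ B, ∀ t, |t| ≤ |Z.1| → (t, Z.2) ∈ B) (v : ℝ) :
    volume (steiner L \ B) + volume ((L \ B) ∩ (fun Z => Z - (v, 0)) ⁻¹' (B \ L)) ≤
      volume (L \ B) := by
  have hs := (isOpen_steiner ho).measurableSet
  have hL := ho.measurableSet
  have hm : MeasurableSet ((L \ B) ∩ (fun Z => Z - (v, 0)) ⁻¹' (B \ L)) :=
    (hL.diff hB).inter ((measurable_id.sub_const _) (hB.diff hL))
  rw [Measure.volume_eq_prod, Measure.prod_apply_symm (hs.diff hB), Measure.prod_apply_symm hm,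
    Measure.prod_apply_symm (hL.diff hB), ← lintegral_add_left (measurable_measure_prodMk_right
      (hs.diff hB))]
  refine lintegral_mono fun y => ?_
  have hsec := section_eq_Ioo ho hc hb y
  have h1 : {t | (t, y) ∈ steiner L} = Ioo (-((upperEnd L y - lowerEnd L y) / 2))
      ((upperEnd L y - lowerEnd L y) / 2) := by
    ext t
    rw [mem_ofPred_eq, mem_steiner_iff ho hc hb, abs_lt]; rfl
  have h2 := volume_diff_add_le (I := {t | (t, y) ∈ L}) (J := {t | (t, y) ∈ B})
    (S := {t | (t, y) ∈ steiner L}) (measurable_prodMk_right hL) (measurable_prodMk_right hB)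
    (section_bddAbove hb y).measure_lt_top.ne
    (by rw [h1, hsec, Real.volume_Ioo, Real.volume_Ioo]; congr 1; ring) ?_ v
  · refine le_trans (le_of_eq ?_) h2
    congr 2
    ext t
    simp
  · by_contra! hcon
    obtain ⟨hc1, hc2⟩ := hcon
    obtain ⟨s, hs1, hs2⟩ := not_subset.1 hc1
    obtain ⟨t, ht1, ht2⟩ := not_subset.1 hc2
    rcases le_total |s| |t| with hst | hst
    · exact hs2 (hBs _ ht1 s hst)
    · refine ht2 ?_
      obtain ⟨a, b, ha, hb', hab⟩ := hs1
      exact ⟨a, b, ha, hb', by simp only at hab ⊢; linarith⟩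

/-- The `L^p` norm over `L` of the linear functional `⟪x, ·⟫`. -/
def cenE {m : ℕ} (p : ℝ) (L : Set (EuclideanSpace ℝ (Fin m))) (x : EuclideanSpace ℝ (Fin m)) : ℝ :=
  (eLpNorm (fun z => ⟪x, z⟫) (ENNReal.ofReal p) (volume.restrict L)).toReal

/-- The body with support function `cenE p L`. -/
def bodyE {m : ℕ} (p : ℝ) (L : Set (EuclideanSpace ℝ (Fin m))) : Set (EuclideanSpace ℝ (Fin m)) :=
  {y | ∀ x, ⟪x, y⟫ ≤ cenE p L x}

theorem exists_splitting (v : EuclideanSpace ℝ (Fin (k + 1))) :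
    ∃ T : EuclideanSpace ℝ (Fin (k + 1)) ≃L[ℝ] ℝ × EuclideanSpace ℝ (Fin k),
      MeasurePreserving T ∧ (∀ x y, ⟪x, y⟫ = pairP (T x) (T y)) ∧ (T v).2 = 0 := by
  set w : EuclideanSpace ℝ (Fin (k + 1)) := EuclideanSpace.single 0 ‖v‖ with hw
  set U := (ℝ ∙ (v - w))ᗮ.reflection with hU
  have hUv : U v = w := Submodule.reflection_sub (by simp [hw])
  refine ⟨U.toContinuousLinearEquiv.trans (splitE k),
    (measurePreserving_splitE k).comp U.measurePreserving, fun x y => ?_, ?_⟩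
  · change _ = pairP (splitE k (U x)) (splitE k (U y))
    rw [← U.inner_map_map, inner_splitE]; rfl
  · change (splitE k (U v)).2 = 0
    rw [hUv]
    ext i
    rw [splitE_snd]
    simp [hw]

theorem exists_steiner_step (hp : 1 ≤ p) {L : Set (EuclideanSpace ℝ (Fin (k + 1)))} {R ρ : ℝ}
    (ho : IsOpen L) (hc : Convex ℝ L) (hR : 0 < R) (hρ : 0 < ρ) (hLR : L ⊆ Metric.ball 0 R)
    (v : EuclideanSpace ℝ (Fin (k + 1))) :
    ∃ L' : Set (EuclideanSpace ℝ (Fin (k + 1))), IsOpen L' ∧ Convex ℝ L' ∧ L' ⊆ Metric.ball 0 R ∧ volume L' = volume L ∧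
      volume (bodyE p L') ≤ volume (bodyE p L) ∧
      volume (L' \ Metric.ball 0 ρ) + volume ((L \ Metric.ball 0 ρ) ∩
        (fun z => z - v) ⁻¹' (Metric.ball 0 ρ \ L)) ≤ volume (L \ Metric.ball 0 ρ) := by
  obtain ⟨T, hT, hpair, hv⟩ := exists_splitting v
  have hnorm : ∀ x, ‖x‖ ^ 2 = (T x).1 ^ 2 + ‖(T x).2‖ ^ 2 := fun x => by
    rw [← real_inner_self_eq_norm_sq, hpair, pairP, real_inner_self_eq_norm_sq]; ring
  have hball : ∀ r, 0 < r → ∀ x, x ∈ Metric.ball 0 r ↔ (T x).1 ^ 2 + ‖(T x).2‖ ^ 2 < r ^ 2 := by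
    intro r hr x
    rw [mem_ball_zero_iff, ← hnorm, sq_lt_sq₀ (norm_nonneg x) hr.le]
  have hvol : ∀ M : Set (ℝ × EuclideanSpace ℝ (Fin k)), volume (T ⁻¹' M) = volume M := fun M =>
    hT.measure_preimage_emb T.toHomeomorph.measurableEmbedding M
  have hcen : ∀ M x, cenE p (T ⁻¹' M) x = cenP p M (T x) := by
    intro M x
    rw [cenE, cenP, ← eLpNorm_comp_measurePreserving (continuous_pairP _).aestronglyMeasurable
      (hT.restrict_preimage_emb T.toHomeomorph.measurableEmbedding M)]
    simp only [hpair]; rfl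
  have hbody : ∀ M, bodyE p (T ⁻¹' M) = T ⁻¹' bodyP p M := by
    intro M
    ext y
    constructor
    · intro h X
      obtain ⟨x, rfl⟩ := T.surjective X
      rw [← hcen, ← hpair]; exact h x
    · intro h x
      rw [hcen, hpair]; exact h (T x)
  set M := T.symm ⁻¹' L with hM
  have hML : T ⁻¹' M = L := by ext x; simp [hM]
  have hMo : IsOpen M := ho.preimage T.symm.continuous
  have hMc : Convex ℝ M := hc.linear_preimage T.symm.toLinearEquiv.toLinearMap
  have hMR : ∀ Z ∈ M, Z.1 ^ 2 + ‖Z.2‖ ^ 2 < R ^ 2 := by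
    intro Z hZ
    have := (hball R hR (T.symm Z)).1 (hLR hZ)
    simpa using this
  have hbdd : ∀ r, 0 < r → Bornology.IsBounded
      {Z : ℝ × EuclideanSpace ℝ (Fin k) | Z.1 ^ 2 + ‖Z.2‖ ^ 2 < r ^ 2} := by
    intro r hr
    refine isBounded_iff_forall_norm_le.2 ⟨r, fun Z hZ => ?_⟩
    have hZ' : Z.1 ^ 2 + ‖Z.2‖ ^ 2 < r ^ 2 := hZ
    refine max_le ?_ ?_
    · exact abs_le_of_sq_le_sq (by nlinarith [sq_nonneg ‖Z.2‖]) hr.le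
    · exact (abs_le_of_sq_le_sq (by nlinarith [sq_nonneg Z.1]) hr.le : |‖Z.2‖| ≤ r).trans' (le_abs_self _)
  have hMb : Bornology.IsBounded M := (hbdd R hR).subset hMR
  set B := {Z : ℝ × EuclideanSpace ℝ (Fin k) | Z.1 ^ 2 + ‖Z.2‖ ^ 2 < ρ ^ 2} with hB
  have hBT : T ⁻¹' B = Metric.ball 0 ρ := by ext x; exact (hball ρ hρ x).symm
  have hBo : IsOpen B := isOpen_lt (by fun_prop) continuous_const
  refine ⟨T ⁻¹' steiner M, (isOpen_steiner hMo).preimage T.continuous,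
    (convex_steiner hMc).linear_preimage T.toLinearEquiv.toLinearMap, fun x hx => ?_, ?_, ?_, ?_⟩
  · exact (hball R hR x).2 (isBounded_steiner hMR _ hx)
  · rw [hvol, volume_steiner hMo hMc hMb, ← hvol, hML]
  · rw [hbody, hvol, ← hML, hbody, hvol]
    exact volume_bodyP_steiner_le hp hMo hMc hMb
  · have h := volume_steiner_diff_add_le hMo hMc hMb hBo.measurableSet ?_ (T v).1
    · rw [← hvol, ← hvol (_ ∩ _), ← hvol (M \ B)] at h
      simp only [preimage_sdiff, preimage_inter, hBT, hML] at h
      convert h using 3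
      rw [← preimage_comp, ← hBT, ← hML]
      ext z
      have : T (z - v) = T z - ((T v).1, 0) := by rw [map_sub, ← hv]
      simp [this]
    · intro Z hZ t ht
      have hZ' : Z.1 ^ 2 + ‖Z.2‖ ^ 2 < ρ ^ 2 := hZ
      change t ^ 2 + ‖Z.2‖ ^ 2 < ρ ^ 2
      linarith [sq_le_sq.2 ht]

end SteinerStep

section Translate

variable {m : ℕ} {A C : Set (EuclideanSpace ℝ (Fin m))}

theorem lintegral_volume_inter_preimage_sub (hA : MeasurableSet A) (hC : MeasurableSet C) :
    ∫⁻ v, volume (A ∩ (fun z => z - v) ⁻¹' C) = volume A * volume C := by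
  set S : Set (EuclideanSpace ℝ (Fin m) × EuclideanSpace ℝ (Fin m)) :=
    {V | V.2 ∈ A ∧ V.2 - V.1 ∈ C} with hS
  have hSm : MeasurableSet S :=
    (measurable_snd hA).inter ((measurable_snd.sub measurable_fst) hC)
  have h1 := Measure.prod_apply (μ := volume) (ν := volume) hSm
  rw [Measure.prod_apply_symm hSm] at h1
  refine h1.symm.trans ?_
  rw [mul_comm, ← setLIntegral_const, ← lintegral_indicator hA]
  refine lintegral_congr fun z => ?_
  by_cases hz : z ∈ A
  · rw [indicator_of_mem hz, ← (Measure.measurePreserving_sub_left volume z).measure_preimage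
      hC.nullMeasurableSet]
    congr 1; ext v; simp [hS, hz]
  · rw [indicator_of_notMem hz]
    convert measure_empty (μ := volume)
    ext v; simp [hS, hz]

theorem exists_volume_inter_preimage_sub_ge {R : ℝ} (hR : 0 < R) (hA : MeasurableSet A)
    (hC : MeasurableSet C) (hAR : A ⊆ Metric.ball 0 R) (hCR : C ⊆ Metric.ball 0 R) :
    ∃ v, volume A * volume C / volume (Metric.ball (0 : EuclideanSpace ℝ (Fin m)) (2 * R)) ≤
      volume (A ∩ (fun z => z - v) ⁻¹' C) := by
  have hintg : ∫⁻ v in Metric.ball 0 (2 * R), volume (A ∩ (fun z => z - v) ⁻¹' C) =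
      volume A * volume C := by
    rw [← lintegral_volume_inter_preimage_sub hA hC]
    refine setLIntegral_eq_of_support_subset fun v hv => ?_
    obtain ⟨z, hz1, hz2⟩ := nonempty_of_measure_ne_zero hv
    have h1 := mem_ball_zero_iff.1 (hAR hz1)
    have h2 := mem_ball_zero_iff.1 (hCR hz2)
    rw [mem_ball_zero_iff]
    have := norm_sub_le z (z - v)
    rw [sub_sub_cancel] at this
    linarith
  have hfin : volume A * volume C ≠ ∞ := ENNReal.mul_ne_top
    (measure_ne_top_of_subset hAR measure_ball_lt_top.ne)
    (measure_ne_top_of_subset hCR measure_ball_lt_top.ne)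
  obtain ⟨v, -, hv⟩ := exists_setLAverage_le (μ := volume)
    (f := fun v => volume (A ∩ (fun z => z - v) ⁻¹' C))
    (Metric.measure_ball_pos volume (0 : EuclideanSpace ℝ (Fin m)) (by linarith : 0 < 2 * R)).ne'
    Metric.isOpen_ball.measurableSet.nullMeasurableSet (hintg ▸ hfin)
  exact ⟨v, by rwa [setLAverage_eq, hintg] at hv⟩

theorem volume_diff_eq_of_volume_eq (hA : MeasurableSet A) (hC : MeasurableSet C)
    (h : volume A = volume C) (hfin : volume A ≠ ∞) : volume (A \ C) = volume (C \ A) := by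
  have h2 := measure_inter_add_sdiff (μ := volume) A hC
  have h3 := measure_inter_add_sdiff (μ := volume) C hA
  rw [h, ← h3, inter_comm C A,
    ENNReal.add_right_inj (measure_ne_top_of_subset inter_subset_left hfin)] at h2
  exact h2

end Translate

section NearBall

variable {k : ℕ} {p : ℝ}

/-- Iterated Steiner symmetrization brings an open convex set close to the ball of equal volume,
without increasing the volume of its centroid body. -/
theorem exists_near_ball (hp : 1 ≤ p) {L : Set (EuclideanSpace ℝ (Fin (k + 1)))} {R ρ ε : ℝ}
    (ho : IsOpen L) (hc : Convex ℝ L) (hρ : 0 < ρ) (hρR : ρ ≤ R)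
    (hLR : L ⊆ Metric.ball 0 R)
    (hvol : volume L = volume (Metric.ball (0 : EuclideanSpace ℝ (Fin (k + 1))) ρ)) (hε : 0 < ε) :
    ∃ L' : Set (EuclideanSpace ℝ (Fin (k + 1))), IsOpen L' ∧ L' ⊆ Metric.ball 0 R ∧
      volume (bodyE p L') ≤ volume (bodyE p L) ∧
      (volume (Metric.ball 0 ρ \ L')).toReal ≤ ε := by
  have hR : 0 < R := hρ.trans_le hρR
  set B := Metric.ball (0 : EuclideanSpace ℝ (Fin (k + 1))) ρ with hB
  have hBm : MeasurableSet B := Metric.isOpen_ball.measurableSet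
  have hBR : B ⊆ Metric.ball 0 R := Metric.ball_subset_ball hρR
  set 𝒞 : Set (Set (EuclideanSpace ℝ (Fin (k + 1)))) := {L' | IsOpen L' ∧ Convex ℝ L' ∧
    L' ⊆ Metric.ball 0 R ∧ volume L' = volume B ∧ volume (bodyE p L') ≤ volume (bodyE p L)} with h𝒞
  by_contra! hcon
  have hfin : ∀ L' ∈ 𝒞, volume L' ≠ ∞ := fun L' h => by
    rw [h.2.2.2.1]; exact measure_ball_lt_top.ne
  have hsymm : ∀ L' ∈ 𝒞, volume (B \ L') = volume (L' \ B) := fun L' h =>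
    (volume_diff_eq_of_volume_eq h.1.measurableSet hBm h.2.2.2.1 (hfin L' h)).symm
  have hlow : ∀ L' ∈ 𝒞, ε < (volume (L' \ B)).toReal := fun L' h => by
    rw [← hsymm L' h]; exact hcon L' h.1 h.2.2.1 h.2.2.2.2
  set W := volume (Metric.ball (0 : EuclideanSpace ℝ (Fin (k + 1))) (2 * R)) with hW
  have hWt : W ≠ ∞ := measure_ball_lt_top.ne
  have hWp : 0 < W.toReal := ENNReal.toReal_pos
    (Metric.measure_ball_pos volume _ (by linarith)).ne' hWt
  set S := (fun L' => (volume (L' \ B)).toReal) '' 𝒞 with hS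
  have hSb : BddBelow S := ⟨ε, by rintro _ ⟨L', h, rfl⟩; exact (hlow L' h).le⟩
  have hSn : S.Nonempty := ⟨_, L, ⟨ho, hc, hLR, hvol, le_rfl⟩, rfl⟩
  obtain ⟨_, ⟨M, hM, rfl⟩, hMd⟩ := exists_lt_of_csInf_lt hSn
    (show sInf S < sInf S + ε ^ 2 / W.toReal by linarith [div_pos (pow_pos hε 2) hWp])
  have hMfin := hfin M hM
  obtain ⟨hMo, hMc, hMR, hMv, hMb⟩ := id hM
  obtain ⟨v, hv⟩ := exists_volume_inter_preimage_sub_ge hR (hMo.measurableSet.diff hBm)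
    (hBm.diff hMo.measurableSet) (sdiff_subset.trans hMR) (sdiff_subset.trans hBR)
  obtain ⟨L', h1, h2, h3, h4, h5, h6⟩ := exists_steiner_step hp hMo hMc hR hρ hMR v
  have hL' : L' ∈ 𝒞 := ⟨h1, h2, h3, h4.trans hMv, h5.trans hMb⟩
  have h7 : sInf S ≤ (volume (L' \ B)).toReal := csInf_le hSb ⟨L', hL', rfl⟩
  have hMd' : volume (M \ B) ≠ ∞ := measure_ne_top_of_subset sdiff_subset hMfin
  have hL'd : volume (L' \ B) ≠ ∞ := measure_ne_top_of_subset sdiff_subset (hfin L' hL')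
  have h8 := (add_le_add_right hv (volume (L' \ B))).trans h6
  rw [hsymm M hM] at h8
  have h9 := ENNReal.toReal_mono hMd' h8
  rw [ENNReal.toReal_add hL'd (ENNReal.div_ne_top (ENNReal.mul_ne_top hMd' hMd')
    (Metric.measure_ball_pos volume _ (by linarith)).ne'), ENNReal.toReal_div,
    ENNReal.toReal_mul] at h9
  have h10 : ε ^ 2 / W.toReal ≤
      (volume (M \ B)).toReal * (volume (M \ B)).toReal / W.toReal := by
    have := hlow M hM
    gcongr
    nlinarith
  simp only at hMd
  linarith

theorem cenE_eq {m : ℕ} (hp : 1 ≤ p) {L : Set (EuclideanSpace ℝ (Fin m))}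
    (hb : Bornology.IsBounded L) (hL : MeasurableSet L) (x : EuclideanSpace ℝ (Fin m)) :
    cenE p L x = (∫ z in L, |⟪x, z⟫| ^ p) ^ p⁻¹ ∧ IntegrableOn (fun z => |⟪x, z⟫| ^ p) L := by
  have : IsFiniteMeasure (volume.restrict L) :=
    ⟨by rw [Measure.restrict_apply_univ]; exact hb.measure_lt_top⟩
  have hp0 : 0 < p := by linarith
  have hp1 : ENNReal.ofReal p ≠ 0 := by simpa using hp0
  have hpt : (ENNReal.ofReal p).toReal = p := ENNReal.toReal_ofReal hp0.le
  obtain ⟨C, hC⟩ := hb.exists_norm_le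
  have hm : MemLp (fun z => ⟪x, z⟫) (ENNReal.ofReal p) (volume.restrict L) := by
    refine MemLp.of_bound (by fun_prop) (‖x‖ * C) ?_
    refine ae_restrict_of_forall_mem hL fun z hz => ?_
    exact (abs_real_inner_le_norm x z).trans (by gcongr; exact hC z hz)
  constructor
  · rw [cenE, hm.eLpNorm_eq_integral_rpow_norm hp1 ENNReal.ofReal_ne_top, hpt,
      ENNReal.toReal_ofReal (by positivity)]
    rfl
  · have := hm.integrable_norm_rpow hp1 ENNReal.ofReal_ne_top
    rwa [hpt] at this

/-- Among open convex sets of given volume, the ball minimizes the volume of the centroid body. -/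
theorem volume_closedBall_le_bodyE (hp : 1 ≤ p) {L : Set (EuclideanSpace ℝ (Fin (k + 1)))}
    {ρ κ : ℝ} (ho : IsOpen L) (hc : Convex ℝ L) (hb : Bornology.IsBounded L) (hρ : 0 < ρ)
    (hvol : volume L = volume (Metric.ball (0 : EuclideanSpace ℝ (Fin (k + 1))) ρ)) (hκ : 0 < κ)
    (hball : ∀ x, ∫ z in Metric.ball (0 : EuclideanSpace ℝ (Fin (k + 1))) ρ, |⟪x, z⟫| ^ p =
      κ * ‖x‖ ^ p) :
    volume (Metric.closedBall (0 : EuclideanSpace ℝ (Fin (k + 1))) (κ ^ p⁻¹)) ≤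
      volume (bodyE p L) := by
  have hp0 : 0 < p := by linarith
  obtain ⟨R₀, hR₀⟩ := hb.subset_ball 0
  set R := max R₀ ρ with hRdef
  have hR : 0 < R := hρ.trans_le (le_max_right _ _)
  have hlt : ∀ c ∈ Ioo 0 (κ ^ p⁻¹),
      volume (Metric.closedBall (0 : EuclideanSpace ℝ (Fin (k + 1))) c) ≤ volume (bodyE p L) := by
    rintro c ⟨hc0, hcκ⟩
    have hcp : c ^ p < κ := by
      have := Real.rpow_lt_rpow hc0.le hcκ hp0
      rwa [← Real.rpow_mul hκ.le, inv_mul_cancel₀ hp0.ne', Real.rpow_one] at this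
    have hRp : 0 < R ^ p := Real.rpow_pos_of_pos hR p
    obtain ⟨L', h1, h2, h3, h4⟩ := exists_near_ball hp (ε := (κ - c ^ p) / R ^ p) ho hc hρ
      (le_max_right R₀ ρ) (hR₀.trans (Metric.ball_subset_ball (le_max_left _ _))) hvol
      (div_pos (by linarith) hRp)
    refine (measure_mono fun y hy x => ?_).trans h3
    have hL'b : Bornology.IsBounded L' := Metric.isBounded_ball.subset h2
    obtain ⟨hcen, hintg⟩ := cenE_eq hp hL'b h1.measurableSet x
    set B := Metric.ball (0 : EuclideanSpace ℝ (Fin (k + 1))) ρ with hB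
    have hintB := (cenE_eq hp (Metric.isBounded_ball : Bornology.IsBounded B)
      Metric.isOpen_ball.measurableSet x).2
    rw [hcen]
    have hy' : ‖y‖ ≤ c := by simpa using hy
    have h5 : ∫ z in B ∩ L', |⟪x, z⟫| ^ p ≤ ∫ z in L', |⟪x, z⟫| ^ p :=
      setIntegral_mono_set hintg (Filter.Eventually.of_forall fun z => by positivity)
        inter_subset_right.eventuallyLE
    have h6 := integral_inter_add_sdiff (μ := volume) h1.measurableSet hintB
    have hfin : volume (B \ L') ≠ ∞ :=
      measure_ne_top_of_subset sdiff_subset measure_ball_lt_top.ne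
    have h7 : ∫ z in B \ L', |⟪x, z⟫| ^ p ≤ (κ - c ^ p) * ‖x‖ ^ p := by
      have h8 : ∫ z in B \ L', |⟪x, z⟫| ^ p ≤ ∫ z in B \ L', (‖x‖ * R) ^ p := by
        refine setIntegral_mono_on (hintB.mono_set sdiff_subset) (integrableOn_const hfin)
          (Metric.isOpen_ball.measurableSet.diff h1.measurableSet) fun z hz => ?_
        have hz' : ‖z‖ ≤ R := (mem_ball_zero_iff.1 hz.1).le.trans (le_max_right _ _)
        gcongr
        exact (abs_real_inner_le_norm x z).trans (by gcongr)
      refine h8.trans ?_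
      rw [setIntegral_const, smul_eq_mul, Real.mul_rpow (norm_nonneg x) hR.le]
      calc volume.real (B \ L') * (‖x‖ ^ p * R ^ p)
          ≤ (κ - c ^ p) / R ^ p * (‖x‖ ^ p * R ^ p) := by
            gcongr; exact h4
        _ = (κ - c ^ p) * ‖x‖ ^ p := by field_simp
    rw [hball] at h6
    calc ⟪x, y⟫ ≤ ‖x‖ * ‖y‖ := real_inner_le_norm x y
      _ ≤ c * ‖x‖ := by rw [mul_comm]; gcongr
      _ = ((c * ‖x‖) ^ p) ^ p⁻¹ := by
        rw [← Real.rpow_mul (by positivity), mul_inv_cancel₀ hp0.ne', Real.rpow_one]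
      _ ≤ _ := by
        gcongr
        rw [Real.mul_rpow hc0.le (norm_nonneg x)]
        linarith
  have hpos : 0 < κ ^ p⁻¹ := Real.rpow_pos_of_pos hκ _
  have hcont : Continuous fun c : ℝ => ENNReal.ofReal (c ^ (k + 1)) *
      volume (Metric.ball (0 : EuclideanSpace ℝ (Fin (k + 1))) 1) :=
    (ENNReal.continuous_mul_const measure_ball_lt_top.ne).comp
      (ENNReal.continuous_ofReal.comp (continuous_pow _))
  rw [Measure.addHaar_closedBall _ _ hpos.le, finrank_euclideanSpace_fin]
  refine le_of_tendsto (x := nhdsWithin (κ ^ p⁻¹) (Iio (κ ^ p⁻¹)))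
    (hcont.continuousAt.tendsto.mono_left nhdsWithin_le_nhds) ?_
  filter_upwards [Ioo_mem_nhdsLT hpos] with c hc
  have := hlt c hc
  rwa [Measure.addHaar_closedBall _ _ hc.1.le, finrank_euclideanSpace_fin] at this

end NearBall

section PolarCoordinates

variable {k : ℕ}

instance (m : ℕ) : IsFiniteMeasure (sphMeasure m) := by unfold sphMeasure; infer_instance

theorem lintegral_polar {F : EuclideanSpace ℝ (Fin (k + 1)) → ℝ≥0∞} (hF : Measurable F) :
    ∫⁻ z, F z = ∫⁻ ξ, (∫⁻ r in Ioi (0 : ℝ), ENNReal.ofReal (r ^ k) *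
      F (r • (ξ : EuclideanSpace ℝ (Fin (k + 1))))) ∂(sphMeasure (k + 1)) := by
  have hmp := (volume : Measure (EuclideanSpace ℝ (Fin (k + 1)))).measurePreserving_homeomorphUnitSphereProd
  rw [finrank_euclideanSpace_fin, Nat.add_sub_cancel] at hmp
  have hF' : Measurable fun V : Metric.sphere (0 : EuclideanSpace ℝ (Fin (k + 1))) 1 × Ioi (0 : ℝ) => F (V.2.1 • V.1.1) := by
    have hc : Continuous fun V : Metric.sphere (0 : EuclideanSpace ℝ (Fin (k + 1))) 1 × Ioi (0 : ℝ) => V.2.1 • V.1.1 := by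
      fun_prop
    exact hF.comp hc.measurable
  have h1 : ∫⁻ z, F z = ∫⁻ z : ({0}ᶜ : Set (EuclideanSpace ℝ (Fin (k + 1)))), F z ∂(volume.comap Subtype.val) := by
    rw [lintegral_subtype_comap (measurableSet_singleton _).compl,
      restrict_compl_singleton]
  have h2 : ∀ z : ({0}ᶜ : Set (EuclideanSpace ℝ (Fin (k + 1)))), F z = (fun V : Metric.sphere (0 : EuclideanSpace ℝ (Fin (k + 1))) 1 × Ioi (0 : ℝ) =>
      F (V.2.1 • V.1.1)) (homeomorphUnitSphereProd _ z) := by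
    intro z
    have := congrArg Subtype.val ((homeomorphUnitSphereProd _).symm_apply_apply z)
    rw [homeomorphUnitSphereProd_symm_apply_coe] at this
    simp only [this]
  rw [h1, lintegral_congr h2, hmp.lintegral_comp hF', lintegral_prod _ hF'.aemeasurable]
  refine lintegral_congr fun ξ => ?_
  refine (lintegral_withDensity_eq_lintegral_mul _ (by fun_prop)
    (hF'.comp measurable_prodMk_left)).trans ?_
  exact lintegral_subtype_comap measurableSet_Ioi
    (fun r : ℝ => ENNReal.ofReal (r ^ k) * F (r • (ξ : EuclideanSpace ℝ (Fin (k + 1)))))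

theorem setLIntegral_Ioo_rpow {a c : ℝ} (ha : 0 ≤ a) (hc : 0 ≤ c) :
    ∫⁻ r in Ioo 0 c, ENNReal.ofReal (r ^ a) = ENNReal.ofReal (c ^ (a + 1) / (a + 1)) := by
  rw [← setLIntegral_congr Ioo_ae_eq_Ioc.symm, ← ofReal_integral_eq_lintegral_ofReal]
  · rw [← intervalIntegral.integral_of_le hc, integral_rpow (Or.inl (by linarith)),
      Real.zero_rpow (by linarith), sub_zero]
  · exact (intervalIntegrable_iff_integrableOn_Ioc_of_le hc).1
      (intervalIntegral.intervalIntegrable_rpow' (by linarith))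
  · exact (ae_restrict_iff' measurableSet_Ioc).2 (Filter.Eventually.of_forall fun t ht =>
      Real.rpow_nonneg ht.1.le a)

theorem lintegral_sublevel_polar {N φ : EuclideanSpace ℝ (Fin (k + 1)) → ℝ} {s : ℝ} (hs : 0 ≤ s)
    (hNc : Continuous N) (hN : ∀ r z, 0 < r → N (r • z) = r * N z) (hN0 : ∀ z, z ≠ 0 → 0 < N z)
    (hφm : Measurable φ) (hφ0 : ∀ z, 0 ≤ φ z) (hφ : ∀ r z, 0 < r → φ (r • z) = r ^ s * φ z) :
    ∫⁻ z in {z | N z < 1}, ENNReal.ofReal (φ z) =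
      ∫⁻ ξ, ENNReal.ofReal (φ (ξ : EuclideanSpace ℝ (Fin (k + 1))) * N ξ ^ (-(k + 1 + s))
        / (k + 1 + s)) ∂(sphMeasure (k + 1)) := by
  have hNo : IsOpen {z | N z < 1} := isOpen_lt hNc continuous_const
  rw [← lintegral_indicator hNo.measurableSet,
    lintegral_polar (hφm.ennreal_ofReal.indicator hNo.measurableSet)]
  refine lintegral_congr fun ξ => ?_
  have hξ : 0 < N ξ := hN0 _ (ne_zero_of_mem_unit_sphere ξ)
  calc _ = ∫⁻ r in Ioi (0 : ℝ), (Ioo 0 (N ξ)⁻¹).indicator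
        (fun r => ENNReal.ofReal (φ ξ) * ENNReal.ofReal (r ^ (k + s))) r := by
        refine setLIntegral_congr_fun measurableSet_Ioi fun r (hr : 0 < r) => ?_
        have hiff : r • (ξ : EuclideanSpace ℝ (Fin (k + 1))) ∈ {z | N z < 1} ↔
            r ∈ Ioo 0 (N ξ)⁻¹ := by
          simp only [mem_ofPred_eq, hN r _ hr, mem_Ioo, hr, true_and]
          rw [lt_inv_comm₀ hr hξ, ← one_div, lt_div_iff₀ hr, mul_comm]
        simp only [indicator_apply, hiff]
        split_ifs
        · rw [hφ r _ hr, ← ENNReal.ofReal_mul (by positivity), ← ENNReal.ofReal_mul (hφ0 _),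
            Real.rpow_add hr, Real.rpow_natCast]
          congr 1; ring
        · simp
    _ = ENNReal.ofReal (φ ξ) * ∫⁻ r in Ioo 0 (N ξ)⁻¹, ENNReal.ofReal (r ^ (k + s)) := by
        rw [lintegral_indicator measurableSet_Ioo, Measure.restrict_restrict measurableSet_Ioo,
          inter_eq_left.2 Ioo_subset_Ioi_self, lintegral_const_mul _ (by fun_prop)]
    _ = _ := by
        rw [setLIntegral_Ioo_rpow (by positivity) (by positivity), ← ENNReal.ofReal_mul (hφ0 _),
          Real.inv_rpow hξ.le, ← Real.rpow_neg hξ.le]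
        congr 1
        rw [show (k : ℝ) + s + 1 = k + 1 + s by ring]; ring

theorem lintegral_mul_exp_neg_norm_sq_polar {φ : EuclideanSpace ℝ (Fin (k + 1)) → ℝ} {s : ℝ}
    (hs : 0 ≤ s) (hφm : Measurable φ) (hφ0 : ∀ z, 0 ≤ φ z)
    (hφ : ∀ r z, 0 < r → φ (r • z) = r ^ s * φ z) :
    ∫⁻ z, ENNReal.ofReal (φ z * Real.exp (-‖z‖ ^ 2)) =
      (∫⁻ ξ, ENNReal.ofReal (φ (ξ : EuclideanSpace ℝ (Fin (k + 1)))) ∂(sphMeasure (k + 1))) *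
        ENNReal.ofReal (1 / 2 * Real.Gamma ((k + s + 1) / 2)) := by
  rw [lintegral_polar (by fun_prop), ← lintegral_mul_const _ (by fun_prop)]
  refine lintegral_congr fun ξ => ?_
  rw [← integral_rpow_mul_exp_neg_rpow two_pos (by linarith [k.cast_nonneg (α := ℝ)]),
    ofReal_integral_eq_lintegral_ofReal
      (integrableOn_rpow_mul_exp_neg_rpow (by linarith [k.cast_nonneg (α := ℝ)]) two_pos)
      ((ae_restrict_iff' measurableSet_Ioi).2 (Filter.Eventually.of_forall fun t (ht : 0 < t) => by
        positivity)), ← lintegral_const_mul _ (by fun_prop)]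
  refine setLIntegral_congr_fun measurableSet_Ioi fun r (hr : 0 < r) => ?_
  rw [hφ r _ hr, norm_smul, norm_eq_of_mem_sphere ξ, mul_one, Real.norm_eq_abs, sq_abs,
    ← ENNReal.ofReal_mul (by positivity), ← ENNReal.ofReal_mul (hφ0 _), Real.rpow_add hr,
    Real.rpow_natCast, Real.rpow_two]
  congr 1; ring

theorem lintegral_abs_rpow_mul_exp_neg_sq {p : ℝ} (hp : 0 ≤ p) :
    ∫⁻ t : ℝ, ENNReal.ofReal (|t| ^ p * Real.exp (-t ^ 2)) =
      ENNReal.ofReal (Real.Gamma ((p + 1) / 2)) := by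
  have h := integral_comp_abs (f := fun t => t ^ p * Real.exp (-t ^ (2 : ℝ)))
  rw [integral_rpow_mul_exp_neg_rpow two_pos (by linarith)] at h
  simp only [Real.rpow_two, sq_abs] at h
  have hpos := Real.Gamma_pos_of_pos (show 0 < (p + 1) / 2 by linarith)
  rw [← ofReal_integral_eq_lintegral_ofReal]
  · rw [h]; congr 1; ring
  · by_contra hc
    rw [integral_undef hc] at h
    linarith
  · exact Filter.Eventually.of_forall fun t => by positivity

theorem lintegral_exp_neg_norm_sq {m : ℕ} :
    ∫⁻ y : EuclideanSpace ℝ (Fin m), ENNReal.ofReal (Real.exp (-‖y‖ ^ 2)) =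
      ENNReal.ofReal (π ^ ((m : ℝ) / 2)) := by
  have h := GaussianFourier.integral_rexp_neg_mul_sq_norm (V := EuclideanSpace ℝ (Fin m)) one_pos
  simp only [neg_mul, one_mul, div_one, finrank_euclideanSpace_fin] at h
  have hpos : 0 < π ^ ((m : ℝ) / 2) := by positivity
  rw [← ofReal_integral_eq_lintegral_ofReal]
  · rw [h]
  · by_contra hc
    rw [integral_undef hc] at h
    exact hpos.ne h
  · exact Filter.Eventually.of_forall fun t => by positivity

theorem lintegral_abs_inner_rpow_mul_exp_neg_norm_sq {p : ℝ} (hp : 0 < p)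
    (x : EuclideanSpace ℝ (Fin (k + 1))) :
    ∫⁻ z, ENNReal.ofReal (|⟪x, z⟫| ^ p * Real.exp (-‖z‖ ^ 2)) =
      ENNReal.ofReal (‖x‖ ^ p * (Real.Gamma ((p + 1) / 2) * π ^ ((k : ℝ) / 2))) := by
  obtain ⟨T, hT, hpair, hv⟩ := exists_splitting x
  have hnorm : ∀ z, ‖z‖ ^ 2 = (T z).1 ^ 2 + ‖(T z).2‖ ^ 2 := fun z => by
    rw [← real_inner_self_eq_norm_sq, hpair, pairP, real_inner_self_eq_norm_sq]; ring
  have hx : |(T x).1| = ‖x‖ := by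
    have := hnorm x
    rw [hv, norm_zero] at this
    rw [← abs_norm x]
    exact (sq_eq_sq_iff_abs_eq_abs _ _).1 (by linarith)
  have hΓ := Real.Gamma_pos_of_pos (show 0 < (p + 1) / 2 by linarith)
  set F : ℝ × EuclideanSpace ℝ (Fin k) → ℝ≥0∞ := fun Z => ENNReal.ofReal (‖x‖ ^ p *
    (|Z.1| ^ p * Real.exp (-Z.1 ^ 2))) * ENNReal.ofReal (Real.exp (-‖Z.2‖ ^ 2)) with hF
  calc _ = ∫⁻ z, F (T z) := by
        refine lintegral_congr fun z => ?_
        simp only [hF]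
        rw [hpair, pairP, hv, inner_zero_left, add_zero, hnorm, abs_mul, hx,
          ← ENNReal.ofReal_mul (by positivity), Real.mul_rpow (norm_nonneg x) (abs_nonneg _),
          neg_add, Real.exp_add]
        congr 1; ring
    _ = _ := by
        rw [hT.lintegral_comp (by fun_prop), hF, Measure.volume_eq_prod, lintegral_prod_mul
          (f := fun t : ℝ => ENNReal.ofReal (‖x‖ ^ p * (|t| ^ p * Real.exp (-t ^ 2))))
          (g := fun y : EuclideanSpace ℝ (Fin k) => ENNReal.ofReal (Real.exp (-‖y‖ ^ 2)))
          (by fun_prop) (by fun_prop), lintegral_exp_neg_norm_sq]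
        simp_rw [ENNReal.ofReal_mul (show 0 ≤ ‖x‖ ^ p by positivity)]
        rw [lintegral_const_mul _ (by fun_prop), lintegral_abs_rpow_mul_exp_neg_sq hp.le,
          ENNReal.ofReal_mul hΓ.le, mul_assoc]

/-- The `p`-th moment `2 ω_{m+p-2} / ω_{p-1}` of a coordinate over the unit sphere of `ℝ^m`. -/
def sphMoment (m : ℕ) (p : ℝ) : ℝ := 2 * w (m + p - 2) / w (p - 1)

theorem w_pos {s : ℝ} (hs : -2 < s) : 0 < w s :=
  div_pos (by positivity) (Real.Gamma_pos_of_pos (by linarith))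

theorem sphMoment_eq {p : ℝ} (hp : 0 < p) : sphMoment (k + 1) p =
    2 * π ^ ((k : ℝ) / 2) * Real.Gamma ((p + 1) / 2) / Real.Gamma ((k + p + 1) / 2) := by
  have h1 := Real.Gamma_pos_of_pos (show 0 < (p + 1) / 2 by linarith)
  have h2 := Real.Gamma_pos_of_pos (show 0 < (k + p + 1) / 2 by positivity)
  rw [sphMoment, w, w]
  push_cast
  rw [show ((k : ℝ) + 1 + p - 2) / 2 = k / 2 + (p - 1) / 2 by ring, Real.rpow_add pi_pos,
    show (k : ℝ) / 2 + (p - 1) / 2 + 1 = (k + p + 1) / 2 by ring,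
    show (p - 1) / 2 + 1 = (p + 1) / 2 by ring]
  have : 0 < π ^ ((p - 1) / 2) := by positivity
  field_simp

theorem lintegral_sphere_abs_inner_rpow {p : ℝ} (hp : 0 < p)
    (x : EuclideanSpace ℝ (Fin (k + 1))) :
    ∫⁻ ξ, ENNReal.ofReal (|⟪x, (ξ : EuclideanSpace ℝ (Fin (k + 1)))⟫| ^ p)
      ∂(sphMeasure (k + 1)) = ENNReal.ofReal (sphMoment (k + 1) p * ‖x‖ ^ p) := by
  have h := lintegral_mul_exp_neg_norm_sq_polar (k := k) (φ := fun z => |⟪x, z⟫| ^ p) hp.le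
    (by fun_prop) (fun z => by positivity) fun r z hr => by
      rw [real_inner_smul_right, abs_mul, abs_of_pos hr, Real.mul_rpow hr.le (abs_nonneg _)]
  rw [lintegral_abs_inner_rpow_mul_exp_neg_norm_sq hp] at h
  have hΓ := Real.Gamma_pos_of_pos (show 0 < (k + p + 1) / 2 by positivity)
  have hΓ' : 0 < 1 / 2 * Real.Gamma ((k + p + 1) / 2) := by positivity
  refine (ENNReal.mul_left_inj (ENNReal.ofReal_pos.2 hΓ').ne' ENNReal.ofReal_ne_top).1 ?_
  rw [← h, ← ENNReal.ofReal_mul' hΓ'.le, sphMoment_eq hp]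
  congr 1
  field_simp

theorem sphMeasure_real_univ : (sphMeasure (k + 1)).real univ = (k + 1 : ℕ) * w (k + 1 : ℕ) := by
  rw [sphMeasure, Measure.toSphere_real_apply_univ, finrank_euclideanSpace_fin, measureReal_def,
    EuclideanSpace.volume_ball, w]
  simp only [ENNReal.ofReal_one, one_pow, one_mul, Fintype.card_fin]
  rw [ENNReal.toReal_ofReal (by positivity), Real.sqrt_eq_rpow, ← Real.rpow_mul_natCast pi_pos.le]
  congr 3
  ring

end PolarCoordinates

section DirNorm

variable {Ω : Type*} [MeasurableSpace Ω] {m : ℕ} {p : ℝ} {μ : Measure Ω}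
  {G : Ω → EuclideanSpace ℝ (Fin m)}

/-- The `L^p` norm of the component of the vector field `G` in the direction `ξ`. -/
def dirNorm (p : ℝ) (μ : Measure Ω) (G : Ω → EuclideanSpace ℝ (Fin m))
    (ξ : EuclideanSpace ℝ (Fin m)) : ℝ :=
  (eLpNorm (fun z => ⟪ξ, G z⟫) (ENNReal.ofReal p) μ).toReal

theorem dirNorm_nonneg (ξ : EuclideanSpace ℝ (Fin m)) : 0 ≤ dirNorm p μ G ξ := ENNReal.toReal_nonneg

theorem dirNorm_smul (c : ℝ) (ξ : EuclideanSpace ℝ (Fin m)) :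
    dirNorm p μ G (c • ξ) = |c| * dirNorm p μ G ξ := by
  have h1 : (fun z => ⟪c • ξ, G z⟫) = c • fun z => ⟪ξ, G z⟫ := by
    ext z
    simp [real_inner_smul_left]
  rw [dirNorm, h1, eLpNorm_const_smul, ENNReal.toReal_mul, dirNorm]
  simp

theorem dirNorm_smul_of_pos (c : ℝ) (ξ : EuclideanSpace ℝ (Fin m)) (hc : 0 < c) :
    dirNorm p μ G (c • ξ) = c * dirNorm p μ G ξ := by
  rw [dirNorm_smul, abs_of_pos hc]

theorem dirNorm_neg (ξ : EuclideanSpace ℝ (Fin m)) : dirNorm p μ G (-ξ) = dirNorm p μ G ξ := by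
  have := dirNorm_smul (p := p) (μ := μ) (G := G) (-1) ξ
  simpa using this

theorem dirNorm_add_le (hp : 1 ≤ p) (hG : MemLp G (ENNReal.ofReal p) μ)
    (ξ η : EuclideanSpace ℝ (Fin m)) :
    dirNorm p μ G (ξ + η) ≤ dirNorm p μ G ξ + dirNorm p μ G η := by
  have h1 := hG.const_inner (𝕜 := ℝ) ξ
  have h2 := hG.const_inner (𝕜 := ℝ) η
  rw [dirNorm, dirNorm, dirNorm, ← ENNReal.toReal_add h1.eLpNorm_ne_top h2.eLpNorm_ne_top]
  refine ENNReal.toReal_mono (ENNReal.add_ne_top.2 ⟨h1.eLpNorm_ne_top, h2.eLpNorm_ne_top⟩) ?_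
  simp only [inner_add_left]
  exact eLpNorm_add_le h1.1 h2.1 (by simpa using hp)

theorem convexOn_dirNorm (hp : 1 ≤ p) (hG : MemLp G (ENNReal.ofReal p) μ) :
    ConvexOn ℝ univ (dirNorm p μ G) := by
  refine ⟨convex_univ, fun x _ y _ a b ha hb _ => ?_⟩
  refine (dirNorm_add_le hp hG _ _).trans_eq ?_
  rw [dirNorm_smul, dirNorm_smul, abs_of_nonneg ha, abs_of_nonneg hb, smul_eq_mul, smul_eq_mul]

theorem continuous_dirNorm (hp : 1 ≤ p) (hG : MemLp G (ENNReal.ofReal p) μ) :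
    Continuous (dirNorm p μ G) := by
  rw [← continuousOn_univ]
  exact (convexOn_dirNorm hp hG).continuousOn isOpen_univ

theorem dirNorm_eq (hp : 1 ≤ p) (hG : MemLp G (ENNReal.ofReal p) μ)
    (ξ : EuclideanSpace ℝ (Fin m)) :
    dirNorm p μ G ξ = (∫ z, |⟪ξ, G z⟫| ^ p ∂μ) ^ p⁻¹ := by
  have hp0 : 0 < p := by linarith
  rw [dirNorm, (hG.const_inner (𝕜 := ℝ) ξ).eLpNorm_eq_integral_rpow_norm (by simpa using hp0)
    ENNReal.ofReal_ne_top, ENNReal.toReal_ofReal hp0.le, ENNReal.toReal_ofReal (by positivity)]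
  rfl

theorem ofReal_dirNorm_rpow (hp : 1 ≤ p) (hG : MemLp G (ENNReal.ofReal p) μ)
    (ξ : EuclideanSpace ℝ (Fin m)) :
    ENNReal.ofReal (dirNorm p μ G ξ ^ p) = ∫⁻ z, ENNReal.ofReal (|⟪ξ, G z⟫| ^ p) ∂μ := by
  have hp0 : 0 < p := by linarith
  have h : Integrable (fun z => |⟪ξ, G z⟫| ^ p) μ := by
    have := (hG.const_inner (𝕜 := ℝ) ξ).integrable_norm_rpow (by simpa using hp0)
      ENNReal.ofReal_ne_top
    rwa [ENNReal.toReal_ofReal hp0.le] at this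
  rw [dirNorm_eq hp hG, ← Real.rpow_mul (by positivity), inv_mul_cancel₀ hp0.ne', Real.rpow_one,
    ofReal_integral_eq_lintegral_ofReal h (Filter.Eventually.of_forall fun z => by positivity)]

theorem exists_pos_mul_norm_le_dirNorm (hp : 1 ≤ p) (hG : MemLp G (ENNReal.ofReal p) μ)
    (h0 : ∀ ξ, ξ ≠ 0 → 0 < dirNorm p μ G ξ) : ∃ c > 0, ∀ ξ, c * ‖ξ‖ ≤ dirNorm p μ G ξ := by
  rcases (Metric.sphere (0 : EuclideanSpace ℝ (Fin m)) 1).eq_empty_or_nonempty with he | hne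
  · refine ⟨1, one_pos, fun ξ => ?_⟩
    by_cases hξ : ξ = 0
    · simp [hξ, dirNorm_nonneg]
    · have : (‖ξ‖⁻¹ • ξ) ∈ Metric.sphere (0 : EuclideanSpace ℝ (Fin m)) 1 := by
        simp [norm_smul, norm_ne_zero_iff.2 hξ]
      simp [he] at this
  · obtain ⟨e, he, hmin⟩ := (isCompact_sphere (0 : EuclideanSpace ℝ (Fin m)) 1).exists_isMinOn hne
      (continuous_dirNorm hp hG).continuousOn
    refine ⟨_, h0 e (ne_zero_of_mem_unit_sphere ⟨e, he⟩), fun ξ => ?_⟩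
    by_cases hξ : ξ = 0
    · simp [hξ, dirNorm_nonneg]
    · have hn : 0 < ‖ξ‖ := norm_pos_iff.2 hξ
      have h1 : (‖ξ‖⁻¹ • ξ) ∈ Metric.sphere (0 : EuclideanSpace ℝ (Fin m)) 1 := by
        simp [norm_smul, hn.ne']
      have h2 := hmin h1
      simp only [mem_ofPred_eq] at h2
      rw [dirNorm_smul_of_pos _ _ (inv_pos.2 hn), ← div_eq_inv_mul, le_div_iff₀ hn] at h2
      exact h2

end DirNorm

section Body

variable {m : ℕ} {p : ℝ} {L : Set (EuclideanSpace ℝ (Fin m))}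

theorem memLp_id_restrict (hb : Bornology.IsBounded L) (hL : MeasurableSet L) :
    MemLp (id : EuclideanSpace ℝ (Fin m) → _) (ENNReal.ofReal p) (volume.restrict L) := by
  have : IsFiniteMeasure (volume.restrict L) :=
    ⟨by rw [Measure.restrict_apply_univ]; exact hb.measure_lt_top⟩
  obtain ⟨C, hC⟩ := hb.exists_norm_le
  exact MemLp.of_bound (by fun_prop) C (ae_restrict_of_forall_mem hL hC)

theorem cenE_eq_dirNorm (x : EuclideanSpace ℝ (Fin m)) :
    cenE p L x = dirNorm p (volume.restrict L) id x := rfl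

theorem convex_bodyE : Convex ℝ (bodyE p L) := by
  intro y hy z hz a b ha hb hab x
  rw [inner_add_right, real_inner_smul_right, real_inner_smul_right]
  calc a * ⟪x, y⟫ + b * ⟪x, z⟫ ≤ a * cenE p L x + b * cenE p L x := by
        gcongr
        exacts [hy x, hz x]
    _ = cenE p L x := by rw [← add_mul, hab, one_mul]

theorem bodyE_mem_nhds {c : ℝ} (hc : 0 < c) (h : ∀ x, c * ‖x‖ ≤ cenE p L x) :
    bodyE p L ∈ nhds 0 := by
  refine Filter.mem_of_superset (Metric.closedBall_mem_nhds _ hc) fun y hy x => ?_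
  rw [mem_closedBall_zero_iff] at hy
  calc ⟪x, y⟫ ≤ ‖x‖ * ‖y‖ := real_inner_le_norm x y
    _ ≤ c * ‖x‖ := by rw [mul_comm]; gcongr
    _ ≤ _ := h x

theorem abs_inner_le_cenE_mul_gauge (hn : bodyE p L ∈ nhds 0) (x y : EuclideanSpace ℝ (Fin m)) :
    |⟪x, y⟫| ≤ cenE p L x * gauge (bodyE p L) y := by
  have key : ∀ x, ⟪x, y⟫ ≤ cenE p L x * gauge (bodyE p L) y := by
    intro x
    have h0 : 0 ≤ cenE p L x := dirNorm_nonneg x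
    have hr : ∀ r, gauge (bodyE p L) y < r → ⟪x, y⟫ ≤ cenE p L x * r := by
      intro r hr
      obtain ⟨b, hb0, hbr, u, hu, rfl⟩ := exists_lt_of_gauge_lt (absorbent_nhds_zero hn) hr
      simp only [real_inner_smul_right]
      calc b * ⟪x, u⟫ ≤ b * cenE p L x := by gcongr; exact hu x
        _ ≤ _ := by rw [mul_comm]; gcongr
    refine ge_of_tendsto (x := nhdsWithin (gauge (bodyE p L) y) (Ioi (gauge (bodyE p L) y)))
      (((continuous_const.mul continuous_id).tendsto _).mono_left nhdsWithin_le_nhds) ?_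
    filter_upwards [self_mem_nhdsWithin] with r h using hr r h
  refine abs_le'.2 ⟨key x, ?_⟩
  have := key (-x)
  rwa [inner_neg_left, cenE_eq_dirNorm, dirNorm_neg] at this

theorem ofReal_pow_mul_volume_le_volume_gauge_lt {K : Set (EuclideanSpace ℝ (Fin m))}
    (hK : Convex ℝ K) {c : ℝ} (hc : 0 < c) :
    ENNReal.ofReal (c ^ m) * volume K ≤ volume {y | gauge K y < c} := by
  have h1 : volume K ≤ volume (interior K) := by
    have h2 := measure_mono (μ := volume) (subset_closure (s := K))
    rw [closure_eq_interior_union_frontier] at h2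
    refine h2.trans ((measure_union_le _ _).trans_eq ?_)
    rw [hK.addHaar_frontier volume, add_zero]
  calc ENNReal.ofReal (c ^ m) * volume K ≤ ENNReal.ofReal (c ^ m) * volume (interior K) := by gcongr
    _ = volume (c • interior K) := by
      rw [Measure.addHaar_smul, finrank_euclideanSpace_fin, abs_of_pos (by positivity)]
    _ ≤ _ := by
      refine measure_mono ?_
      rintro _ ⟨u, hu, rfl⟩
      have := interior_subset_gauge_lt_one K hu
      simp only [mem_ofPred_eq] at this ⊢
      rw [gauge_smul_of_nonneg hc.le, smul_eq_mul]
      nlinarith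

end Body

theorem rpow_mul_integral_rpow_neg_le {α : Type*} [MeasurableSpace α] {ν : Measure α}
    [IsFiniteMeasure ν] {N : α → ℝ} {m p : ℝ} (hm : 0 < m) (hp : 0 < p) (hN : ∀ x, 0 < N x)
    (h1 : Integrable (fun x => N x ^ p) ν) (h2 : Integrable (fun x => N x ^ (-m)) ν)
    (hσ : 0 < ν.real univ) (hJ : 0 < ∫ x, N x ^ (-m) ∂ν) :
    ν.real univ ^ (1 + p / m) * (∫ x, N x ^ (-m) ∂ν) ^ (-p / m) ≤ ∫ x, N x ^ p ∂ν := by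
  set σ := ν.real univ
  set J := ∫ x, N x ^ (-m) ∂ν
  set c := (J / σ) ^ (-m⁻¹) with hc
  have hc0 : 0 < c := by positivity
  have hcm : c ^ m = σ / J := by
    rw [hc, ← Real.rpow_mul (by positivity), neg_mul, inv_mul_cancel₀ hm.ne', Real.rpow_neg_one,
      inv_div]
  have hcp : σ * c ^ p = σ ^ (1 + p / m) * J ^ (-p / m) := by
    rw [hc, ← Real.rpow_mul (by positivity), Real.div_rpow hJ.le hσ.le, Real.rpow_add hσ,
      Real.rpow_one, show -m⁻¹ * p = -(p / m) by ring, Real.rpow_neg hσ.le, div_inv_eq_mul,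
      neg_div]
    ring
  have key : ∀ x, m + p ≤ m * c ^ (-p) * N x ^ p + p * c ^ m * N x ^ (-m) := by
    intro x
    have ht : 0 < N x / c := div_pos (hN x) hc0
    have := Real.geom_mean_le_arith_mean2_weighted (w₁ := m / (m + p)) (w₂ := p / (m + p))
      (p₁ := (N x / c) ^ p) (p₂ := (N x / c) ^ (-m)) (by positivity) (by positivity)
      (by positivity) (by positivity) (by field_simp)
    rw [← Real.rpow_mul ht.le, ← Real.rpow_mul ht.le, ← Real.rpow_add ht,
      show p * (m / (m + p)) + -m * (p / (m + p)) = 0 by ring, Real.rpow_zero,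
      Real.div_rpow (hN x).le hc0.le, Real.div_rpow (hN x).le hc0.le,
      Real.rpow_neg hc0.le m, div_inv_eq_mul] at this
    rw [Real.rpow_neg hc0.le]
    have h3 := mul_le_mul_of_nonneg_left this (show 0 ≤ m + p by positivity)
    refine (by simpa using h3 : m + p ≤ _).trans_eq ?_
    field_simp
  have hintg : (m + p) * σ ≤ m * c ^ (-p) * (∫ x, N x ^ p ∂ν) + p * c ^ m * J := by
    have := integral_mono (μ := ν) (integrable_const _)
      ((h1.const_mul (m * c ^ (-p))).add (h2.const_mul (p * c ^ m))) key
    simp only [Pi.add_apply] at this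
    rw [integral_add (h1.const_mul _) (h2.const_mul _), integral_const_mul, integral_const_mul,
      integral_const, smul_eq_mul] at this
    linarith
  rw [hcm, mul_assoc p, div_mul_cancel₀ _ hJ.ne', Real.rpow_neg hc0.le] at hintg
  rw [← hcp]
  have hcp0 : 0 < c ^ p := by positivity
  have h4 : m * σ ≤ m * ((c ^ p)⁻¹ * ∫ x, N x ^ p ∂ν) := by linarith
  have h5 := le_of_mul_le_mul_left h4 hm
  calc σ * c ^ p ≤ ((c ^ p)⁻¹ * ∫ x, N x ^ p ∂ν) * c ^ p := by gcongr
    _ = _ := by field_simp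

/-- The affine energy associated with a norm `N`. -/
def affEnergy (m : ℕ) (p : ℝ) (N : EuclideanSpace ℝ (Fin m) → ℝ) : ℝ :=
  (m * w m) ^ (1 + p / m) / sphMoment m p *
    (∫ ξ, N (ξ : EuclideanSpace ℝ (Fin m)) ^ (-(m : ℝ)) ∂(sphMeasure m)) ^ (-p / m)

section Energy

variable {k : ℕ} {p : ℝ} {N : EuclideanSpace ℝ (Fin (k + 1)) → ℝ}

theorem sphMoment_pos {m : ℕ} (hm : 1 ≤ m) (hp : 0 < p) : 0 < sphMoment m p := by
  have : (1 : ℝ) ≤ m := by exact_mod_cast hm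
  exact div_pos (mul_pos two_pos (w_pos (by linarith))) (w_pos (by linarith))

theorem pos_of_mem_sphere (h0 : ∀ ξ, ξ ≠ 0 → 0 < N ξ)
    (ξ : Metric.sphere (0 : EuclideanSpace ℝ (Fin (k + 1))) 1) : 0 < N ξ :=
  h0 _ (ne_zero_of_mem_unit_sphere ξ)

theorem integrable_sphere_rpow (hN : Continuous N) (h0 : ∀ ξ, ξ ≠ 0 → 0 < N ξ) (s : ℝ) :
    Integrable (fun ξ : Metric.sphere (0 : EuclideanSpace ℝ (Fin (k + 1))) 1 => N ξ ^ s)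
      (sphMeasure (k + 1)) := by
  have : CompactSpace (Metric.sphere (0 : EuclideanSpace ℝ (Fin (k + 1))) 1) :=
    isCompact_iff_compactSpace.1 (isCompact_sphere 0 1)
  refine Continuous.integrable_of_hasCompactSupport ?_ (HasCompactSupport.of_compactSpace _)
  exact (hN.comp continuous_subtype_val).rpow_const fun ξ => Or.inl (pos_of_mem_sphere h0 ξ).ne'

theorem sphMeasure_real_univ_pos : 0 < (sphMeasure (k + 1)).real univ := by
  rw [sphMeasure_real_univ]
  exact mul_pos (by positivity) (w_pos (by linarith [(k + 1 : ℕ).cast_nonneg (α := ℝ)]))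

theorem integral_sphere_rpow_pos (hN : Continuous N) (h0 : ∀ ξ, ξ ≠ 0 → 0 < N ξ) (s : ℝ) :
    0 < ∫ ξ, N (ξ : EuclideanSpace ℝ (Fin (k + 1))) ^ s ∂(sphMeasure (k + 1)) := by
  have hpos : ∀ ξ : Metric.sphere (0 : EuclideanSpace ℝ (Fin (k + 1))) 1, 0 < N ξ ^ s :=
    fun ξ => Real.rpow_pos_of_pos (pos_of_mem_sphere h0 ξ) s
  rw [integral_pos_iff_support_of_nonneg (fun ξ => (hpos ξ).le) (integrable_sphere_rpow hN h0 s),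
    show Function.support (fun ξ : Metric.sphere (0 : EuclideanSpace ℝ (Fin (k + 1))) 1 => N ξ ^ s)
      = univ from eq_univ_of_forall fun ξ => (hpos ξ).ne']
  have := sphMeasure_real_univ_pos (k := k)
  rw [measureReal_def] at this
  exact (ENNReal.toReal_pos_iff.1 this).1

theorem affEnergy_mul_le (hp : 0 < p) (hN : Continuous N) (h0 : ∀ ξ, ξ ≠ 0 → 0 < N ξ) :
    affEnergy (k + 1) p N * sphMoment (k + 1) p ≤
      ∫ ξ, N (ξ : EuclideanSpace ℝ (Fin (k + 1))) ^ p ∂(sphMeasure (k + 1)) := by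
  have hs := sphMoment_pos (m := k + 1) (by lia) hp
  have := rpow_mul_integral_rpow_neg_le (ν := sphMeasure (k + 1))
    (N := fun ξ => N (ξ : EuclideanSpace ℝ (Fin (k + 1)))) (m := (k + 1 : ℕ)) (by positivity) hp
    (pos_of_mem_sphere h0) (integrable_sphere_rpow hN h0 p) (integrable_sphere_rpow hN h0 _)
    sphMeasure_real_univ_pos (integral_sphere_rpow_pos hN h0 _)
  rw [sphMeasure_real_univ] at this
  refine le_trans (le_of_eq ?_) this
  rw [affEnergy]
  field_simp

variable {Ω : Type*} [MeasurableSpace Ω] {μ : Measure Ω} [SFinite μ]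
  {G : Ω → EuclideanSpace ℝ (Fin (k + 1))}

theorem affEnergy_le (hp : 1 ≤ p) (hGm : Measurable G) (hG : MemLp G (ENNReal.ofReal p) μ)
    (h0 : ∀ ξ, ξ ≠ 0 → 0 < dirNorm p μ G ξ) :
    affEnergy (k + 1) p (dirNorm p μ G) ≤ ∫ z, ‖G z‖ ^ p ∂μ := by
  have hp0 : 0 < p := by linarith
  have hc := continuous_dirNorm hp hG
  have hs := sphMoment_pos (m := k + 1) (by lia) hp0
  have hi : Integrable (fun z => ‖G z‖ ^ p) μ := by
    have := hG.integrable_norm_rpow (by simpa using hp0) ENNReal.ofReal_ne_top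
    rwa [ENNReal.toReal_ofReal hp0.le] at this
  have h1 : ∫ ξ, dirNorm p μ G (ξ : EuclideanSpace ℝ (Fin (k + 1))) ^ p ∂(sphMeasure (k + 1)) =
      sphMoment (k + 1) p * ∫ z, ‖G z‖ ^ p ∂μ := by
    rw [← ENNReal.ofReal_eq_ofReal_iff
        (integral_sphere_rpow_pos hc h0 p).le (mul_nonneg hs.le (integral_nonneg fun z => by positivity)),
      ofReal_integral_eq_lintegral_ofReal (integrable_sphere_rpow hc h0 p)
        (Filter.Eventually.of_forall fun ξ => Real.rpow_nonneg (dirNorm_nonneg _) _)]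
    simp only [ofReal_dirNorm_rpow hp hG]
    rw [lintegral_lintegral_swap (by fun_prop)]
    have : ∀ z, ∫⁻ ξ, ENNReal.ofReal (|⟪(ξ : EuclideanSpace ℝ (Fin (k + 1))), G z⟫| ^ p)
        ∂(sphMeasure (k + 1)) = ENNReal.ofReal (sphMoment (k + 1) p) * ENNReal.ofReal (‖G z‖ ^ p) := by
      intro z
      simp only [real_inner_comm (G z)]
      rw [lintegral_sphere_abs_inner_rpow hp0, ENNReal.ofReal_mul hs.le]
    simp only [this]
    rw [lintegral_const_mul _ (by fun_prop), ENNReal.ofReal_mul hs.le,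
      ofReal_integral_eq_lintegral_ofReal hi (Filter.Eventually.of_forall fun z => by positivity)]
  have h2 := affEnergy_mul_le hp0 hc h0
  rw [h1, mul_comm] at h2
  exact le_of_mul_le_mul_left h2 hs

end Energy

section Dual

variable {k : ℕ} {p : ℝ} {N : EuclideanSpace ℝ (Fin (k + 1)) → ℝ}

theorem volume_ball_eq {ρ : ℝ} (hρ : 0 ≤ ρ) (x : EuclideanSpace ℝ (Fin (k + 1))) :
    volume (Metric.ball x ρ) = ENNReal.ofReal (w (k + 1 : ℕ) * ρ ^ ((k + 1 : ℕ) : ℝ)) := by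
  rw [EuclideanSpace.volume_ball, ← ENNReal.ofReal_pow hρ, ← ENNReal.ofReal_mul (by positivity), w]
  simp only [Fintype.card_fin]
  rw [Real.sqrt_eq_rpow, ← Real.rpow_mul_natCast pi_pos.le, Real.rpow_natCast, mul_comm]
  congr 4
  ring

theorem volume_sublevel_eq (hN : Continuous N) (hs : ∀ r z, 0 < r → N (r • z) = r * N z)
    (h0 : ∀ ξ, ξ ≠ 0 → 0 < N ξ) :
    volume {z | N z < 1} = ENNReal.ofReal
      ((∫ ξ, N (ξ : EuclideanSpace ℝ (Fin (k + 1))) ^ (-((k + 1 : ℕ) : ℝ)) ∂(sphMeasure (k + 1))) /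
        (k + 1 : ℕ)) := by
  have h := lintegral_sublevel_polar (s := 0) (φ := fun _ => 1) le_rfl hN hs h0 measurable_const
    (fun _ => zero_le_one) (fun r z hr => by simp)
  simp only [ENNReal.ofReal_one, lintegral_const, one_mul, Measure.restrict_apply_univ,
    add_zero] at h
  rw [h, ← integral_div, ofReal_integral_eq_lintegral_ofReal
    ((integrable_sphere_rpow hN h0 _).div_const _)]
  · push_cast
    rfl
  · refine Filter.Eventually.of_forall fun ξ => div_nonneg ?_ (by positivity)
    exact Real.rpow_nonneg (pos_of_mem_sphere h0 ξ).le _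

theorem lintegral_sublevel_rpow_eq (hp : 0 < p) (hN : Continuous N)
    (hs : ∀ r z, 0 < r → N (r • z) = r * N z) (h0 : ∀ ξ, ξ ≠ 0 → 0 < N ξ) (hN0 : ∀ ξ, 0 ≤ N ξ) :
    ∫⁻ z in {z | N z < 1}, ENNReal.ofReal (N z ^ p) = ENNReal.ofReal
      ((∫ ξ, N (ξ : EuclideanSpace ℝ (Fin (k + 1))) ^ (-((k + 1 : ℕ) : ℝ)) ∂(sphMeasure (k + 1))) /
        ((k + 1 : ℕ) + p)) := by
  rw [lintegral_sublevel_polar hp.le hN hs h0 (by fun_prop) (fun z => Real.rpow_nonneg (hN0 z) _)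
    (fun r z hr => by rw [hs r z hr, Real.mul_rpow hr.le (hN0 z)]), ← integral_div,
    ofReal_integral_eq_lintegral_ofReal ((integrable_sphere_rpow hN h0 _).div_const _)]
  · congr 1 with ξ
    rw [← Real.rpow_add (pos_of_mem_sphere h0 ξ)]
    push_cast
    congr 3
    ring
  · refine Filter.Eventually.of_forall fun ξ => div_nonneg ?_ (by positivity)
    exact Real.rpow_nonneg (pos_of_mem_sphere h0 ξ).le _

theorem integral_ball_abs_inner_rpow (hp : 0 < p) {ρ : ℝ} (hρ : 0 < ρ)
    (x : EuclideanSpace ℝ (Fin (k + 1))) :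
    ∫ z in Metric.ball 0 ρ, |⟪x, z⟫| ^ p =
      sphMoment (k + 1) p * ρ ^ ((k + 1 : ℕ) + p) / ((k + 1 : ℕ) + p) * ‖x‖ ^ p := by
  have hb : Metric.ball (0 : EuclideanSpace ℝ (Fin (k + 1))) ρ = {z | ρ⁻¹ * ‖z‖ < 1} := by
    ext z
    rw [mem_ball_zero_iff, mem_ofPred_eq, inv_mul_lt_one₀ hρ]
  have hs := sphMoment_pos (m := k + 1) (by lia) hp
  rw [integral_eq_lintegral_of_nonneg_ae (Filter.Eventually.of_forall fun z => by positivity)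
    (by fun_prop (disch := exact hp.le)), hb, lintegral_sublevel_polar (N := fun z => ρ⁻¹ * ‖z‖) hp.le (by fun_prop)
    (fun r z hr => by rw [norm_smul, Real.norm_of_nonneg hr.le]; ring)
    (fun z hz => mul_pos (inv_pos.2 hρ) (norm_pos_iff.2 hz)) (by fun_prop)
    (fun z => by positivity) fun r z hr => by
      rw [real_inner_smul_right, abs_mul, abs_of_pos hr, Real.mul_rpow hr.le (abs_nonneg _)]]
  have : ∀ ξ : Metric.sphere (0 : EuclideanSpace ℝ (Fin (k + 1))) 1,
      ENNReal.ofReal (|⟪x, (ξ : EuclideanSpace ℝ (Fin (k + 1)))⟫| ^ p *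
        (ρ⁻¹ * ‖(ξ : EuclideanSpace ℝ (Fin (k + 1)))‖) ^ (-(k + 1 + p)) / (k + 1 + p)) =
      ENNReal.ofReal (|⟪x, (ξ : EuclideanSpace ℝ (Fin (k + 1)))⟫| ^ p) *
        ENNReal.ofReal (ρ ^ ((k + 1 : ℕ) + p) / ((k + 1 : ℕ) + p)) := by
    intro ξ
    rw [← ENNReal.ofReal_mul (by positivity), norm_eq_of_mem_sphere, mul_one,
      Real.inv_rpow hρ.le, Real.rpow_neg hρ.le, inv_inv]
    push_cast
    rw [mul_div_assoc]
  simp only [this]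
  rw [lintegral_mul_const _ (by fun_prop), lintegral_sphere_abs_inner_rpow hp,
    ← ENNReal.ofReal_mul (by positivity), ENNReal.toReal_ofReal (by positivity)]
  ring

variable {Ω : Type*} [MeasurableSpace Ω] {μ : Measure Ω} [SFinite μ]
  {G : Ω → EuclideanSpace ℝ (Fin (k + 1))}

theorem affEnergy_eq_of_volume {ρ : ℝ} (hρ : 0 < ρ) (hp : 0 < p)
    (hJ : w (k + 1 : ℕ) * ρ ^ ((k + 1 : ℕ) : ℝ) =
      (∫ ξ, N (ξ : EuclideanSpace ℝ (Fin (k + 1))) ^ (-((k + 1 : ℕ) : ℝ)) ∂(sphMeasure (k + 1))) /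
        (k + 1 : ℕ)) :
    affEnergy (k + 1) p N = (sphMoment (k + 1) p * ρ ^ ((k + 1 : ℕ) + p) / ((k + 1 : ℕ) + p))⁻¹ *
      ((∫ ξ, N (ξ : EuclideanSpace ℝ (Fin (k + 1))) ^ (-((k + 1 : ℕ) : ℝ)) ∂(sphMeasure (k + 1))) /
        ((k + 1 : ℕ) + p)) := by
  have hs := sphMoment_pos (m := k + 1) (by lia) hp
  have hw : 0 < w (k + 1 : ℕ) := w_pos (by linarith [(k + 1 : ℕ).cast_nonneg (α := ℝ)])
  set m : ℝ := ((k + 1 : ℕ) : ℝ) with hm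
  have hm0 : 0 < m := by positivity
  rw [affEnergy, ← hm]
  set J := ∫ ξ, N (ξ : EuclideanSpace ℝ (Fin (k + 1))) ^ (-m) ∂(sphMeasure (k + 1))
  have hJ' : J = m * w m * ρ ^ m := by
    rw [mul_assoc, hJ]; field_simp
  have hmw : 0 < m * w m := by positivity
  rw [hJ', Real.mul_rpow hmw.le (by positivity), ← Real.rpow_mul hρ.le, Real.rpow_add hmw,
    Real.rpow_one, Real.rpow_add hρ, mul_div_cancel₀ _ hm0.ne', Real.rpow_neg hρ.le, neg_div,
    Real.rpow_neg hmw.le]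
  field_simp

theorem exists_dual_pair (hp : 1 ≤ p) (hGm : Measurable G) (hG : MemLp G (ENNReal.ofReal p) μ)
    (h0 : ∀ ξ, ξ ≠ 0 → 0 < dirNorm p μ G ξ) :
    ∃ h ν : EuclideanSpace ℝ (Fin (k + 1)) → ℝ, Measurable h ∧ (∀ y, 0 ≤ h y) ∧ Continuous ν ∧
      (∀ y, 0 ≤ ν y) ∧ (∀ x y, |⟪x, y⟫| ≤ h x * ν y) ∧
      (∀ c, 0 < c → ENNReal.ofReal (w (k + 1 : ℕ) * c ^ ((k + 1 : ℕ) : ℝ)) ≤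
        volume {y | ν y < c}) ∧
      ∫⁻ z, ENNReal.ofReal (h (G z) ^ p) ∂μ =
        ENNReal.ofReal (affEnergy (k + 1) p (dirNorm p μ G)) := by
  have hp0 : 0 < p := by linarith
  have hw : 0 < w (k + 1 : ℕ) := w_pos (by linarith [(k + 1 : ℕ).cast_nonneg (α := ℝ)])
  have hsm := sphMoment_pos (m := k + 1) (by lia) hp0
  have hNc := continuous_dirNorm hp hG
  set N := dirNorm p μ G with hN
  have hNs : ∀ r z, 0 < r → N (r • z) = r * N z := fun r z hr => dirNorm_smul_of_pos r z hr
  have hJ := integral_sphere_rpow_pos hNc h0 (-((k + 1 : ℕ) : ℝ))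
  have hvolL := volume_sublevel_eq hNc hNs h0
  have hLp := lintegral_sublevel_rpow_eq hp0 hNc hNs h0 dirNorm_nonneg
  have hE := fun ρ => affEnergy_eq_of_volume (N := N) (p := p) (k := k) (ρ := ρ)
  set J := ∫ ξ, N (ξ : EuclideanSpace ℝ (Fin (k + 1))) ^ (-((k + 1 : ℕ) : ℝ)) ∂(sphMeasure (k + 1))
  set L := {z | N z < 1} with hL
  have hLo : IsOpen L := isOpen_lt hNc continuous_const
  have hLc : Convex ℝ L := by
    have := (convexOn_dirNorm hp hG).convex_lt 1
    simpa using this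
  obtain ⟨c, hc, hcN⟩ := exists_pos_mul_norm_le_dirNorm hp hG h0
  have hLb : Bornology.IsBounded L := by
    refine (Metric.isBounded_ball (x := 0) (r := c⁻¹)).subset fun z hz => ?_
    have := (hcN z).trans_lt hz
    rw [mem_ball_zero_iff, inv_eq_one_div, lt_div_iff₀' hc]
    exact this
  set ρ := (J / (k + 1 : ℕ) / w (k + 1 : ℕ)) ^ ((k + 1 : ℕ) : ℝ)⁻¹ with hρdef
  have hρ : 0 < ρ := by positivity
  have hρJ : w (k + 1 : ℕ) * ρ ^ ((k + 1 : ℕ) : ℝ) = J / (k + 1 : ℕ) := by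
    rw [hρdef, Real.rpow_inv_rpow (by positivity) (by positivity), mul_div_cancel₀ _ hw.ne']
  replace hE := hE ρ hρ hp0 hρJ
  set κ := sphMoment (k + 1) p * ρ ^ ((k + 1 : ℕ) + p) / ((k + 1 : ℕ) + p) with hκdef
  have hκ : 0 < κ := by positivity
  have hvol : volume L = volume (Metric.ball (0 : EuclideanSpace ℝ (Fin (k + 1))) ρ) := by
    rw [hvolL, volume_ball_eq hρ.le, hρJ]
  have hbody := volume_closedBall_le_bodyE hp hLo hLc hLb hρ hvol hκ
    (integral_ball_abs_inner_rpow hp0 hρ)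
  have hmem := memLp_id_restrict (p := p) hLb hLo.measurableSet
  have hcen0 : ∀ x, x ≠ 0 → 0 < dirNorm p (volume.restrict L) id x := by
    intro x hx
    obtain ⟨he, hi⟩ := cenE_eq hp hLb hLo.measurableSet x
    rw [← cenE_eq_dirNorm, he]
    refine Real.rpow_pos_of_pos ?_ _
    rw [setIntegral_pos_iff_support_of_nonneg_ae
      (Filter.Eventually.of_forall fun z => by positivity) hi]
    have hsub : {z | ⟪x, z⟫ ≠ 0} ∩ L ⊆ Function.support (fun z => |⟪x, z⟫| ^ p) ∩ L :=
      inter_subset_inter_left _ fun z hz => (Real.rpow_pos_of_pos (abs_pos.2 hz) p).ne'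
    refine (IsOpen.measure_pos _ ?_ ?_).trans_le (measure_mono hsub)
    · exact (isOpen_ne_fun (by fun_prop) continuous_const).inter hLo
    · have hr : 0 < (N x + 1)⁻¹ := inv_pos.2 (by linarith [h0 x hx])
      refine ⟨(N x + 1)⁻¹ • x, ?_, ?_⟩
      · rw [mem_ofPred_eq, real_inner_smul_right]
        exact mul_ne_zero hr.ne' (inner_self_ne_zero.2 hx)
      · rw [hL, mem_ofPred_eq, hNs _ _ hr, inv_mul_lt_one₀ (by linarith [h0 x hx])]
        exact lt_add_one _
  obtain ⟨c', hc', hcen⟩ := exists_pos_mul_norm_le_dirNorm hp hmem hcen0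
  have hnhds : bodyE p L ∈ nhds 0 := bodyE_mem_nhds hc' hcen
  have hcenc : Continuous (cenE p L) := continuous_dirNorm hp hmem
  have hκp : 0 < κ ^ p⁻¹ := by positivity
  refine ⟨fun x => (κ ^ p⁻¹)⁻¹ * cenE p L x, fun y => κ ^ p⁻¹ * gauge (bodyE p L) y,
    by fun_prop, fun y => mul_nonneg (by positivity) (dirNorm_nonneg y),
    continuous_const.mul (continuous_gauge convex_bodyE hnhds),
    fun y => mul_nonneg hκp.le (gauge_nonneg y), fun x y => ?_, fun c hc => ?_, ?_⟩
  · refine (abs_inner_le_cenE_mul_gauge hnhds x y).trans_eq ?_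
    field_simp
  · have h1 := ofReal_pow_mul_volume_le_volume_gauge_lt (K := bodyE p L) convex_bodyE
      (c := (κ ^ p⁻¹)⁻¹ * c) (by positivity)
    have h2 : {y | κ ^ p⁻¹ * gauge (bodyE p L) y < c} =
        {y | gauge (bodyE p L) y < (κ ^ p⁻¹)⁻¹ * c} := by
      ext y
      rw [mem_ofPred_eq, mem_ofPred_eq, lt_inv_mul_iff₀ hκp]
    rw [h2]
    refine le_trans (le_trans (le_of_eq ?_) (mul_le_mul_right hbody _)) h1
    rw [Measure.addHaar_closedBall_eq_addHaar_ball, volume_ball_eq hκp.le,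
      ← ENNReal.ofReal_mul (by positivity), ← Real.rpow_natCast, mul_left_comm,
      ← Real.mul_rpow (by positivity) hκp.le]
    congr 3
    field_simp
  · have h1 : ∀ z, ENNReal.ofReal (((κ ^ p⁻¹)⁻¹ * cenE p L (G z)) ^ p) =
        ENNReal.ofReal κ⁻¹ * ∫⁻ y in L, ENNReal.ofReal (|⟪y, G z⟫| ^ p) := by
      intro z
      rw [cenE_eq_dirNorm, Real.mul_rpow (by positivity) (dirNorm_nonneg _),
        Real.inv_rpow hκp.le, Real.rpow_inv_rpow hκ.le hp0.ne', ENNReal.ofReal_mul (by positivity),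
        ofReal_dirNorm_rpow hp hmem]
      simp only [id, real_inner_comm (G z)]
    simp only [h1]
    rw [lintegral_const_mul _ (by fun_prop), lintegral_lintegral_swap (by fun_prop)]
    simp only [← ofReal_dirNorm_rpow hp hG]
    rw [hLp, ← ENNReal.ofReal_mul (by positivity), hE]

end Dual

theorem rpow_sub_one_le {p q : ℝ} (hp : 1 < p) (hq : q = p / (p - 1)) :
    (p - 1) ^ (p - 1) ≤
      (p ^ p⁻¹ * q ^ q⁻¹) ^ (-p⁻¹) * p * ((p - 1) ^ ((p - 1) / p)) ^ (p - 1) := by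
  have hp0 : 0 < p := by linarith
  have hp1 : 0 < p - 1 := by linarith
  have hc : p ^ p⁻¹ * q ^ q⁻¹ = p * (p - 1) ^ (-((p - 1) / p)) := by
    rw [hq, inv_div, Real.div_rpow hp0.le hp1.le, Real.rpow_neg hp1.le, ← div_eq_mul_inv,
      ← mul_div_assoc, ← Real.rpow_add hp0, show p⁻¹ + (p - 1) / p = 1 by field_simp; ring,
      Real.rpow_one]
  have h1 : (p ^ p⁻¹ * q ^ q⁻¹) ^ (-p⁻¹) * p * ((p - 1) ^ ((p - 1) / p)) ^ (p - 1) =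
      p ^ ((p - 1) / p) * (p - 1) ^ ((p - 1) - ((p - 1) / p) ^ 2) := by
    rw [hc, Real.mul_rpow hp0.le (by positivity), ← Real.rpow_mul hp1.le, ← Real.rpow_mul hp1.le,
      show (p - 1) - ((p - 1) / p) ^ 2 = -((p - 1) / p) * -p⁻¹ + (p - 1) / p * (p - 1) by
        field_simp; ring,
      Real.rpow_add hp1, show (p - 1) / p = -p⁻¹ + 1 by field_simp; ring, Real.rpow_add hp0,
      Real.rpow_one]
    ring
  have ht1 : (p - 1) / p ≤ 1 := by rw [div_le_one hp0]; linarith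
  have ht0 : 0 ≤ (p - 1) / p := by positivity
  calc (p - 1) ^ (p - 1) =
        (p - 1) ^ (((p - 1) / p) ^ 2) * (p - 1) ^ ((p - 1) - ((p - 1) / p) ^ 2) := by
        rw [← Real.rpow_add hp1]; congr 1; ring
    _ ≤ p ^ (((p - 1) / p) ^ 2) * (p - 1) ^ ((p - 1) - ((p - 1) / p) ^ 2) := by
        gcongr; linarith
    _ ≤ p ^ ((p - 1) / p) * (p - 1) ^ ((p - 1) - ((p - 1) / p) ^ 2) := by
        gcongr
        · exact hp.le
        · nlinarith
    _ = _ := h1.symm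

theorem A_nonneg {n : ℕ} {p : ℝ} (hn : 1 ≤ n) (hp : 1 < p) (hpn : p < n) : 0 ≤ A n p := by
  have hn' : (1 : ℝ) ≤ n := by exact_mod_cast hn
  have h1 : 0 ≤ p - 1 := by linarith
  have h2 : 0 ≤ (n : ℝ) - p := by linarith
  have h3 : 0 ≤ (n : ℝ) - 1 := by linarith
  have g : ∀ {s : ℝ}, 0 ≤ s → 0 ≤ Real.Gamma s := fun h => Real.Gamma_nonneg_of_nonneg h
  rw [A]
  have := g (s := n) (by positivity)
  have := g (s := ((n : ℝ) + 1) / 2) (by positivity)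
  have := g (s := ((n : ℝ) - 1) / p) (by positivity)
  have := g (s := ((n : ℝ) * (p - 1) + 1) / p) (by positivity)
  positivity

theorem sharp_constant_le {k : ℕ} {p q : ℝ} (hp : 1 < p) (hpm : p < (k + 1 : ℕ) + 1)
    (hq : q = p / (p - 1)) :
    ((p - 1) / ((k + 1 : ℕ) + 1 - p) * (w (k + 1 : ℕ) * Real.Gamma ((k + 1 : ℕ) / q + 1) *
        Real.Gamma ((k + 1 : ℕ) / p) / Real.Gamma (k + 1 : ℕ))) ^ (-(p - 1) / (k + 1 : ℕ)) *
      ((p - 1) / ((k + 1 : ℕ) + 1 - p)) ^ (p - ((k + 1 : ℕ) + 1 - p) / (k + 1 : ℕ)) ≤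
    (p ^ p⁻¹ * q ^ q⁻¹) ^ (-p⁻¹) * (p * A (k + 2) p) := by
  have hcast : ((k + 2 : ℕ) : ℝ) = (k + 1 : ℕ) + 1 := by push_cast; ring
  rw [A, hcast]
  set m : ℝ := ((k + 1 : ℕ) : ℝ)
  have hm : 0 < m := by positivity
  have hp0 : 0 < p := by linarith
  have hp1 : 0 < p - 1 := by linarith
  have hmp : 0 < m + 1 - p := by linarith
  have hq0 : 0 < q := by rw [hq]; positivity
  have g1 := Real.Gamma_pos_of_pos (show 0 < m / q + 1 by positivity)
  have g2 := Real.Gamma_pos_of_pos (show 0 < m / p by positivity)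
  have g3 := Real.Gamma_pos_of_pos hm
  have g4 := Real.Gamma_pos_of_pos (show 0 < m / 2 + 1 by positivity)
  rw [Real.Gamma_add_one hm.ne', add_sub_cancel_right,
    show (m + 1 + 1) / 2 = m / 2 + 1 by ring,
    show ((m + 1) * (p - 1) + 1) / p = m / q + 1 by rw [hq]; field_simp; ring]
  set X := m * Real.Gamma m * Real.Gamma (m / 2 + 1) /
    (m * Real.Gamma (m / p) * Real.Gamma (m / q + 1)) with hX
  have hX0 : 0 < X := by positivity
  have hκ : 0 < (p - 1) / (m + 1 - p) := by positivity
  have h1 : (p - 1) / (m + 1 - p) * (w m * Real.Gamma (m / q + 1) *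
      Real.Gamma (m / p) / Real.Gamma m) = (p - 1) / (m + 1 - p) * π ^ (m / 2) * X⁻¹ := by
    rw [hX, w]; field_simp
  have hexp : ((p - 1) / (m + 1 - p)) ^ (p - 1) =
      ((p - 1) / (m + 1 - p)) ^ (-(p - 1) / m + (p - (m + 1 - p) / m)) := by
    congr 1; field_simp; ring
  have h2 : ((p - 1) / (m + 1 - p) * π ^ (m / 2) * X⁻¹) ^ (-(p - 1) / m) *
      ((p - 1) / (m + 1 - p)) ^ (p - (m + 1 - p) / m) =
      ((p - 1) / (m + 1 - p)) ^ (p - 1) * (π ^ (-(p - 1) / 2) * X ^ ((p - 1) / m)) := by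
    rw [Real.mul_rpow (by positivity) (by positivity), Real.mul_rpow hκ.le (by positivity),
      Real.inv_rpow hX0.le, ← Real.rpow_neg hX0.le, ← Real.rpow_mul pi_pos.le,
      show m / 2 * (-(p - 1) / m) = -(p - 1) / 2 by field_simp,
      show -(-(p - 1) / m) = (p - 1) / m by ring,
      hexp, Real.rpow_add hκ]
    ring
  rw [h1, h2, Real.div_rpow hp1.le hmp.le, Real.div_rpow (by positivity) hmp.le]
  calc (p - 1) ^ (p - 1) / (m + 1 - p) ^ (p - 1) * (π ^ (-(p - 1) / 2) * X ^ ((p - 1) / m))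
      ≤ (p ^ p⁻¹ * q ^ q⁻¹) ^ (-p⁻¹) * p * ((p - 1) ^ ((p - 1) / p)) ^ (p - 1) /
        (m + 1 - p) ^ (p - 1) * (π ^ (-(p - 1) / 2) * X ^ ((p - 1) / m)) := by
        gcongr
        exact rpow_sub_one_le hp hq
    _ = _ := by ring

section Gradient

variable {m : ℕ} {f : ℝ × EuclideanSpace ℝ (Fin m) → ℝ}

/-- The gradient in the second variable. -/
def gradSnd (f : ℝ × EuclideanSpace ℝ (Fin m) → ℝ) (z : ℝ × EuclideanSpace ℝ (Fin m)) :
    EuclideanSpace ℝ (Fin m) :=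
  gradient (fun x => f (z.1, x)) z.2

theorem gradSnd_eq (hf : ContDiff ℝ 1 f) (z : ℝ × EuclideanSpace ℝ (Fin m)) :
    gradSnd f z = (InnerProductSpace.toDual ℝ _).symm
      ((fderiv ℝ f z).comp (ContinuousLinearMap.inr ℝ ℝ _)) := by
  have h1 : HasFDerivAt (fun x => f (z.1, x))
      ((fderiv ℝ f z).comp (ContinuousLinearMap.inr ℝ ℝ _)) z.2 :=
    ((hf.differentiable one_ne_zero) z).hasFDerivAt.comp z.2 (hasFDerivAt_prodMk_right z.1 z.2)
  rw [gradSnd, gradient, h1.fderiv]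

theorem fderiv_zero_prod (hf : ContDiff ℝ 1 f) (z : ℝ × EuclideanSpace ℝ (Fin m))
    (y : EuclideanSpace ℝ (Fin m)) : fderiv ℝ f z (0, y) = ⟪gradSnd f z, y⟫ := by
  rw [gradSnd_eq hf, InnerProductSpace.toDual_symm_apply]
  rfl

theorem continuous_gradSnd (hf : ContDiff ℝ 1 f) : Continuous (gradSnd f) := by
  rw [funext (gradSnd_eq hf)]
  exact (LinearIsometryEquiv.continuous _).comp
    ((hf.continuous_fderiv one_ne_zero).clm_comp continuous_const)

theorem hasCompactSupport_gradSnd (hf : ContDiff ℝ 1 f) (hfc : HasCompactSupport f) :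
    HasCompactSupport (gradSnd f) := by
  refine (hfc.fderiv ℝ).mono fun z hz h => hz ?_
  rw [gradSnd_eq hf, h, ContinuousLinearMap.zero_comp, map_zero]

theorem memLp_gradSnd (hf : ContDiff ℝ 1 f) (hfc : HasCompactSupport f) (p : ℝ≥0∞)
    (s : Set (ℝ × EuclideanSpace ℝ (Fin m))) : MemLp (gradSnd f) p (volume.restrict s) :=
  ((continuous_gradSnd hf).memLp_of_hasCompactSupport (hasCompactSupport_gradSnd hf hfc)).restrict s

/-- A compactly supported function with a vanishing directional derivative along the half-space
vanishes there. -/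
theorem eq_zero_of_dirNorm_eq_zero {p : ℝ} (hp : 1 ≤ p) (hf : ContDiff ℝ 1 f)
    (hfc : HasCompactSupport f) {ξ : EuclideanSpace ℝ (Fin m)} (hξ : ξ ≠ 0)
    (h : dirNorm p (volume.restrict {z | 0 < z.1}) (gradSnd f) ξ = 0)
    {z : ℝ × EuclideanSpace ℝ (Fin m)} (hz : 0 ≤ z.1) : f z = 0 := by
  have hp0 : 0 < p := by linarith
  have hc := continuous_gradSnd hf
  rw [dirNorm_eq hp (memLp_gradSnd hf hfc _ _),
    Real.rpow_eq_zero (integral_nonneg fun z => by positivity) (by positivity)] at h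
  have hcs : HasCompactSupport fun z => ⟪ξ, gradSnd f z⟫ :=
    (hasCompactSupport_gradSnd hf hfc).comp_left (g := fun v => ⟪ξ, v⟫) (inner_zero_right _)
  have h0 : ∀ y : ℝ × EuclideanSpace ℝ (Fin m), 0 ≤ y.1 → ⟪ξ, gradSnd f y⟫ = 0 := fun y hy =>
    eq_zero_of_integral_halfSpace_eq_zero (by fun_prop) hcs hp0 h hy
  have hd : ∀ s : ℝ, HasDerivAt (fun s : ℝ => f (z.1, z.2 + s • ξ)) 0 s := by
    intro s
    have h1 : HasDerivAt (fun s : ℝ => (z.1, z.2 + s • ξ)) ((0 : ℝ), ξ) s := by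
      refine (hasDerivAt_const s z.1).prodMk ?_
      simpa using ((hasDerivAt_id s).smul_const ξ).const_add z.2
    have h2 := ((hf.differentiable one_ne_zero) (z.1, z.2 + s • ξ)).hasFDerivAt.comp_hasDerivAt s h1
    rwa [fderiv_zero_prod hf, real_inner_comm, h0 (z.1, z.2 + s • ξ) hz] at h2
  have hconst : ∀ s : ℝ, f (z.1, z.2 + s • ξ) = f z := fun s => by
    have := is_const_of_deriv_eq_zero (fun s => (hd s).differentiableAt) (fun s => (hd s).deriv) s 0
    simpa using this
  obtain ⟨R, hR⟩ := hfc.isBounded.exists_norm_le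
  by_contra hne
  have hmem : ∀ s : ℝ, ‖z.2 + s • ξ‖ ≤ R := fun s =>
    (norm_snd_le (z.1, z.2 + s • ξ)).trans
      (hR _ (subset_tsupport _ (by rw [Function.mem_support, hconst]; exact hne)))
  have h1 := hmem ((‖z.2‖ + R + 1) / ‖ξ‖)
  have hξ0 : 0 < ‖ξ‖ := norm_pos_iff.2 hξ
  have hR0 : 0 ≤ R := (norm_nonneg _).trans (hmem 0)
  have h2 : ‖((‖z.2‖ + R + 1) / ‖ξ‖) • ξ‖ = ‖z.2‖ + R + 1 := by
    rw [norm_smul, Real.norm_of_nonneg (by positivity), div_mul_cancel₀ _ hξ0.ne']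
  have h3 := norm_sub_le (z.2 + ((‖z.2‖ + R + 1) / ‖ξ‖) • ξ) z.2
  rw [add_sub_cancel_left, h2] at h3
  linarith

end Gradient

section EnergyFormula

variable {k : ℕ} {p : ℝ} {f : ℝ × EuclideanSpace ℝ (Fin (k + 1)) → ℝ}

theorem lp_dxi_eq_dirNorm (hp : 1 ≤ p) (hf : ContDiff ℝ 1 f) (hfc : HasCompactSupport f)
    (ξ : EuclideanSpace ℝ (Fin (k + 1))) :
    lp (k + 2) p (dxi (n := k + 2) f ξ) =
      dirNorm p (volume.restrict {z | 0 < z.1}) (gradSnd f) ξ := by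
  rw [dirNorm_eq hp (memLp_gradSnd hf hfc _ _)]
  change (∫ y in {z : ℝ × EuclideanSpace ℝ (Fin (k + 1)) | 0 < z.1},
    |fderiv ℝ f y (0, ξ)| ^ p) ^ p⁻¹ = _
  simp only [fderiv_zero_prod hf, real_inner_comm ξ]

theorem cc_rpow {m : ℕ} (hm : 1 ≤ m) (hp : 0 < p) :
    cc m p ^ p = (m * w m) ^ (1 + p / m) / sphMoment m p := by
  have hm' : (1 : ℝ) ≤ m := by exact_mod_cast hm
  have h1 : 0 < w m := w_pos (by linarith)
  have h2 : 0 < w (p - 1) := w_pos (by linarith)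
  have h3 : 0 < w ((m : ℝ) + p - 2) := w_pos (by linarith)
  rw [cc, Real.mul_rpow (by positivity) (by positivity), Real.rpow_inv_rpow (by positivity) hp.ne',
    ← Real.rpow_mul (by positivity), Real.rpow_add (by positivity), Real.rpow_one, sphMoment,
    inv_mul_eq_div]
  field_simp

theorem Ep_rpow (hp : 1 ≤ p) (hf : ContDiff ℝ 1 f) (hfc : HasCompactSupport f) :
    Ep (k + 2) p f ^ p =
      affEnergy (k + 1) p (dirNorm p (volume.restrict {z | 0 < z.1}) (gradSnd f)) := by
  have hp0 : 0 < p := by linarith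
  have hcast : 1 - ((k + 2 : ℕ) : ℝ) = -((k + 1 : ℕ) : ℝ) := by push_cast; ring
  have hZ : Z (k + 2) p f = (∫ ξ, dirNorm p (volume.restrict {z | 0 < z.1}) (gradSnd f)
      (ξ : EuclideanSpace ℝ (Fin (k + 1))) ^ (-((k + 1 : ℕ) : ℝ)) ∂(sphMeasure (k + 1))) ^
        (-((k + 1 : ℕ) : ℝ))⁻¹ := by
    rw [← hcast]
    simp only [← lp_dxi_eq_dirNorm hp hf hfc]
    rfl
  have hJ : 0 ≤ ∫ ξ, dirNorm p (volume.restrict {z | 0 < z.1}) (gradSnd f)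
      (ξ : EuclideanSpace ℝ (Fin (k + 1))) ^ (-((k + 1 : ℕ) : ℝ)) ∂(sphMeasure (k + 1)) :=
    integral_nonneg fun ξ => Real.rpow_nonneg (dirNorm_nonneg _) _
  have hcc : 0 ≤ cc (k + 1) p := by
    have h1 : 0 < w (k + 1 : ℕ) := w_pos (by linarith [(k + 1 : ℕ).cast_nonneg (α := ℝ)])
    have h2 : 0 < w (p - 1) := w_pos (by linarith)
    have h3 : 0 < w (((k + 1 : ℕ) : ℝ) + p - 2) :=
      w_pos (by linarith [(k + 1 : ℕ).cast_nonneg (α := ℝ)])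
    rw [cc]
    positivity
  rw [Ep, hZ]
  change (cc (k + 1) p * _) ^ p = _
  rw [Real.mul_rpow hcc (Real.rpow_nonneg hJ _), cc_rpow (by lia) hp0, ← Real.rpow_mul hJ,
    affEnergy, inv_neg, neg_mul, inv_mul_eq_div, neg_div]

end EnergyFormula

section Main

variable {k : ℕ} {p : ℝ} {f : ℝ × EuclideanSpace ℝ (Fin (k + 1)) → ℝ}

theorem affEnergy_nonneg {m : ℕ} (hm : 1 ≤ m) (hp : 0 < p) {N : EuclideanSpace ℝ (Fin m) → ℝ}
    (hN : ∀ ξ, 0 ≤ N ξ) : 0 ≤ affEnergy m p N := by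
  have hm' : (1 : ℝ) ≤ m := by exact_mod_cast hm
  have h1 : 0 < w m := w_pos (by linarith)
  have h2 := sphMoment_pos hm hp
  have h3 : 0 ≤ ∫ ξ, N (ξ : EuclideanSpace ℝ (Fin m)) ^ (-(m : ℝ)) ∂(sphMeasure m) :=
    integral_nonneg fun ξ => Real.rpow_nonneg (hN _) _
  rw [affEnergy]
  positivity

theorem integrable_dt_rpow (hp : 0 < p) (hf : ContDiff ℝ 1 f) (hfc : HasCompactSupport f)
    (s : Set (ℝ × EuclideanSpace ℝ (Fin (k + 1)))) :
    IntegrableOn (fun z => |fderiv ℝ f z (1, 0)| ^ p) s := by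
  have hc : Continuous fun z => fderiv ℝ f z (1, 0) :=
    (hf.continuous_fderiv one_ne_zero).clm_apply continuous_const
  refine ((hc.abs.rpow_const fun _ => Or.inr hp.le).integrable_of_hasCompactSupport ?_).integrableOn
  refine (hfc.fderiv ℝ).mono fun z hz h => hz ?_
  simp [h, hp.ne']

theorem integrable_gradSnd_rpow (hp : 0 < p) (hf : ContDiff ℝ 1 f) (hfc : HasCompactSupport f)
    (s : Set (ℝ × EuclideanSpace ℝ (Fin (k + 1)))) :
    IntegrableOn (fun z => ‖gradSnd f z‖ ^ p) s := by
  have := (memLp_gradSnd hf hfc (ENNReal.ofReal p) s).integrable_norm_rpow (by simpa using hp)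
    ENNReal.ofReal_ne_top
  rwa [ENNReal.toReal_ofReal hp.le] at this

theorem lp_dt_rpow (hp : 0 < p) : lp (k + 2) p (dt (n := k + 2) f) ^ p =
    ∫ z in {z : ℝ × EuclideanSpace ℝ (Fin (k + 1)) | 0 < z.1}, |fderiv ℝ f z (1, 0)| ^ p := by
  rw [lp, Real.rpow_inv_rpow (integral_nonneg fun z => by positivity) hp.ne']
  rfl

theorem trace_le_affEnergy {q : ℝ} (hp : 1 < p) (hpm : p < (k + 1 : ℕ) + 1) (hq : q = p / (p - 1))
    (hf : ContDiff ℝ 1 f) (hfc : HasCompactSupport f)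
    (h0 : ∀ ξ, ξ ≠ 0 → 0 < dirNorm p (volume.restrict {z | 0 < z.1}) (gradSnd f) ξ) :
    (∫ x, |f (0, x)| ^ (p * (k + 1 : ℕ) / ((k + 1 : ℕ) + 1 - p))) ^
        (((k + 1 : ℕ) + 1 - p) / (k + 1 : ℕ)) ≤
      (p ^ p⁻¹ * q ^ q⁻¹) ^ (-p⁻¹) * (p * A (k + 2) p) *
        (affEnergy (k + 1) p (dirNorm p (volume.restrict {z | 0 < z.1}) (gradSnd f)) +
          ∫ z in {z | 0 < z.1}, |fderiv ℝ f z (1, 0)| ^ p) := by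
  have hp0 : 0 < p := by linarith
  have hp1 : 0 < p - 1 := by linarith
  have hq0 : 0 < q := by rw [hq]; positivity
  have hG := memLp_gradSnd hf hfc (ENNReal.ofReal p) {z | 0 < z.1}
  have hGm := (continuous_gradSnd hf).measurable
  obtain ⟨h, ν, hhm, hh0, hνc, hν0, hhν, hvol, hE⟩ := exists_dual_pair hp.le hGm hG h0
  have hw : 0 < w (k + 1 : ℕ) := w_pos (by linarith [(k + 1 : ℕ).cast_nonneg (α := ℝ)])
  have hlow := le_lintegral_halfSpace (by lia) hp hpm hq hνc hν0 hw.le hvol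
  have hE0 := affEnergy_nonneg (m := k + 1) (by lia) hp0
    (dirNorm_nonneg (p := p) (μ := volume.restrict {z | 0 < z.1}) (G := gradSnd f))
  have ht0 : 0 ≤ ∫ z in {z : ℝ × EuclideanSpace ℝ (Fin (k + 1)) | 0 < z.1},
    |fderiv ℝ f z (1, 0)| ^ p := integral_nonneg fun z => by positivity
  have hdt : Measurable fun z => |fderiv ℝ f z (1, 0)| ^ p :=
    (((hf.continuous_fderiv one_ne_zero).clm_apply continuous_const).abs.rpow_const
      fun _ => Or.inr hp0.le).measurable
  have hmp : 0 < ((k + 1 : ℕ) : ℝ) + 1 - p := by linarith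
  have hg1 := Real.Gamma_pos_of_pos (show 0 < ((k + 1 : ℕ) : ℝ) / q + 1 by positivity)
  have hg2 := Real.Gamma_pos_of_pos (show 0 < ((k + 1 : ℕ) : ℝ) / p by positivity)
  have hg3 := Real.Gamma_pos_of_pos (show 0 < ((k + 1 : ℕ) : ℝ) by positivity)
  refine (trace_le_of_le_lintegral (by lia) hp hpm hq rfl hf hfc hGm (fderiv_zero_prod hf) hνc hν0
    hhm hh0 hhν (add_nonneg hE0 ht0) ?_ (by positivity) hlow).trans
      (mul_le_mul_of_nonneg_right (sharp_constant_le hp hpm hq) (add_nonneg hE0 ht0))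
  rw [ENNReal.ofReal_add hE0 ht0, ← hE, ofReal_integral_eq_lintegral_ofReal
    (integrable_dt_rpow hp0 hf hfc _) (Filter.Eventually.of_forall fun z => by positivity),
    add_comm (∫⁻ _, _ ∂_), ← lintegral_add_left hdt.ennreal_ofReal]
  refine lintegral_mono fun z => ?_
  rw [ENNReal.ofReal_add (by positivity) (Real.rpow_nonneg (hh0 _) _)]

theorem affEnergy_dirNorm_gradSnd_eq_zero (hp : 0 < p)
    (hz : ∀ z : ℝ × EuclideanSpace ℝ (Fin (k + 1)), 0 < z.1 → gradSnd f z = 0) :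
    affEnergy (k + 1) p (dirNorm p (volume.restrict {z | 0 < z.1}) (gradSnd f)) = 0 := by
  have hm : (0 : ℝ) < (k + 1 : ℕ) := by positivity
  have h1 : ∀ ξ, dirNorm p (volume.restrict {z | 0 < z.1}) (gradSnd f) ξ = 0 := by
    intro ξ
    have hae : (fun z => ⟪ξ, gradSnd f z⟫) =ᵐ[volume.restrict {z | 0 < z.1}] 0 := by
      filter_upwards [ae_restrict_mem (measurableSet_lt measurable_const measurable_fst)] with z h
      rw [hz z h, inner_zero_right, Pi.zero_apply]
    rw [dirNorm, eLpNorm_congr_ae hae, eLpNorm_zero, ENNReal.toReal_zero]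
  simp only [affEnergy, h1, Real.zero_rpow (neg_ne_zero.2 hm.ne'), integral_zero]
  rw [Real.zero_rpow (div_ne_zero (neg_ne_zero.2 hp.ne') hm.ne'), mul_zero]

theorem affine_trace_of_contDiff {q : ℝ} (hp : 1 < p) (hpm : p < (k + 1 : ℕ) + 1)
    (hq : q = p / (p - 1)) (hf : ContDiff ℝ 1 f) (hfc : HasCompactSupport f) :
    (∫ x, |f (0, x)| ^ (p * (k + 1 : ℕ) / ((k + 1 : ℕ) + 1 - p))) ^
        (((k + 1 : ℕ) + 1 - p) / (k + 1 : ℕ)) ≤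
      (p ^ p⁻¹ * q ^ q⁻¹) ^ (-p⁻¹) * (p * A (k + 2) p) *
        (affEnergy (k + 1) p (dirNorm p (volume.restrict {z | 0 < z.1}) (gradSnd f)) +
          ∫ z in {z | 0 < z.1}, |fderiv ℝ f z (1, 0)| ^ p) ∧
    affEnergy (k + 1) p (dirNorm p (volume.restrict {z | 0 < z.1}) (gradSnd f)) ≤
      ∫ z in {z | 0 < z.1}, ‖gradSnd f z‖ ^ p := by
  have hp0 : 0 < p := by linarith
  have hp1 : 0 < p - 1 := by linarith
  have hmp : 0 < ((k + 1 : ℕ) : ℝ) + 1 - p := by linarith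
  have hm : (0 : ℝ) < (k + 1 : ℕ) := by positivity
  by_cases h0 : ∀ ξ, ξ ≠ 0 → 0 < dirNorm p (volume.restrict {z | 0 < z.1}) (gradSnd f) ξ
  · exact ⟨trace_le_affEnergy hp hpm hq hf hfc h0, affEnergy_le hp.le
      (continuous_gradSnd hf).measurable (memLp_gradSnd hf hfc _ _) h0⟩
  push Not at h0
  obtain ⟨ξ, hξ, hle⟩ := h0
  have hz : ∀ z : ℝ × EuclideanSpace ℝ (Fin (k + 1)), 0 ≤ z.1 → f z = 0 := fun z hz =>
    eq_zero_of_dirNorm_eq_zero hp.le hf hfc hξ (hle.antisymm (dirNorm_nonneg ξ)) hz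
  have hgrad : ∀ z : ℝ × EuclideanSpace ℝ (Fin (k + 1)), 0 < z.1 → gradSnd f z = 0 := by
    intro z hz'
    have : f =ᶠ[nhds z] fun _ => 0 := by
      filter_upwards [(isOpen_lt continuous_const continuous_fst).mem_nhds hz'] with y hy
      exact hz y (le_of_lt hy)
    rw [gradSnd_eq hf, this.fderiv_eq, fderiv_fun_const, Pi.zero_apply,
      ContinuousLinearMap.zero_comp, map_zero]
  rw [affEnergy_dirNorm_gradSnd_eq_zero hp0 hgrad]
  refine ⟨?_, integral_nonneg fun z => by positivity⟩
  have h1 : ∀ x, |f (0, x)| ^ (p * (k + 1 : ℕ) / ((k + 1 : ℕ) + 1 - p)) = 0 := fun x => by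
    rw [hz _ le_rfl, abs_zero, Real.zero_rpow (by positivity)]
  have hq0 : 0 < q := by rw [hq]; positivity
  have hA := A_nonneg (n := k + 2) (p := p) (by lia) hp (by push_cast at hpm ⊢; linarith)
  simp only [h1, integral_zero]
  rw [Real.zero_rpow (by positivity)]
  have ht0 : 0 ≤ ∫ z in {z : ℝ × EuclideanSpace ℝ (Fin (k + 1)) | 0 < z.1},
    |fderiv ℝ f z (1, 0)| ^ p := integral_nonneg fun z => by positivity
  positivity

end Main

/-- The affine `L^p` trace inequality implies, via Young's inequality, the additive form
with constant `d₂ = (p^{1/p} q^{1/q})^{-1/p} p 𝒜_{n,p}`. -/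
theorem affine_trace_additive_form (n : ℕ) (hn : 3 ≤ n) (p q : ℝ) (hp : 1 < p) (hpn : p < n)
    (hq : q = p / (p - 1))
    (f : ℝ × EuclideanSpace ℝ (Fin (n - 1)) → ℝ) (hf : ContDiff ℝ (⊤ : ℕ∞) f)
    (hfc : HasCompactSupport f) :
    bdry n (p * ((n : ℝ) - 1) / ((n : ℝ) - p)) f ^ (((n : ℝ) - p) / ((n : ℝ) - 1)) ≤
        (p ^ p⁻¹ * q ^ q⁻¹) ^ (-p⁻¹) * (p * A n p) *
          (Ep n p f ^ p + lp n p (dt f) ^ p) ∧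
      (p ^ p⁻¹ * q ^ q⁻¹) ^ (-p⁻¹) * (p * A n p) * (Ep n p f ^ p + lp n p (dt f) ^ p) ≤
        (p ^ p⁻¹ * q ^ q⁻¹) ^ (-p⁻¹) * (p * A n p) *
          ∫ y in H n, (‖gradx f y‖ ^ p + |dt f y| ^ p) := by
  obtain ⟨k, rfl⟩ : ∃ k, n = k + 2 := ⟨n - 2, by lia⟩
  have hp0 : 0 < p := by linarith
  have hp1 : 0 < p - 1 := by linarith
  have hq0 : 0 < q := by rw [hq]; positivity
  have hcast : ((k + 2 : ℕ) : ℝ) = (k + 1 : ℕ) + 1 := by push_cast; ring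
  have hf1 : ContDiff ℝ 1 f := hf.of_le (by exact_mod_cast le_top)
  have hA := A_nonneg (by lia) hp hpn
  obtain ⟨h1, h2⟩ := affine_trace_of_contDiff (k := k) (f := f) hp (hcast ▸ hpn) hq hf1 hfc
  have hE := Ep_rpow (k := k) (f := f) hp.le hf1 hfc
  have ht := lp_dt_rpow (k := k) (f := f) hp0
  rw [← hE, ← ht] at h1
  rw [← hE] at h2
  refine ⟨?_, mul_le_mul_of_nonneg_left ?_ (by positivity)⟩
  · rw [hcast, add_sub_cancel_right]
    exact h1
  · have h3 := add_le_add h2 ht.le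
    rw [← integral_add (integrable_gradSnd_rpow hp0 hf1 hfc _)
      (integrable_dt_rpow hp0 hf1 hfc _)] at h3
    exact h3

end AffineTrace
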